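/- arXiv:1111.0925 — 2 statements merged into one kernel-verified Lean document; each statement's English description precedes it below -/
import Mathlib

section
/- For every A > 0 and every ε > 0 there exists C > 0 such that the following holds. Let x ≥ 2 be half an odd integer (i.e. 2x is an odd integer), let c ∈ ℂ with |Re c| ≤ A/log x, write γ = Re c, set η = 1/log x + max(1, 1 − γ), and let Q ≥ 1. Then | D_c(x) − (1/(2π)) ∫_{−Q}^{Q} ζ(η + it) ζ(η + it + c) x^{η + it} / (η + it) dt | ≤ C x^{1 + ε} (log x) / Q. -/
open Complex Real

/-- The divisor function `σ_q(n) = ∑_{d ∣ n} d^q` for complex `q`. -/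
noncomputable def csigma (q : ℂ) (n : ℕ) : ℂ :=
  ∑ d ∈ n.divisors, (d : ℂ) ^ q

/-- `D_c(x) = ∑_{n ≤ x} σ_{-c}(n)`. -/
noncomputable def Dsum (c : ℂ) (x : ℝ) : ℂ :=
  ∑ n ∈ Finset.Icc 1 ⌊x⌋₊, csigma (-c) n

lemma pt_horiz (u a b q : ℝ) (hu : u ≠ 0) (hab : a ≤ b) (hq : q ≠ 0) :
    ‖∫ σ in a..b, Complex.exp (u * ((σ : ℂ) + q * I)) / ((σ : ℂ) + q * I)‖
      ≤ (Real.exp (u * b) - Real.exp (u * a)) / (u * |q|) := by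
  have h1 : ∫ σ in a..b, Real.exp (u * σ) / |q| =
      (Real.exp (u * b) - Real.exp (u * a)) / (u * |q|) := by
    rw [intervalIntegral.integral_div, intervalIntegral.integral_comp_mul_left (fun x => Real.exp x) hu,
      integral_exp, smul_eq_mul]
    have : |q| ≠ 0 := abs_ne_zero.mpr hq
    field_simp
  rw [← h1]
  apply intervalIntegral.norm_integral_le_of_norm_le hab
  · refine Filter.Eventually.of_forall fun t _ => ?_
    rw [norm_div, Complex.norm_exp]
    have e1 : ((u : ℂ) * ((t : ℂ) + q * I)).re = u * t := by simp
    rw [e1]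
    have e2 : |q| ≤ ‖(t : ℂ) + q * I‖ := by
      have := Complex.abs_im_le_norm ((t : ℂ) + q * I)
      simpa using this
    have : 0 < |q| := abs_pos.mpr hq
    gcongr
  · apply Continuous.intervalIntegrable
    fun_prop

lemma pt_vert (a Q : ℝ) (hQ : 0 < Q) (K : ℝ) (f : ℂ → ℂ)
    (hf : ∀ t : ℝ, ‖f ((a : ℂ) + t * I)‖ ≤ K / |a|) :
    ‖∫ t in (-Q)..Q, f ((a : ℂ) + t * I)‖ ≤ 2 * Q * K / |a| := by
  have := intervalIntegral.norm_integral_le_of_norm_le_const (a := -Q) (b := Q)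
    (f := fun t : ℝ => f ((a : ℂ) + t * I)) (C := K / |a|) (fun t _ => hf t)
  refine this.trans (le_of_eq ?_)
  rw [abs_of_pos (a := Q - -Q) (by linarith)]
  ring

lemma pt_le_of_forall {A B K : ℝ} (R₀ : ℝ) (h : ∀ R, R₀ < R → 0 < R → A ≤ B + K / R) : A ≤ B := by
  have h1 : Filter.Tendsto (fun R : ℝ => B + K / R) Filter.atTop (nhds (B + 0)) := by
    apply Filter.Tendsto.add tendsto_const_nhds
    exact Filter.Tendsto.div_atTop tendsto_const_nhds Filter.tendsto_id
  rw [add_zero] at h1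
  refine ge_of_tendsto h1 ?_
  filter_upwards [Filter.eventually_gt_atTop R₀, Filter.eventually_gt_atTop 0] with R h1 h2
  exact h R h1 h2

lemma pt_abs_le (a t : ℝ) : |a| ≤ ‖(a : ℂ) + t * I‖ := by
  have := Complex.abs_re_le_norm ((a : ℂ) + t * I)
  simpa using this

lemma pt_neg (u η Q : ℝ) (hu : u < 0) (hη : 0 < η) (hQ : 0 < Q) :
    ‖∫ t in (-Q)..Q, Complex.exp (u * ((η : ℂ) + t * I)) / ((η : ℂ) + t * I)‖
      ≤ 2 * Real.exp (u * η) / (Q * |u|) := by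
  apply pt_le_of_forall (K := 2 * Q) η
  intro R hR hR0
  have hd : DifferentiableOn ℂ (fun s : ℂ => Complex.exp (u * s) / s)
      (Set.uIcc η R ×ℂ Set.uIcc (-Q) Q) := by
    intro s hs
    apply DifferentiableAt.differentiableWithinAt
    have hs1 := (Complex.mem_reProdIm.mp hs).1
    rw [Set.uIcc_of_le hR.le] at hs1
    have : s ≠ 0 := by
      rintro rfl
      have := hs1.1
      simp at this
      linarith
    fun_prop (disch := assumption)
  have h := Complex.integral_boundary_rect_eq_zero_of_differentiableOn
    (fun s : ℂ => Complex.exp (u * s) / s) (⟨η, -Q⟩ : ℂ) (⟨R, Q⟩ : ℂ) hd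
  simp only [smul_eq_mul] at h
  have b1 := pt_horiz u η R (-Q) hu.ne hR.le (by linarith)
  have b2 := pt_horiz u η R Q hu.ne hR.le (by linarith)
  have b3 := pt_vert R Q hQ 1 (fun s : ℂ => Complex.exp (u * s) / s) (by
    intro t
    have := pt_abs_le R t
    have hR' : 0 < |R| := abs_pos.mpr hR0.ne'
    rw [norm_div, Complex.norm_exp]
    have e1 : ((u : ℂ) * ((R : ℂ) + t * I)).re = u * R := by simp
    rw [e1]
    have : Real.exp (u * R) ≤ 1 := Real.exp_le_one_iff.mpr (by nlinarith)
    gcongr)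
  rw [abs_neg] at b1
  rw [abs_of_pos hQ] at b1 b2
  rw [abs_of_pos hR0, mul_one] at b3
  set X1 := ∫ σ in η..R, Complex.exp (u * ((σ : ℂ) + (-Q : ℝ) * I)) / ((σ : ℂ) + (-Q : ℝ) * I)
  set X2 := ∫ σ in η..R, Complex.exp (u * ((σ : ℂ) + Q * I)) / ((σ : ℂ) + Q * I)
  set X3 := ∫ t in (-Q)..Q, Complex.exp (u * ((R : ℂ) + t * I)) / ((R : ℂ) + t * I)
  set X4 := ∫ t in (-Q)..Q, Complex.exp (u * ((η : ℂ) + t * I)) / ((η : ℂ) + t * I)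
  have e : I * X4 = X1 - X2 + I * X3 := by linear_combination -h
  have e' : ‖X4‖ = ‖X1 - X2 + I * X3‖ := by rw [← e]; simp
  rw [e']
  have n1 := norm_add_le (X1 - X2) (I * X3)
  have n2 := norm_sub_le X1 X2
  have n3 : ‖I * X3‖ = ‖X3‖ := by simp
  have n4 : (Real.exp (u * R) - Real.exp (u * η)) / (u * Q) ≤ Real.exp (u * η) / (Q * |u|) := by
    rw [abs_of_neg hu, ← neg_div_neg_eq, show -(u * Q) = Q * -u by ring]
    have : 0 < Q * -u := by nlinarith
    gcongr
    have := Real.exp_pos (u * R)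
    linarith
  have n5 : 2 * Real.exp (u * η) / (Q * |u|) = Real.exp (u * η) / (Q * |u|) + Real.exp (u * η) / (Q * |u|) := by ring
  linarith

lemma pt_atan (a b q : ℝ) (hq : q ≠ 0) :
    ∫ σ in a..b, q / (σ ^ 2 + q ^ 2) = Real.arctan (b / q) - Real.arctan (a / q) := by
  have : ∀ σ ∈ Set.uIcc a b, HasDerivAt (fun σ : ℝ => Real.arctan (σ / q)) (q / (σ ^ 2 + q ^ 2)) σ := by
    intro σ _
    have := ((hasDerivAt_id σ).div_const q).arctan
    convert this using 1
    simp
    have : q ^ 2 + σ ^ 2 ≠ 0 := by positivity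
    have : σ ^ 2 + q ^ 2 ≠ 0 := by positivity
    field_simp
    simp only [id]
    ring
  rw [intervalIntegral.integral_eq_sub_of_hasDerivAt this]
  apply Continuous.intervalIntegrable
  refine Continuous.div (by fun_prop) (by fun_prop) ?_
  intro σ; positivity

lemma pt_ne (σ q : ℝ) (h : σ ≠ 0 ∨ q ≠ 0) : (σ : ℂ) + q * I ≠ 0 := by
  intro h0
  have h1 := congrArg Complex.re h0
  have h2 := congrArg Complex.im h0
  simp at h1 h2
  tauto

lemma pt_inv_rect (η R Q : ℝ) (hη : 0 < η) (hR : 0 < R) (hQ : 0 < Q) :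
    (∫ σ in (-R)..η, 1 / ((σ : ℂ) + (-Q : ℝ) * I)) - (∫ σ in (-R)..η, 1 / ((σ : ℂ) + Q * I))
      + I * (∫ t in (-Q)..Q, 1 / ((η : ℂ) + t * I)) =
    I * ((2 * π - 2 * Real.arctan (Q / R) : ℝ) : ℂ) := by
  have c1 : ∀ q : ℝ, q ≠ 0 → Continuous (fun σ : ℝ => 1 / ((σ : ℂ) + q * I)) := by
    intro q hq
    refine Continuous.div (by fun_prop) (by fun_prop) fun σ => pt_ne σ q (Or.inr hq)
  have c2 : Continuous (fun t : ℝ => 1 / ((η : ℂ) + t * I)) :=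
    Continuous.div (by fun_prop) (by fun_prop) fun σ => pt_ne η σ (Or.inl hη.ne')
  rw [← intervalIntegral.integral_sub ((c1 _ (by linarith)).intervalIntegrable _ _)
    ((c1 _ (by linarith)).intervalIntegrable _ _)]
  have e1 : ∀ σ : ℝ, 1 / ((σ : ℂ) + (-Q : ℝ) * I) - 1 / ((σ : ℂ) + Q * I)
      = (2 * I) * ((Q / (σ ^ 2 + Q ^ 2) : ℝ) : ℂ) := by
    intro σ
    have h1 := pt_ne σ (-Q) (Or.inr (by linarith))
    have h2 := pt_ne σ Q (Or.inr (by linarith))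
    have h3 : ((σ : ℂ) ^ 2 + Q ^ 2) ≠ 0 := by
      have : σ ^ 2 + Q ^ 2 ≠ 0 := by positivity
      exact_mod_cast this
    have h4 : ((σ : ℂ) + (-Q : ℝ) * I) * ((σ : ℂ) + Q * I) = (σ : ℂ) ^ 2 + Q ^ 2 := by
      push_cast
      linear_combination (-(Q : ℂ) ^ 2) * I_sq
    rw [div_sub_div _ _ h1 h2, h4]
    push_cast
    ring
  simp_rw [e1]
  rw [intervalIntegral.integral_const_mul, intervalIntegral.integral_ofReal, pt_atan _ _ _ hQ.ne']
  have e2 : ∫ t in (-Q)..Q, 1 / ((η : ℂ) + t * I) = ((2 * Real.arctan (Q / η) : ℝ) : ℂ) := by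
    have s1 : ∫ t in (-Q)..Q, 1 / ((η : ℂ) + t * I) = ∫ t in (-Q)..Q, 1 / ((η : ℂ) - t * I) := by
      have := intervalIntegral.integral_comp_neg (a := -Q) (b := Q) (fun t : ℝ => 1 / ((η : ℂ) + t * I))
      rw [neg_neg] at this
      rw [← this]
      congr 1
      ext t
      push_cast
      ring
    have s2 : (∫ t in (-Q)..Q, 1 / ((η : ℂ) + t * I)) + ∫ t in (-Q)..Q, 1 / ((η : ℂ) - t * I)
       = 2 * ((2 * Real.arctan (Q / η) : ℝ) : ℂ) := by
      rw [← intervalIntegral.integral_add (c2.intervalIntegrable _ _)]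
      · have : ∀ t : ℝ, 1 / ((η : ℂ) + t * I) + 1 / ((η : ℂ) - t * I)
          = 2 * ((η / (t ^ 2 + η ^ 2) : ℝ) : ℂ) := by
          intro t
          have h1 := pt_ne η t (Or.inl (by linarith))
          have h2 := pt_ne η (-t) (Or.inl (by linarith))
          have h2' : (η : ℂ) - t * I ≠ 0 := by
            convert h2 using 1
            push_cast; ring
          have h4 : ((η : ℂ) + t * I) * ((η : ℂ) - t * I) = (t : ℂ) ^ 2 + η ^ 2 := by
            linear_combination (-(t : ℂ) ^ 2) * I_sq
          rw [div_add_div _ _ h1 h2', h4]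
          push_cast
          ring
        simp_rw [this]
        rw [intervalIntegral.integral_const_mul, intervalIntegral.integral_ofReal, pt_atan _ _ _ hη.ne']
        rw [neg_div, Real.arctan_neg]
        push_cast; ring
      · apply Continuous.intervalIntegrable
        refine Continuous.div (by fun_prop) (by fun_prop) fun t => ?_
        have h2 := pt_ne η (-t) (Or.inl (by linarith))
        convert h2 using 1
        push_cast; ring
    rw [← s1] at s2
    linear_combination s2 / 2
  rw [e2]
  have a1 := Real.arctan_inv_of_pos (div_pos hη hQ)
  have a2 := Real.arctan_inv_of_pos (div_pos hR hQ)
  rw [inv_div] at a1 a2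
  rw [a1, a2, neg_div, Real.arctan_neg]
  push_cast
  ring

lemma pt_pos (u η Q : ℝ) (hu : 0 < u) (hη : 0 < η) (hQ : 0 < Q) :
    ‖(∫ t in (-Q)..Q, Complex.exp (u * ((η : ℂ) + t * I)) / ((η : ℂ) + t * I)) - 2 * π‖
      ≤ 2 * Real.exp (u * η) / (Q * |u|) := by
  apply pt_le_of_forall (K := 2 * Q * 2 + 2 * Q) η
  intro R hR hR0
  set f : ℂ → ℂ := dslope (fun s : ℂ => Complex.exp (u * s)) 0 with hf
  have hfd : Differentiable ℂ f := by
    have : DifferentiableOn ℂ (fun s : ℂ => Complex.exp (u * s)) Set.univ := by fun_prop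
    have := (Complex.differentiableOn_dslope (c := (0 : ℂ)) Filter.univ_mem).mpr this
    exact differentiableOn_univ.mp this
  have hfe : ∀ s : ℂ, s ≠ 0 → f s = Complex.exp (u * s) / s - 1 / s := by
    intro s hs
    rw [hf, dslope_of_ne _ hs, slope_def_field]
    simp
    ring
  have h := Complex.integral_boundary_rect_eq_zero_of_differentiableOn
    f (⟨-R, -Q⟩ : ℂ) (⟨η, Q⟩ : ℂ) hfd.differentiableOn
  simp only [smul_eq_mul] at h
  have c1 : ∀ q : ℝ, q ≠ 0 → Continuous (fun σ : ℝ => 1 / ((σ : ℂ) + q * I)) := by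
    intro q hq
    refine Continuous.div (by fun_prop) (by fun_prop) fun σ => pt_ne σ q (Or.inr hq)
  have c2 : Continuous (fun t : ℝ => 1 / ((η : ℂ) + t * I)) :=
    Continuous.div (by fun_prop) (by fun_prop) fun σ => pt_ne η σ (Or.inl hη.ne')
  have c1' : ∀ q : ℝ, q ≠ 0 → Continuous (fun σ : ℝ => Complex.exp (u * ((σ : ℂ) + q * I)) / ((σ : ℂ) + q * I)) := by
    intro q hq
    refine Continuous.div (by fun_prop) (by fun_prop) fun σ => pt_ne σ q (Or.inr hq)
  have c2' : Continuous (fun t : ℝ => Complex.exp (u * ((η : ℂ) + t * I)) / ((η : ℂ) + t * I)) :=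
    Continuous.div (by fun_prop) (by fun_prop) fun σ => pt_ne η σ (Or.inl hη.ne')
  have g1 : ∀ q : ℝ, q ≠ 0 → ∫ σ in (-R)..η, f ((σ : ℂ) + q * I) =
      (∫ σ in (-R)..η, Complex.exp (u * ((σ : ℂ) + q * I)) / ((σ : ℂ) + q * I)) -
       ∫ σ in (-R)..η, 1 / ((σ : ℂ) + q * I) := by
    intro q hq
    rw [← intervalIntegral.integral_sub ((c1' q hq).intervalIntegrable _ _) ((c1 q hq).intervalIntegrable _ _)]
    congr 1
    ext σ
    exact hfe _ (pt_ne σ q (Or.inr hq))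
  have g2 : ∫ t in (-Q)..Q, f ((η : ℂ) + t * I) =
      (∫ t in (-Q)..Q, Complex.exp (u * ((η : ℂ) + t * I)) / ((η : ℂ) + t * I)) -
       ∫ t in (-Q)..Q, 1 / ((η : ℂ) + t * I) := by
    rw [← intervalIntegral.integral_sub (c2'.intervalIntegrable _ _) (c2.intervalIntegrable _ _)]
    congr 1
    ext t
    exact hfe _ (pt_ne η t (Or.inl hη.ne'))
  rw [g1 _ (by linarith), g1 _ (by linarith), g2] at h
  have hr := pt_inv_rect η R Q hη hR0 hQ
  have b1 := pt_horiz u (-R) η (-Q) hu.ne' (by linarith) (by linarith)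
  have b2 := pt_horiz u (-R) η Q hu.ne' (by linarith) (by linarith)
  have b3 := pt_vert (-R) Q hQ 2 f (by
    intro t
    have h1 := pt_abs_le (-R) t
    have hR' : 0 < |-R| := abs_pos.mpr (by linarith)
    rw [hfe _ (pt_ne (-R) t (Or.inl (by linarith))), ← sub_div, norm_div]
    have : ‖Complex.exp (u * (((-R : ℝ) : ℂ) + t * I)) - 1‖ ≤ 2 := by
      refine (norm_sub_le _ _).trans ?_
      rw [Complex.norm_exp]
      have e1 : ((u : ℂ) * (((-R : ℝ) : ℂ) + t * I)).re = u * -R := by simp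
      rw [e1]
      have : Real.exp (u * -R) ≤ 1 := Real.exp_le_one_iff.mpr (by nlinarith)
      simp only [norm_one]
      linarith
    gcongr)
  rw [abs_neg] at b1 b3
  rw [abs_of_pos hQ] at b1 b2
  rw [abs_of_pos hR0] at b3
  set X1 := ∫ σ in (-R)..η, Complex.exp (u * ((σ : ℂ) + (-Q : ℝ) * I)) / ((σ : ℂ) + (-Q : ℝ) * I)
  set X2 := ∫ σ in (-R)..η, Complex.exp (u * ((σ : ℂ) + Q * I)) / ((σ : ℂ) + Q * I)
  set X3 := ∫ t in (-Q)..Q, f (((-R : ℝ) : ℂ) + t * I)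
  set X4 := ∫ t in (-Q)..Q, Complex.exp (u * ((η : ℂ) + t * I)) / ((η : ℂ) + t * I)
  have e : I * (X4 - 2 * π) = X2 - X1 + I * X3 - I * ((2 * Real.arctan (Q / R) : ℝ) : ℂ) := by
    push_cast at h hr ⊢
    linear_combination h + hr
  have e' : ‖X4 - 2 * π‖ = ‖X2 - X1 + I * X3 - I * ((2 * Real.arctan (Q / R) : ℝ) : ℂ)‖ := by
    rw [← e]; simp
  rw [e']
  have n0 := norm_sub_le (X2 - X1 + I * X3) (I * ((2 * Real.arctan (Q / R) : ℝ) : ℂ))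
  have n1 := norm_add_le (X2 - X1) (I * X3)
  have n2 := norm_sub_le X2 X1
  have n3 : ‖I * X3‖ = ‖X3‖ := by simp
  have n6 : ‖I * ((2 * Real.arctan (Q / R) : ℝ) : ℂ)‖ ≤ 2 * Q / R := by
    rw [norm_mul, Complex.norm_I, one_mul, Complex.norm_real, Real.norm_eq_abs]
    have hq : 0 < Q / R := div_pos hQ hR0
    have : 0 < Real.arctan (Q / R) := Real.arctan_pos.mpr hq
    rw [abs_of_pos (by linarith)]
    have : Real.arctan (Q / R) ≤ Q / R := by
      have := Real.le_tan this.le (Real.arctan_lt_pi_div_two _)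
      rwa [Real.tan_arctan] at this
    calc _ ≤ 2 * (Q / R) := by linarith
      _ = _ := by ring
  have n4 : (Real.exp (u * η) - Real.exp (u * -R)) / (u * Q) ≤ Real.exp (u * η) / (Q * |u|) := by
    rw [abs_of_pos hu, mul_comm Q u]
    gcongr
    have := Real.exp_pos (u * -R)
    linarith
  have n5 : 2 * Real.exp (u * η) / (Q * |u|) = Real.exp (u * η) / (Q * |u|) + Real.exp (u * η) / (Q * |u|) := by ring
  have n7 : (2 * Q * 2 + 2 * Q) / R = 2 * Q * 2 / R + 2 * Q / R := by ring
  linarith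

lemma pt_perron (u η Q : ℝ) (hu : u ≠ 0) (hη : 0 < η) (hQ : 0 < Q) :
    ‖(if 0 < u then (1 : ℂ) else 0) -
      (1 / (2 * π)) * ∫ t in (-Q)..Q, Complex.exp (u * ((η : ℂ) + t * I)) / ((η : ℂ) + t * I)‖
      ≤ Real.exp (u * η) / (Q * |u|) := by
  have hp : (0 : ℝ) < 2 * π := by positivity
  have hpc : (π : ℂ) ≠ 0 := by exact_mod_cast Real.pi_pos.ne'
  have key : ‖(∫ t in (-Q)..Q, Complex.exp (u * ((η : ℂ) + t * I)) / ((η : ℂ) + t * I)) -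
     2 * π * (if 0 < u then (1 : ℂ) else 0)‖ ≤ 2 * Real.exp (u * η) / (Q * |u|) := by
    split_ifs with h
    · simpa using pt_pos u η Q h hη hQ
    · simpa using pt_neg u η Q (lt_of_le_of_ne (not_lt.mp h) hu) hη hQ
  set X := ∫ t in (-Q)..Q, Complex.exp (u * ((η : ℂ) + t * I)) / ((η : ℂ) + t * I)
  set d := (if 0 < u then (1 : ℂ) else 0)
  have e : d - (1 / (2 * π)) * X = -(1 / (2 * π) : ℝ) * (X - 2 * π * d) := by
    push_cast; field_simp; ring
  rw [e, norm_mul, norm_neg, Complex.norm_real, Real.norm_eq_abs, abs_of_pos (by positivity)]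
  have : 1 / (2 * π) ≤ 1 / 2 := by
    have := Real.pi_gt_three
    gcongr; linarith
  calc _ ≤ 1 / 2 * (2 * Real.exp (u * η) / (Q * |u|)) := by gcongr
    _ = _ := by ring
lemma pt_div (ε : ℝ) (hε : 0 < ε) : ∃ C : ℝ, 0 < C ∧ ∀ n : ℕ, 1 ≤ n →
    (n.divisors.card : ℝ) ≤ C * (n : ℝ) ^ ε := by
  have hl2 : 0 < Real.log 2 := Real.log_pos (by norm_num)
  set K : ℝ := 1 + 1 / (ε * Real.log 2) with hK
  have hKi : 0 < 1 / (ε * Real.log 2) := by positivity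
  have hK1 : 1 ≤ K := by linarith
  set P : ℕ := ⌈(2 : ℝ) ^ (1 / ε)⌉₊ with hP
  refine ⟨K ^ P, by positivity, fun n hn => ?_⟩
  have hn0 : n ≠ 0 := by omega
  have small : ∀ p a : ℕ, 2 ≤ p → ((a : ℝ) + 1) ≤ K * ((p : ℝ) ^ ε) ^ a := by
    intro p a hp
    have hp' : (2 : ℝ) ≤ p := by exact_mod_cast hp
    have h1 : 1 + ε * Real.log 2 * a ≤ ((p : ℝ) ^ ε) ^ a := by
      calc 1 + ε * Real.log 2 * a ≤ Real.exp (ε * Real.log 2 * a) := by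
            have := Real.add_one_le_exp (ε * Real.log 2 * a); linarith
        _ = ((2 : ℝ) ^ ε) ^ a := by
            rw [Real.rpow_def_of_pos (by norm_num), ← Real.exp_nat_mul]
            congr 1; ring
        _ ≤ _ := by gcongr
    have h2 : (a : ℝ) + 1 ≤ K * (1 + ε * Real.log 2 * a) := by
      have e : K * (1 + ε * Real.log 2 * a) = K + ε * Real.log 2 * a + a := by
        rw [hK]; field_simp; ring
      rw [e]
      have : 0 ≤ ε * Real.log 2 * a := by positivity
      linarith
    exact h2.trans (by gcongr)
  have large : ∀ p a : ℕ, P ≤ p → ((a : ℝ) + 1) ≤ ((p : ℝ) ^ ε) ^ a := by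
    intro p a hp
    have h0 : (2 : ℝ) ^ (1 / ε) ≤ p := (Nat.le_ceil _).trans (by exact_mod_cast hp)
    have h1 : (2 : ℝ) ≤ (p : ℝ) ^ ε := by
      calc (2 : ℝ) = ((2 : ℝ) ^ (1 / ε)) ^ ε := by
            rw [← Real.rpow_mul (by norm_num)]
            rw [one_div_mul_cancel hε.ne', Real.rpow_one]
        _ ≤ _ := by gcongr
    calc ((a : ℝ) + 1) ≤ 2 ^ a := by
            have : a + 1 ≤ 2 ^ a := Nat.lt_two_pow_self
            exact_mod_cast this
      _ ≤ _ := by gcongr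
  have hfac : (n : ℝ) ^ ε = ∏ p ∈ n.primeFactors, ((p : ℝ) ^ ε) ^ (n.factorization p) := by
    have h : (n : ℝ) = ∏ p ∈ n.primeFactors, (p : ℝ) ^ (n.factorization p) := by
      conv_lhs => rw [← Nat.prod_factorization_pow_eq_self hn0]
      rw [Finsupp.prod]
      push_cast
      rfl
    conv_lhs => rw [h]
    rw [← Real.finsetProd_rpow _ _ (fun i _ => by positivity)]
    refine Finset.prod_congr rfl fun p _ => ?_
    rw [← Real.rpow_natCast, ← Real.rpow_mul (by positivity), ← Real.rpow_natCast, ← Real.rpow_mul (by positivity), mul_comm]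
  rw [Nat.card_divisors hn0, hfac]
  push_cast
  calc ∏ p ∈ n.primeFactors, ((n.factorization p : ℝ) + 1)
      ≤ ∏ p ∈ n.primeFactors, ((if p < P then K else 1) * ((p : ℝ) ^ ε) ^ (n.factorization p)) := by
        refine Finset.prod_le_prod (fun _ _ => by positivity) fun p hp => ?_
        split_ifs with h
        · exact small p _ (Nat.prime_of_mem_primeFactors hp).two_le
        · rw [one_mul]; exact large p _ (not_lt.mp h)
    _ = (∏ p ∈ n.primeFactors, (if p < P then K else 1)) * ∏ p ∈ n.primeFactors, ((p : ℝ) ^ ε) ^ (n.factorization p) :=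
        Finset.prod_mul_distrib
    _ ≤ _ := by
        gcongr
        rw [← Finset.prod_filter, Finset.prod_const]
        apply pow_le_pow_right₀ hK1
        calc _ ≤ (Finset.range P).card := by
              apply Finset.card_le_card
              intro p hp
              simp at hp ⊢
              exact hp.2
          _ = P := Finset.card_range P

lemma pt_zeta (σ : ℝ) (hσ : 1 < σ) : ‖riemannZeta (σ : ℂ)‖ ≤ 1 + 1 / (σ - 1) := by
  have h := ZetaAsymptotics.zeta_limit_aux1 hσ
  have h2 : 0 ≤ ZetaAsymptotics.termTSum σ := tsum_nonneg fun n => ZetaAsymptotics.term_nonneg _ _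
  have h3 : riemannZeta (σ : ℂ) = ((∑' (n : ℕ), 1 / ((n : ℝ) + 1) ^ σ : ℝ) : ℂ) := by
    rw [zeta_eq_tsum_one_div_nat_add_one_cpow (by simpa using hσ), Complex.ofReal_tsum]
    congr 1
    ext n
    rw [Complex.ofReal_div, Complex.ofReal_cpow (by positivity)]
    push_cast
    rfl
  rw [h3, Complex.norm_real, Real.norm_eq_abs, abs_of_nonneg (tsum_nonneg fun n => by positivity)]
  have : 0 ≤ σ * ZetaAsymptotics.termTSum σ := by positivity
  linarith

lemma pt_lser (c s : ℂ) (h1 : 1 < s.re) (h2 : 1 < (s + c).re) :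
    HasSum (fun n : ℕ => csigma (-c) n * Complex.exp (-(s * Real.log n)))
      (riemannZeta s * riemannZeta (s + c)) := by
  have hg : LSeriesHasSum (fun n : ℕ => (n : ℂ) ^ (-c)) s (riemannZeta (s + c)) := by
    have := LSeriesHasSum_one h2
    unfold LSeriesHasSum at this ⊢
    convert this using 1
    ext n
    rw [LSeries.term_def, LSeries.term_def]
    split_ifs with h
    · rfl
    · have : (n : ℂ) ≠ 0 := by exact_mod_cast h
      rw [Pi.one_apply, Complex.cpow_neg, Complex.cpow_add _ _ this]
      field_simp
  have hc := LSeriesHasSum.convolution (LSeriesHasSum_one h1) hg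
  unfold LSeriesHasSum at hc
  convert hc using 1
  ext n
  rw [LSeries.term_def]
  split_ifs with h
  · simp [h, csigma]
  · have hn : (n : ℂ) ≠ 0 := by exact_mod_cast h
    rw [div_eq_mul_inv, ← Complex.cpow_neg, Complex.cpow_def_of_ne_zero hn (-s), LSeries.convolution_def]
    congr 1
    · simp only [csigma, Pi.one_apply, one_mul]
      exact (Nat.sum_divisorsAntidiagonal' (fun _ j => (j : ℂ) ^ (-c))).symm
    · rw [← Complex.ofReal_natCast, ← Complex.ofReal_log (by positivity)]
      congr 1
      ring

lemma pt_sum (k : ℕ) : ∑ n ∈ Finset.Icc 1 (2 * k + 1), 1 / |(k : ℝ) + 1 / 2 - n| ≤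
    4 * (1 + Real.log ((k : ℝ) + 1)) := by
  have h1 : ∑ n ∈ Finset.Icc 1 (2 * k + 1), 1 / |(k : ℝ) + 1 / 2 - n| ≤
      ∑ n ∈ Finset.range ((k + 1) + (k + 1)), 1 / |(k : ℝ) + 1 / 2 - n| := by
    apply Finset.sum_le_sum_of_subset_of_nonneg
    · intro n hn
      simp at hn ⊢
      omega
    · intros; positivity
  have h2 : ∑ j ∈ Finset.range (k + 1), 1 / ((j : ℝ) + 1 / 2) ≤ 2 * (1 + Real.log ((k : ℝ) + 1)) := by
    have h := harmonic_le_one_add_log (k + 1)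
    push_cast [harmonic] at h
    calc _ ≤ ∑ j ∈ Finset.range (k + 1), 2 * ((j : ℝ) + 1)⁻¹ := by
          refine Finset.sum_le_sum fun j _ => ?_
          rw [← div_eq_mul_inv, div_le_div_iff₀ (by positivity) (by positivity)]
          have : (0 : ℝ) ≤ j := by positivity
          linarith
      _ = 2 * ∑ j ∈ Finset.range (k + 1), ((j : ℝ) + 1)⁻¹ := by rw [Finset.mul_sum]
      _ ≤ _ := by gcongr
  refine h1.trans ?_
  rw [Finset.sum_range_add, ← Finset.sum_range_reflect]
  have e1 : ∑ j ∈ Finset.range (k + 1), 1 / |(k : ℝ) + 1 / 2 - ((k + 1 - 1 - j : ℕ) : ℝ)| =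
      ∑ j ∈ Finset.range (k + 1), 1 / ((j : ℝ) + 1 / 2) := by
    refine Finset.sum_congr rfl fun j hj => ?_
    have : j ≤ k := by simp at hj; omega
    rw [Nat.add_sub_cancel, Nat.cast_sub this]
    rw [show (k : ℝ) + 1 / 2 - (k - j) = j + 1 / 2 by ring, abs_of_pos (by positivity)]
  have e2 : ∑ j ∈ Finset.range (k + 1), 1 / |(k : ℝ) + 1 / 2 - ((k + 1 + j : ℕ) : ℝ)| =
      ∑ j ∈ Finset.range (k + 1), 1 / ((j : ℝ) + 1 / 2) := by
    refine Finset.sum_congr rfl fun j hj => ?_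
    push_cast
    rw [show (k : ℝ) + 1 / 2 - (k + 1 + j) = -(j + 1 / 2) by ring, abs_neg, abs_of_pos (by positivity)]
  rw [e1, e2]
  linarith

lemma pt_term (x η : ℝ) (n : ℕ) (hx : 2 ≤ x) (hη : 0 < η) (hn : 1 ≤ n) (hne : x ≠ n) :
    Real.exp ((Real.log x - Real.log n) * η) / |Real.log x - Real.log n| ≤
      2 * Real.exp ((Real.log x - Real.log n) * η) +
        if (x / 2 ≤ n ∧ (n : ℝ) ≤ 2 * x) then Real.exp η * (2 * x) / |x - n| else 0 := by
  have hn' : (0 : ℝ) < n := by exact_mod_cast hn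
  have hx0 : 0 < x := by linarith
  have hl2 := Real.log_two_gt_d9
  have hl2' := Real.log_two_lt_d9
  set u := Real.log x - Real.log n with hu
  have hE := Real.exp_pos (u * η)
  have hu1 : u = Real.log (x / n) := by rw [hu, Real.log_div hx0.ne' hn'.ne']
  have hu2 : -u = Real.log (n / x) := by rw [hu, Real.log_div hn'.ne' hx0.ne']; ring
  have far : 1 / 2 ≤ |u| → Real.exp (u * η) / |u| ≤ 2 * Real.exp (u * η) := by
    intro h
    rw [div_le_iff₀ (by linarith)]
    nlinarith
  split_ifs with h
  · have hd : 0 < |x - n| := abs_pos.mpr (sub_ne_zero.mpr hne)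
    have hlow : |x - n| / (2 * x) ≤ |u| := by
      rcases lt_or_gt_of_ne hne with hlt | hgt
      · have h1 := Real.one_sub_inv_le_log_of_pos (div_pos hn' hx0)
        rw [← hu2, inv_div] at h1
        have h2 : (n - x) / (2 * x) ≤ 1 - x / n := by
          rw [show 1 - x / n = (n - x) / n by field_simp]
          have : 0 ≤ n - x := by linarith
          gcongr
          exact h.2
        rw [abs_of_neg (by linarith : x - n < 0), neg_sub]
        have := neg_abs_le u
        linarith
      · have h1 := Real.one_sub_inv_le_log_of_pos (div_pos hx0 hn')
        rw [← hu1, inv_div] at h1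
        have h2 : (x - n) / (2 * x) ≤ 1 - n / x := by
          rw [show 1 - n / x = (x - n) / x by field_simp]
          have : 0 ≤ x - n := by linarith
          gcongr
          linarith
        rw [abs_of_pos (by linarith : 0 < x - n)]
        have := le_abs_self u
        linarith
    have hule : u ≤ 1 := by
      have : x / n ≤ 2 := by rw [div_le_iff₀ hn']; linarith
      have := Real.log_le_log (div_pos hx0 hn') this
      rw [← hu1] at this
      linarith
    have hE2 : Real.exp (u * η) ≤ Real.exp η := Real.exp_le_exp.mpr (by nlinarith)
    calc Real.exp (u * η) / |u| ≤ Real.exp η / (|x - n| / (2 * x)) := by gcongr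
      _ = Real.exp η * (2 * x) / |x - n| := by field_simp
      _ ≤ _ := by linarith
  · rw [add_zero]
    apply far
    rw [not_and_or, not_le, not_le] at h
    rcases h with h | h
    · have : 2 ≤ x / n := by rw [le_div_iff₀ hn']; linarith
      have := Real.log_le_log (by norm_num) this
      rw [← hu1] at this
      have := le_abs_self u
      linarith
    · have : 2 ≤ n / x := by rw [le_div_iff₀ hx0]; linarith
      have := Real.log_le_log (by norm_num) this
      rw [← hu2] at this
      have := neg_abs_le u
      linarith

/-- The real majorant of `csigma`. -/
noncomputable def rsig (γ : ℝ) (n : ℕ) : ℝ := ∑ d ∈ n.divisors, (d : ℝ) ^ (-γ)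

lemma rsig_nonneg (γ : ℝ) (n : ℕ) : 0 ≤ rsig γ n := Finset.sum_nonneg fun _ _ => by positivity

lemma rsig_cast (γ : ℝ) (n : ℕ) : csigma (-(γ : ℂ)) n = (rsig γ n : ℂ) := by
  unfold csigma rsig
  push_cast
  refine Finset.sum_congr rfl fun d _ => ?_
  rw [Complex.ofReal_cpow (by positivity)]
  push_cast
  rfl

lemma csigma_le (c : ℂ) (n : ℕ) : ‖csigma (-c) n‖ ≤ rsig c.re n := by
  unfold csigma rsig
  refine (norm_sum_le _ _).trans (Finset.sum_le_sum fun d hd => ?_)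
  have : 0 < d := Nat.pos_of_mem_divisors hd
  rw [Complex.norm_natCast_cpow_of_pos this]
  simp

lemma rsig_le (A x γ : ℝ) (hA : 0 < A) (hx : 2 ≤ x) (hγ : |γ| ≤ A / Real.log x) (n : ℕ)
    (hn : (n : ℝ) ≤ 2 * x) : rsig γ n ≤ n.divisors.card * Real.exp (2 * A) := by
  unfold rsig
  have hL : 0 < Real.log x := Real.log_pos (by linarith)
  have h := Finset.sum_le_card_nsmul n.divisors (fun d : ℕ => (d : ℝ) ^ (-γ)) (Real.exp (2 * A)) (by
    intro d hd
    have hd0 : 0 < d := Nat.pos_of_mem_divisors hd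
    have hd1 : (1 : ℝ) ≤ d := by exact_mod_cast hd0
    have hdn : (d : ℝ) ≤ n := by exact_mod_cast Nat.divisor_le hd
    rw [Real.rpow_def_of_pos (by linarith)]
    apply Real.exp_le_exp.mpr
    have h1 : Real.log d ≤ 2 * Real.log x := by
      calc Real.log d ≤ Real.log (x * x) := Real.log_le_log (by linarith) (by nlinarith)
        _ = _ := by rw [Real.log_mul (by linarith) (by linarith)]; ring
    have h0 : 0 ≤ Real.log d := Real.log_nonneg hd1
    calc Real.log d * -γ ≤ Real.log d * |γ| := by
          have := neg_abs_le γ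
          gcongr; linarith
      _ ≤ (2 * Real.log x) * (A / Real.log x) := by gcongr
      _ = 2 * A := by field_simp)
  simpa [nsmul_eq_mul] using h

lemma rsig_hasSum (γ η L : ℝ) (hL : 0 < L) (h1 : 1 + 1 / L ≤ η) (h2 : 1 + 1 / L ≤ η + γ) :
    ∃ Z : ℝ, HasSum (fun n : ℕ => rsig γ n * Real.exp (-(η * Real.log n))) Z ∧ Z ≤ (1 + L) ^ 2 := by
  have hL' : 0 < 1 / L := by positivity
  have h := pt_lser (γ : ℂ) (η : ℂ) (by simp; linarith) (by simp; linarith)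
  have e : ∀ n : ℕ, csigma (-(γ : ℂ)) n * Complex.exp (-((η : ℂ) * Real.log n)) =
      ((rsig γ n * Real.exp (-(η * Real.log n)) : ℝ) : ℂ) := by
    intro n
    rw [rsig_cast]
    push_cast
    rfl
  simp_rw [e] at h
  have hs : Summable (fun n : ℕ => rsig γ n * Real.exp (-(η * Real.log n))) :=
    Complex.summable_ofReal.mp h.summable
  obtain ⟨Z, hZ⟩ := hs
  refine ⟨Z, hZ, ?_⟩
  have hZ' := (Complex.hasSum_ofReal.mpr hZ).unique h
  calc Z ≤ ‖(Z : ℂ)‖ := by rw [Complex.norm_real]; exact le_abs_self Z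
    _ = ‖riemannZeta (η : ℂ)‖ * ‖riemannZeta ((η + γ : ℝ) : ℂ)‖ := by
        rw [hZ', norm_mul]; push_cast; rfl
    _ ≤ (1 + 1 / (η - 1)) * (1 + 1 / ((η + γ) - 1)) := by
        have := pt_zeta η (by linarith)
        have := pt_zeta (η + γ) (by linarith)
        have : 0 < 1 / (η - 1) := by apply one_div_pos.mpr; linarith
        gcongr
    _ ≤ (1 + L) * (1 + L) := by
        have : 1 / (η - 1) ≤ L := by
          rw [div_le_iff₀ (by linarith)]
          have : L * (1 / L) ≤ L * (η - 1) := by gcongr; linarith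
          rwa [mul_one_div_cancel hL.ne'] at this
        have : 1 / (η + γ - 1) ≤ L := by
          rw [div_le_iff₀ (by linarith)]
          have : L * (1 / L) ≤ L * (η + γ - 1) := by gcongr; linarith
          rwa [mul_one_div_cancel hL.ne'] at this
        have : 0 < 1 / (η + γ - 1) := by apply one_div_pos.mpr; linarith
        gcongr
    _ = _ := by ring

lemma pt_exchange (c : ℂ) (x η Q : ℝ) (h1 : 1 < η) (h2 : 1 < η + c.re)
    (hsum : Summable (fun n : ℕ => rsig c.re n * Real.exp (-(η * Real.log n)))) :
    HasSum (fun n : ℕ => csigma (-c) n *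
        ∫ t in (-Q)..Q, Complex.exp ((Real.log x - Real.log n : ℝ) * ((η : ℂ) + t * I)) / ((η : ℂ) + t * I))
      (∫ t in (-Q)..Q, riemannZeta ((η : ℂ) + t * I) * riemannZeta ((η : ℂ) + t * I + c) *
        Complex.exp (((η : ℂ) + t * I) * Real.log x) / ((η : ℂ) + t * I)) := by
  have e : ∀ n : ℕ, (csigma (-c) n *
        ∫ t in (-Q)..Q, Complex.exp ((Real.log x - Real.log n : ℝ) * ((η : ℂ) + t * I)) / ((η : ℂ) + t * I))
      = ∫ t in (-Q)..Q, csigma (-c) n * (Complex.exp ((Real.log x - Real.log n : ℝ) * ((η : ℂ) + t * I)) / ((η : ℂ) + t * I)) := by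
    intro n
    rw [intervalIntegral.integral_const_mul]
  simp_rw [e]
  have cont : ∀ n : ℕ, Continuous (fun t : ℝ => csigma (-c) n * (Complex.exp ((Real.log x - Real.log n : ℝ) * ((η : ℂ) + t * I)) / ((η : ℂ) + t * I))) := by
    intro n
    refine Continuous.mul (by fun_prop) ?_
    exact Continuous.div (by fun_prop) (by fun_prop) fun σ => pt_ne η σ (Or.inl (by linarith))
  refine intervalIntegral.hasSum_integral_of_dominated_convergence
    (fun n _ => Real.exp (η * Real.log x) * (rsig c.re n * Real.exp (-(η * Real.log n))))
    (fun n => (cont n).aestronglyMeasurable) ?_ ?_ ?_ ?_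
  · intro n
    refine Filter.Eventually.of_forall fun t _ => ?_
    rw [norm_mul, norm_div, Complex.norm_exp]
    have e1 : (((Real.log x - Real.log n : ℝ) : ℂ) * ((η : ℂ) + t * I)).re = (Real.log x - Real.log n) * η := by
      rw [Complex.re_ofReal_mul]; simp
    rw [e1]
    have h3 : 1 ≤ ‖(η : ℂ) + t * I‖ := by
      have := pt_abs_le η t
      rw [abs_of_pos (by linarith)] at this
      linarith
    have h4 := csigma_le c n
    calc _ ≤ rsig c.re n * (Real.exp ((Real.log x - Real.log n) * η) / 1) := by
          have := rsig_nonneg c.re n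
          gcongr
      _ = _ := by
          rw [div_one, mul_left_comm, ← Real.exp_add]
          congr 2; ring
  · exact Filter.Eventually.of_forall fun t _ => hsum.mul_left _
  · exact intervalIntegrable_const
  · refine Filter.Eventually.of_forall fun t _ => ?_
    have h := pt_lser c ((η : ℂ) + t * I) (by simpa using h1) (by simpa using h2)
    have h' := h.mul_right (Complex.exp (((η : ℂ) + t * I) * Real.log x) / ((η : ℂ) + t * I))
    rw [mul_div_assoc]
    refine h'.congr_fun ?_
    intro n
    rw [mul_assoc]
    congr 1
    rw [← mul_div_assoc, ← Complex.exp_add]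
    congr 2
    push_cast; ring

lemma pt_core (A ε Cd : ℝ) (hA : 0 < A) (hε : 0 < ε) (hCd : 0 < Cd)
    (hdiv : ∀ n : ℕ, 1 ≤ n → (n.divisors.card : ℝ) ≤ Cd * (n : ℝ) ^ ε)
    (x : ℝ) (hx : 2 ≤ x) (k : ℕ) (hk : x = (k : ℝ) + 1 / 2) (c : ℂ)
    (hc : |c.re| ≤ A / Real.log x) (Q η : ℝ) (hQ : 1 ≤ Q)
    (hη : η = 1 / Real.log x + max 1 (1 - c.re)) :
    ‖Dsum c x - (1 / (2 * π)) * ∫ t in (-Q)..Q,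
        riemannZeta ((η : ℂ) + t * I) * riemannZeta ((η : ℂ) + t * I + c) *
        Complex.exp (((η : ℂ) + t * I) * Real.log x) / ((η : ℂ) + t * I)‖ ≤
    (18 * Real.exp (1 + A) / ε + 32 * Cd * 2 ^ ε * Real.exp (2 * A) * Real.exp (3 + 2 * A)) *
      x ^ ((1 : ℝ) + ε) * Real.log x / Q := by
  have hx0 : 0 < x := by linarith
  set L := Real.log x with hLdef
  have hLhalf : 1 / 2 ≤ L := by
    have := Real.log_two_gt_d9
    have := Real.log_le_log (by norm_num) hx
    linarith
  have hL : 0 < L := by linarith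
  have hLi : 1 / L ≤ 2 := by rw [div_le_iff₀ hL]; linarith
  have hLi0 : 0 < 1 / L := by positivity
  have hAL : A / L ≤ 2 * A := by
    rw [div_le_iff₀ hL]; nlinarith
  have hm1 : 1 ≤ max 1 (1 - c.re) := le_max_left _ _
  have hm2 : 1 - c.re ≤ max 1 (1 - c.re) := le_max_right _ _
  have hm3 : max 1 (1 - c.re) ≤ 1 + A / L := by
    apply max_le
    · have : 0 < A / L := by positivity
      linarith
    · have := neg_abs_le c.re
      linarith
  have hη0 : 0 < η := by linarith
  obtain ⟨Z, hZ, hZle⟩ := rsig_hasSum c.re η L hL (by linarith) (by linarith)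
  have hex := pt_exchange c x η Q (by linarith) (by linarith) hZ.summable
  have hne : ∀ n : ℕ, x ≠ n := by
    intro n h
    rw [hk] at h
    have h2 : (2 * k + 1 : ℝ) = 2 * n := by linarith
    have h3 : 2 * k + 1 = 2 * n := by exact_mod_cast h2
    omega
  -- the sum side
  have hD : HasSum (fun n : ℕ => csigma (-c) n * (if 0 < L - Real.log n then (1 : ℂ) else 0)) (Dsum c x) := by
    have h0 : ∀ n ∉ Finset.Icc 1 ⌊x⌋₊, csigma (-c) n * (if 0 < L - Real.log n then (1 : ℂ) else 0) = 0 := by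
      intro n hn
      rcases Nat.eq_zero_or_pos n with h | h
      · simp [h, csigma]
      · have h1 : ⌊x⌋₊ < n := by
          simp at hn; exact hn h
        have h2 : x < n := (Nat.floor_lt hx0.le).mp h1
        have h3 := Real.log_le_log hx0 h2.le
        rw [if_neg (by linarith), mul_zero]
    have h1 := hasSum_sum_of_ne_finset_zero (L := SummationFilter.unconditional ℕ) h0
    convert h1 using 1
    unfold Dsum
    refine Finset.sum_congr rfl fun n hn => ?_
    have hn1 := Finset.mem_Icc.mp hn
    have hn0 : (0 : ℝ) < n := by exact_mod_cast hn1.1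
    have h2 : (n : ℝ) ≤ x := (Nat.le_floor_iff hx0.le).mp hn1.2
    have h3 : (n : ℝ) < x := lt_of_le_of_ne h2 (hne n).symm
    have h4 := Real.log_lt_log hn0 h3
    rw [if_pos (by linarith), mul_one]
  have hdiff := hD.sub (hex.mul_left (1 / (2 * (π : ℂ))))
  -- the majorant
  set B : ℝ := Cd * (2 * x) ^ ε * Real.exp (2 * A) with hB
  have hB0 : 0 < B := by positivity
  set G : ℕ → ℝ := fun n => if n ∈ Finset.Icc 1 (2 * k + 1) then
    B * (Real.exp η * (2 * x)) * (1 / |(k : ℝ) + 1 / 2 - n|) else 0 with hG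
  have hG0 : ∀ n, 0 ≤ G n := by
    intro n
    simp only [hG]
    split_ifs <;> positivity
  have hGs : HasSum G (∑ n ∈ Finset.Icc 1 (2 * k + 1), G n) :=
    hasSum_sum_of_ne_finset_zero (fun n hn => by simp only [hG]; rw [if_neg hn])
  have hGle : ∑ n ∈ Finset.Icc 1 (2 * k + 1), G n ≤ B * (Real.exp η * (2 * x)) * (16 * L) := by
    have e : ∑ n ∈ Finset.Icc 1 (2 * k + 1), G n = B * (Real.exp η * (2 * x)) *
        ∑ n ∈ Finset.Icc 1 (2 * k + 1), 1 / |(k : ℝ) + 1 / 2 - n| := by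
      rw [Finset.mul_sum]
      refine Finset.sum_congr rfl fun n hn => ?_
      simp only [hG]
      rw [if_pos hn]
    rw [e]
    have h1 := pt_sum k
    have h2 : Real.log ((k : ℝ) + 1) ≤ 2 * L := by
      calc Real.log ((k : ℝ) + 1) ≤ Real.log (x * x) := by
            apply Real.log_le_log (by positivity)
            nlinarith
        _ = _ := by rw [Real.log_mul (by linarith) (by linarith)]; ring
    gcongr
    linarith
  have hmaj := ((hZ.mul_left (2 * Real.exp (η * L))).add hGs).mul_left (1 / Q)
  have hfin := hdiff.norm_le_of_bounded hmaj (by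
    intro n
    rcases Nat.eq_zero_or_pos n with h | h
    · subst h
      simp only [csigma, Nat.divisors_zero, Finset.sum_empty, zero_mul, mul_zero, sub_zero, norm_zero]
      have := hG0 0
      have := rsig_nonneg c.re 0
      positivity
    · have hn0 : (0 : ℝ) < n := by exact_mod_cast h
      set u := L - Real.log n with hu
      have hu0 : u ≠ 0 := by
        intro h0
        have : L = Real.log n := by linarith
        exact hne n (Real.log_injOn_pos (Set.mem_Ioi.mpr hx0) (Set.mem_Ioi.mpr hn0) this)
      have hp := pt_perron u η Q hu0 hη0 (by linarith)
      have ht := pt_term x η n hx hη0 h (hne n)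
      rw [← hLdef, ← hu] at ht
      have hs := csigma_le c n
      have hr0 := rsig_nonneg c.re n
      have e1 : ∀ X d : ℂ, csigma (-c) n * d - 1 / (2 * (π : ℂ)) * (csigma (-c) n * X) =
          csigma (-c) n * (d - 1 / (2 * (π : ℂ)) * X) := by intros; ring
      rw [e1, norm_mul]
      have e2 : Real.exp (u * η) = Real.exp (η * L) * Real.exp (-(η * Real.log n)) := by
        rw [← Real.exp_add, hu]; congr 1; ring
      have e3 : rsig c.re n * (if (x / 2 ≤ n ∧ (n : ℝ) ≤ 2 * x) then Real.exp η * (2 * x) / |x - n| else 0) ≤ G n := by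
        split_ifs with hcond
        · have hmem : n ∈ Finset.Icc 1 (2 * k + 1) := by
            rw [Finset.mem_Icc]
            refine ⟨h, ?_⟩
            have := hcond.2
            rw [hk] at this
            have : (n : ℝ) ≤ 2 * k + 1 := by linarith
            exact_mod_cast this
          simp only [hG]
          rw [if_pos hmem, ← hk]
          have hb : rsig c.re n ≤ B := by
            refine (rsig_le A x c.re hA hx hc n hcond.2).trans ?_
            rw [hB]
            gcongr
            refine (hdiv n h).trans ?_
            gcongr
            exact hcond.2
          rw [div_eq_mul_one_div, ← mul_assoc]
          gcongr
        · rw [mul_zero]; exact hG0 n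
      calc _ ≤ rsig c.re n * (Real.exp (u * η) / (Q * |u|)) := by gcongr
        _ = 1 / Q * (rsig c.re n * (Real.exp (u * η) / |u|)) := by
            have : |u| ≠ 0 := abs_ne_zero.mpr hu0
            field_simp
        _ ≤ 1 / Q * (rsig c.re n * (2 * Real.exp (u * η) +
              if (x / 2 ≤ n ∧ (n : ℝ) ≤ 2 * x) then Real.exp η * (2 * x) / |x - n| else 0)) := by
            gcongr
        _ ≤ 1 / Q * (rsig c.re n * (2 * Real.exp (u * η)) + G n) := by
            rw [mul_add (rsig c.re n)]
            gcongr
        _ = _ := by rw [e2]; ring)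
  refine hfin.trans ?_
  have hxL : Real.exp L = x := Real.exp_log hx0
  have f1 : Real.exp (η * L) ≤ Real.exp (1 + A) * x := by
    rw [← hxL, ← Real.exp_add]
    apply Real.exp_le_exp.mpr
    have : η * L ≤ (1 / L + (1 + A / L)) * L := by gcongr; linarith
    have e : (1 / L + (1 + A / L)) * L = 1 + A + L := by field_simp; ring
    linarith
  have f2 : (1 + L) ^ 2 ≤ 9 * L * (x ^ ε / ε) := by
    have : L ≤ x ^ ε / ε := Real.log_le_rpow_div hx0.le hε
    calc (1 + L) ^ 2 ≤ 9 * L * L := by nlinarith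
      _ ≤ _ := by gcongr
  have f3 : Real.exp η ≤ Real.exp (3 + 2 * A) := Real.exp_le_exp.mpr (by linarith)
  have f4 : (2 * x) ^ ε = 2 ^ ε * x ^ ε := Real.mul_rpow (by norm_num) hx0.le
  have f5 : x ^ (1 + ε) = x * x ^ ε := by rw [Real.rpow_add hx0, Real.rpow_one]
  calc _ ≤ 1 / Q * (2 * (Real.exp (1 + A) * x) * (9 * L * (x ^ ε / ε)) +
          B * (Real.exp (3 + 2 * A) * (2 * x)) * (16 * L)) := by
        have g1 : 2 * Real.exp (η * L) * Z ≤ 2 * (Real.exp (1 + A) * x) * (9 * L * (x ^ ε / ε)) := by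
          calc _ ≤ 2 * Real.exp (η * L) * (9 * L * (x ^ ε / ε)) := by
                gcongr; exact hZle.trans f2
            _ ≤ _ := by gcongr
        have g2 : B * (Real.exp η * (2 * x)) * (16 * L) ≤ B * (Real.exp (3 + 2 * A) * (2 * x)) * (16 * L) := by
          gcongr
        gcongr
        exact hGle.trans g2
    _ = _ := by
        rw [f5, hB, f4]
        field_simp
        ring

theorem perron_truncation_for_Dsum :
    ∀ A ε : ℝ, 0 < A → 0 < ε → ∃ C : ℝ, 0 < C ∧
      ∀ x : ℝ, 2 ≤ x → (∃ k : ℤ, 2 * x = 2 * (k : ℝ) + 1) →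
      ∀ c : ℂ, |c.re| ≤ A / Real.log x →
      ∀ Q : ℝ, 1 ≤ Q →
        ‖Dsum c x -
            (1 / (2 * Real.pi)) *
              ∫ t in (-Q)..Q,
                riemannZeta ((1 / Real.log x + max 1 (1 - c.re)) + t * I) *
                  riemannZeta ((1 / Real.log x + max 1 (1 - c.re)) + t * I + c) *
                  Complex.exp (((1 / Real.log x + max 1 (1 - c.re)) + t * I) * Real.log x) /
                  ((1 / Real.log x + max 1 (1 - c.re)) + t * I)‖ ≤
          C * x ^ ((1:ℝ) + ε) * Real.log x / Q := by
  intro A ε hA hε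
  obtain ⟨Cd, hCd, hdiv⟩ := pt_div ε hε
  refine ⟨18 * Real.exp (1 + A) / ε + 32 * Cd * 2 ^ ε * Real.exp (2 * A) * Real.exp (3 + 2 * A),
    by positivity, ?_⟩
  rintro x hx ⟨k, hk⟩ c hc Q hQ
  have hk0 : 0 ≤ k := by
    have : (0 : ℝ) < k := by linarith
    exact_mod_cast this.le
  lift k to ℕ using hk0
  have h := pt_core A ε Cd hA hε hCd hdiv x hx k (by push_cast at hk; linarith) c hc Q _ hQ rfl
  simpa only [Complex.ofReal_add, Complex.ofReal_div, Complex.ofReal_one] using h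
end

section
/- For every A > 0 there exists C > 0 such that the following holds. Let T ≥ 2, let b ∈ ℂ with |Re b| ≤ A/log T and β' := Im b satisfying 0 < β' ≤ T², let c ∈ ℂ with |Re c| ≤ A/log T, set a = b + c with |Re a| ≤ A/log T, and set δ = 1/log T + max(1 − Re a, 1 − Re b). Then | ∑_{m, n ≥ 1} n^{−c} ∫_{δ + b}^{δ + b + iT} χ(1 − s)(nm)^{−s} ds − 2πi ∑_{β'/(2π) < nm ≤ (T + β')/(2π)} n^{−c} | ≤ C · max(β', T)^{1/2} (log T)², where the complex integral is along the vertical segment from δ + b to δ + b + iT and the second sum is over pairs of positive integers m, n with β'/(2π) < mn ≤ (T + β')/(2π). -/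
open Complex Real

/-- The `χ` factor from the functional equation `ζ(s) = χ(s) ζ(1-s)`:
`χ(s) = 2^s π^(s-1) sin(πs/2) Γ(1-s)`. -/
noncomputable def fnEqChi (s : ℂ) : ℂ :=
  2 ^ s * (Real.pi : ℂ) ^ (s - 1) * Complex.sin (Real.pi * s / 2) * Complex.Gamma (1 - s)

namespace VIS

open MeasureTheory Filter Topology Set

/-- Exact size of Gamma on the half line. -/
lemma norm_Gamma_half (t : ℝ) :
    ‖Complex.Gamma ((1/2 : ℝ) + t * I)‖ ≤ √(2 * π) * Real.exp (-(π * t / 2)) := by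
  have h := Complex.Gamma_mul_Gamma_one_sub ((1/2 : ℝ) + t * I)
  have h1 : (1 : ℂ) - ((1/2 : ℝ) + t * I) = (starRingEnd ℂ) ((1/2 : ℝ) + t * I) := by
    apply Complex.ext <;> simp <;> norm_num
  rw [h1, Complex.Gamma_conj] at h
  have h2 : Complex.sin (π * ((1/2 : ℝ) + t * I)) = (Real.cosh (π * t) : ℝ) := by
    have : (π : ℂ) * ((1/2 : ℝ) + t * I) = (π * t : ℝ) * I + π / 2 := by push_cast; ring
    rw [this, Complex.sin_add_pi_div_two, Complex.cos_mul_I, Complex.ofReal_cosh]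
  rw [h2] at h
  have h3 : ‖Complex.Gamma ((1/2 : ℝ) + t * I)‖ ^ 2 = π / Real.cosh (π * t) := by
    have := congrArg norm h
    rw [norm_mul, RCLike.norm_conj, ← sq, norm_div, Complex.norm_real, Complex.norm_real] at this
    rw [this, Real.norm_of_nonneg pi_pos.le, Real.norm_of_nonneg (Real.cosh_pos _).le]
  have h4 : π / Real.cosh (π * t) ≤ (√(2 * π) * Real.exp (-(π * t / 2))) ^ 2 := by
    rw [mul_pow, Real.sq_sqrt (by positivity), ← Real.exp_nat_mul, div_le_iff₀ (Real.cosh_pos _),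
      Real.cosh_eq]
    have e1 : ((2:ℕ):ℝ) * -(π * t / 2) = -(π * t) := by push_cast; ring
    rw [e1]
    have e2 : Real.exp (-(π * t)) * Real.exp (π * t) = 1 := by rw [← Real.exp_add]; simp
    have e3 : 0 < Real.exp (-(π * t)) := Real.exp_pos _
    nlinarith [pi_pos, mul_pos e3 e3, mul_pos pi_pos (mul_pos e3 e3)]
  exact le_of_sq_le_sq (h3.trans_le h4) (by positivity)
where
  le_of_sq_le_sq {a b : ℝ} (h : a ^ 2 ≤ b ^ 2) (hb : 0 ≤ b) : a ≤ b := abs_le_of_sq_le_sq' h hb |>.2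

/-- one-factor interpolation -/
lemma factor_interp (v t θ : ℝ) (hv : 1/2 ≤ v) (ht : 1 ≤ t) (h0 : 0 ≤ θ) (h1 : θ ≤ 1) :
    ‖(v : ℂ) + t * I‖ ^ (1 - θ) * ‖((v + 1 : ℝ) : ℂ) + t * I‖ ^ θ ≤
      Real.exp (1 / v ^ 2) * ‖((v + θ : ℝ) : ℂ) + t * I‖ := by
  have e (a : ℝ) : ‖(a : ℂ) + t * I‖ = √(a ^ 2 + t ^ 2) := Complex.norm_add_mul_I a t
  simp only [e]
  have hs (a p : ℝ) : √(a ^ 2 + t ^ 2) ^ p = √((a ^ 2 + t ^ 2) ^ p) := by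
    rw [Real.sqrt_eq_rpow, Real.sqrt_eq_rpow, ← Real.rpow_mul (by positivity),
      ← Real.rpow_mul (by positivity), mul_comm]
  rw [hs, hs, ← Real.sqrt_mul (by positivity)]
  have hx : Real.exp (1 / v ^ 2) = √(Real.exp (2 / v ^ 2)) := by
    rw [Real.sqrt_eq_rpow, ← Real.exp_mul]; congr 1; ring
  rw [hx, ← Real.sqrt_mul (by positivity)]
  apply Real.sqrt_le_sqrt
  have h := Real.geom_mean_le_arith_mean2_weighted (w₁ := 1 - θ) (w₂ := θ) (p₁ := v ^ 2 + t ^ 2)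
    (p₂ := (v + 1) ^ 2 + t ^ 2) (by linarith) h0 (by positivity) (by positivity) (by ring)
  refine h.trans ?_
  have hv0 : 0 < v := by linarith
  have h2 : 1 + 1 / v ^ 2 ≤ Real.exp (2 / v ^ 2) := by
    have := Real.add_one_le_exp (2 / v ^ 2)
    have h3 : 1 / v ^ 2 ≤ 2 / v ^ 2 := by gcongr; norm_num
    linarith
  have h4 : (1 - θ) * (v ^ 2 + t ^ 2) + θ * ((v + 1) ^ 2 + t ^ 2) ≤
      (1 + 1 / v ^ 2) * ((v + θ) ^ 2 + t ^ 2) := by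
    have : 1 / v ^ 2 * ((v + θ) ^ 2 + t ^ 2) ≥ 1 := by
      rw [ge_iff_le, div_mul_eq_mul_div, le_div_iff₀ (by positivity)]
      nlinarith
    nlinarith
  exact h4.trans (by gcongr)

lemma Gamma_interp : ∃ K : ℝ, 0 < K ∧ ∀ t θ : ℝ, 1 ≤ t → 0 ≤ θ → θ ≤ 1 →
    ‖Complex.Gamma ((1/2 + θ : ℝ) + t * I)‖ ≤
      K * (‖Complex.Gamma ((1/2 : ℝ) + t * I)‖ ^ (1 - θ) *
        ‖Complex.Gamma ((1/2 + 1 : ℝ) + t * I)‖ ^ θ) := by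
  have hsum : Summable (fun j : ℕ => 1 / ((j : ℝ) + 1/2) ^ 2) := by
    have := (Real.summable_one_div_nat_add_rpow (1/2) 2).2 (by norm_num)
    refine this.congr fun j => ?_
    rw [abs_of_pos (by positivity)]; norm_cast
  refine ⟨Real.exp (∑' j : ℕ, 1 / ((j : ℝ) + 1/2) ^ 2), Real.exp_pos _, ?_⟩
  intro t θ ht h0 h1
  have lim (u : ℝ) := (Complex.GammaSeq_tendsto_Gamma ((u : ℂ) + t * I)).norm
  have hΓ (u : ℝ) (hu : 1/2 ≤ u): ‖Complex.Gamma ((u : ℂ) + t * I)‖ ≠ 0 := by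
    rw [norm_ne_zero_iff]
    apply Complex.Gamma_ne_zero_of_re_pos
    simp; linarith
  have l1 := (lim (1/2)).rpow_const (p := 1 - θ) (Or.inl (hΓ _ le_rfl))
  have l2 := (lim (1/2 + 1)).rpow_const (p := θ) (Or.inl (hΓ _ (by norm_num)))
  refine le_of_tendsto_of_tendsto (lim (1/2 + θ))
    ((l1.mul l2).const_mul (Real.exp (∑' j : ℕ, 1 / ((j : ℝ) + 1/2) ^ 2))) ?_
  filter_upwards [eventually_gt_atTop 0] with n hn
  have hn' : (0:ℝ) < n := by exact_mod_cast hn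
  have hseq (u : ℝ) : ‖Complex.GammaSeq ((u : ℂ) + t * I) n‖ =
      (n : ℝ) ^ u * (n.factorial : ℝ) / ∏ j ∈ Finset.range (n + 1), ‖((u + j : ℝ) : ℂ) + t * I‖ := by
    rw [Complex.GammaSeq, norm_div, norm_mul, norm_prod]
    congr 1
    · congr 1
      · rw [show ((n : ℕ) : ℂ) = ((n : ℝ) : ℂ) by simp, Complex.norm_cpow_eq_rpow_re_of_pos hn']
        simp
      · simp
    · refine Finset.prod_congr rfl fun j _ => ?_
      congr 1; push_cast; ring
  rw [hseq, hseq, hseq]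
  have hpos (u : ℝ) : 0 < ‖(u : ℂ) + t * I‖ := by
    rw [norm_pos_iff]; intro h
    have := congrArg Complex.im h
    simp at this; linarith
  have hP (u : ℝ) : 0 < ∏ j ∈ Finset.range (n + 1), ‖((u + j : ℝ) : ℂ) + t * I‖ :=
    Finset.prod_pos fun j _ => hpos _
  rw [Real.div_rpow (by positivity) (hP _).le, Real.div_rpow (by positivity) (hP _).le,
    Real.mul_rpow (by positivity) (by positivity), Real.mul_rpow (by positivity) (by positivity),
    div_mul_div_comm, ← Real.rpow_mul hn'.le, ← Real.rpow_mul hn'.le]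
  have e1 : (n:ℝ) ^ ((1/2 : ℝ) * (1 - θ)) * (n.factorial : ℝ) ^ (1 - θ) *
      ((n:ℝ) ^ ((1/2 + 1 : ℝ) * θ) * (n.factorial : ℝ) ^ θ) = (n:ℝ) ^ (1/2 + θ) * n.factorial := by
    have a1 : (n:ℝ) ^ ((1/2 : ℝ) * (1 - θ)) * (n:ℝ) ^ ((1/2 + 1 : ℝ) * θ) = (n:ℝ) ^ (1/2 + θ) := by
      rw [← Real.rpow_add hn']; congr 1; ring
    have a2 : (n.factorial:ℝ) ^ (1 - θ) * (n.factorial : ℝ) ^ θ = n.factorial := by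
      rw [← Real.rpow_add (by positivity)]; simp
    rw [← a1]; nth_rewrite 3 [← a2]; ring
  rw [e1, ← mul_div_assoc, div_le_div_iff₀ (hP _) (by positivity [hP (1/2), hP (1/2+1)])]
  have key : (∏ j ∈ Finset.range (n + 1), ‖((1/2 + j : ℝ) : ℂ) + t * I‖) ^ (1 - θ) *
      (∏ j ∈ Finset.range (n + 1), ‖((1/2 + 1 + j : ℝ) : ℂ) + t * I‖) ^ θ ≤
      Real.exp (∑' j : ℕ, 1 / ((j : ℝ) + 1/2) ^ 2) *
        ∏ j ∈ Finset.range (n + 1), ‖((1/2 + θ + j : ℝ) : ℂ) + t * I‖ := by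
    rw [← Real.finsetProd_rpow _ _ (fun j _ => (hpos _).le),
      ← Real.finsetProd_rpow _ _ (fun j _ => (hpos _).le), ← Finset.prod_mul_distrib]
    calc _ ≤ ∏ j ∈ Finset.range (n + 1), (Real.exp (1 / ((j : ℝ) + 1/2) ^ 2) *
            ‖((1/2 + θ + j : ℝ) : ℂ) + t * I‖) := by
          apply Finset.prod_le_prod
          · intro j _; positivity
          · intro j _
            have := factor_interp (j + 1/2) t θ (by linarith [(Nat.cast_nonneg j : (0:ℝ) ≤ j)]) ht h0 h1
            rw [show (1/2 + j : ℝ) = j + 1/2 by ring, show (1/2 + 1 + j : ℝ) = j + 1/2 + 1 by ring,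
              show (1/2 + θ + j : ℝ) = j + 1/2 + θ by ring]
            exact this
      _ = Real.exp (∑ j ∈ Finset.range (n + 1), 1 / ((j : ℝ) + 1/2) ^ 2) *
            ∏ j ∈ Finset.range (n + 1), ‖((1/2 + θ + j : ℝ) : ℂ) + t * I‖ := by
          rw [Finset.prod_mul_distrib, Real.exp_sum]
      _ ≤ _ := by
          have := hsum.sum_le_tsum (Finset.range (n + 1)) (fun j _ => by positivity)
          have := (hP (1/2 + θ)).le
          gcongr
  calc _ ≤ (n:ℝ) ^ (1/2 + θ) * n.factorial * (Real.exp (∑' j : ℕ, 1 / ((j : ℝ) + 1/2) ^ 2) *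
        ∏ j ∈ Finset.range (n + 1), ‖((1/2 + θ + j : ℝ) : ℂ) + t * I‖) := by
        gcongr
    _ = _ := by ring

lemma norm_ge_im (u t : ℝ) (ht : 0 ≤ t) : t ≤ ‖(u : ℂ) + t * I‖ := by
  rw [Complex.norm_add_mul_I]
  exact Real.le_sqrt_of_sq_le (by nlinarith [sq_nonneg u])

lemma Gamma_succ (u t : ℝ) (ht : 1 ≤ t) :
    ‖Complex.Gamma ((u + 1 : ℝ) + t * I)‖ = ‖(u : ℂ) + t * I‖ * ‖Complex.Gamma ((u : ℝ) + t * I)‖ := by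
  have h0 : (u : ℂ) + t * I ≠ 0 := by
    rw [← norm_pos_iff]; linarith [norm_ge_im u t (by linarith)]
  rw [← norm_mul, ← Complex.Gamma_add_one _ h0]
  congr 2; push_cast; ring

/-- base strip -/
lemma Gamma_base : ∃ C : ℝ, 0 < C ∧ ∀ t u : ℝ, 1 ≤ t → 1/2 ≤ u → u ≤ 3/2 →
    ‖Complex.Gamma ((u : ℝ) + t * I)‖ ≤ C * Real.exp ((u - 1/2) * Real.log t - π * t / 2) := by
  obtain ⟨K, hK, h⟩ := Gamma_interp
  refine ⟨K * √(2 * π) * 2, by positivity, ?_⟩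
  intro t u ht hu1 hu2
  have hh := h t (u - 1/2) ht (by linarith) (by linarith)
  rw [Gamma_succ _ _ ht, Real.mul_rpow (norm_nonneg _) (norm_nonneg _),
    mul_left_comm (‖Complex.Gamma ((1/2 : ℝ) + t * I)‖ ^ (1 - (u - 1/2))),
    ← Real.rpow_add_of_nonneg (norm_nonneg _) (by linarith) (by linarith)] at hh
  have e1 : (1 - (u - 1/2) + (u - 1/2)) = 1 := by ring
  have e2 : (1/2 + (u - 1/2)) = u := by ring
  rw [e1, e2, Real.rpow_one] at hh
  refine hh.trans ?_
  have b1 : ‖((1/2 : ℝ) : ℂ) + t * I‖ ^ (u - 1/2) ≤ 2 * Real.exp ((u - 1/2) * Real.log t) := by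
    have : ‖((1/2 : ℝ) : ℂ) + t * I‖ ≤ 2 * t := by
      rw [Complex.norm_add_mul_I]
      apply Real.sqrt_le_iff.2 ⟨by linarith, by nlinarith⟩
    calc _ ≤ (2 * t) ^ (u - 1/2) := Real.rpow_le_rpow (norm_nonneg _) this (by linarith)
      _ = 2 ^ (u - 1/2) * Real.exp ((u - 1/2) * Real.log t) := by
        rw [Real.mul_rpow (by norm_num) (by linarith), Real.rpow_def_of_pos (by linarith : 0 < t),
          mul_comm (Real.log t)]
      _ ≤ _ := by
        gcongr
        calc (2:ℝ) ^ (u - 1/2) ≤ 2 ^ (1:ℝ) := Real.rpow_le_rpow_of_exponent_le (by norm_num) (by linarith)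
          _ = 2 := by simp
  calc _ ≤ K * ((2 * Real.exp ((u - 1/2) * Real.log t)) * (√(2 * π) * Real.exp (-(π * t / 2)))) := by
        gcongr; exact norm_Gamma_half t
    _ = _ := by rw [sub_eq_add_neg _ (π * t / 2), Real.exp_add]; ring

lemma Gamma_bound : ∃ C : ℝ, 0 < C ∧ ∀ t u : ℝ, 1 ≤ t →
    ‖Complex.Gamma ((u : ℝ) + t * I)‖ ≤
      C * Real.exp ((u - 1/2) * Real.log t - π * t / 2 + max u 0 ^ 3 / (2 * t ^ 2)) := by
  obtain ⟨C, hC, h⟩ := Gamma_base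
  refine ⟨C, hC, ?_⟩
  intro t u ht
  have ht0 : 0 < t := by linarith
  have up : ∀ k : ℕ, ∀ w : ℝ, 1/2 ≤ w → w ≤ 3/2 → ‖Complex.Gamma ((w + k : ℝ) + t * I)‖ ≤
      C * Real.exp ((w + k - 1/2) * Real.log t - π * t / 2 + max (w + k) 0 ^ 3 / (2 * t ^ 2)) := by
    intro k w hw1 hw2
    induction k with
    | zero =>
      simp only [Nat.cast_zero, add_zero]
      refine (h t w ht hw1 hw2).trans ?_
      gcongr
      have : 0 ≤ max w 0 ^ 3 / (2 * t ^ 2) := by positivity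
      linarith
    | succ k ih =>
      have hk : 0 ≤ w + k := by positivity
      rw [Nat.cast_succ, ← add_assoc, Gamma_succ _ _ ht]
      rw [max_eq_left hk] at ih
      rw [max_eq_left (by linarith)]
      have b : ‖((w + k : ℝ) : ℂ) + t * I‖ ≤ Real.exp (Real.log t + (w + k) ^ 2 / (2 * t ^ 2)) := by
        rw [Complex.norm_add_mul_I]
        apply Real.sqrt_le_iff.2 ⟨by positivity, ?_⟩
        rw [← Real.exp_nat_mul, show ((2:ℕ):ℝ) * (Real.log t + (w + k) ^ 2 / (2 * t ^ 2)) =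
          Real.log t + Real.log t + (w + k) ^ 2 / t ^ 2 by push_cast; field_simp; ring,
          Real.exp_add, Real.exp_add, Real.exp_log ht0]
        have := Real.add_one_le_exp ((w + k) ^ 2 / t ^ 2)
        calc (w + k) ^ 2 + t ^ 2 = t * t * ((w + k) ^ 2 / t ^ 2 + 1) := by field_simp
          _ ≤ _ := by gcongr
      calc _ ≤ Real.exp (Real.log t + (w + k) ^ 2 / (2 * t ^ 2)) *
            (C * Real.exp ((w + k - 1/2) * Real.log t - π * t / 2 + (w + k) ^ 3 / (2 * t ^ 2))) := by
            gcongr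
        _ = C * Real.exp ((w + k + 1 - 1/2) * Real.log t - π * t / 2 +
              ((w + k) ^ 2 + (w + k) ^ 3) / (2 * t ^ 2)) := by
            rw [mul_left_comm, ← Real.exp_add]; congr 2; ring
        _ ≤ _ := by
            gcongr
            nlinarith [sq_nonneg (w + k)]
  have down : ∀ k : ℕ, ∀ w : ℝ, 1/2 ≤ w → w ≤ 3/2 → ‖Complex.Gamma ((w - k : ℝ) + t * I)‖ ≤
      C * Real.exp ((w - k - 1/2) * Real.log t - π * t / 2) := by
    intro k w hw1 hw2
    induction k with
    | zero => simpa using h t w ht hw1 hw2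
    | succ k ih =>
      have e := Gamma_succ (w - (k + 1 : ℕ)) t ht
      have e2 : w - ((k + 1 : ℕ):ℝ) + 1 = w - k := by push_cast; ring
      rw [e2] at e
      rw [e] at ih
      have hge := norm_ge_im (w - (k + 1 : ℕ)) t ht0.le
      have h3 : t * ‖Complex.Gamma ((w - (k + 1 : ℕ) : ℝ) + t * I)‖ ≤
          C * Real.exp ((w - k - 1/2) * Real.log t - π * t / 2) :=
        le_trans (by gcongr) ih
      have h4 : C * Real.exp ((w - k - 1/2) * Real.log t - π * t / 2) =
          t * (C * Real.exp ((w - (k + 1 : ℕ) - 1/2) * Real.log t - π * t / 2)) := by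
        nth_rewrite 3 [← Real.exp_log ht0]
        rw [mul_left_comm, ← Real.exp_add]; congr 2; push_cast; ring
      rw [h4] at h3
      exact le_of_mul_le_mul_left h3 ht0
  rcases le_total (1/2) u with hu | hu
  · have hf := Nat.floor_le (by linarith : 0 ≤ u - 1/2)
    have hf2 := Nat.lt_floor_add_one (u - 1/2)
    have := up ⌊u - 1/2⌋₊ (u - ⌊u - 1/2⌋₊) (by linarith) (by linarith)
    rwa [sub_add_cancel] at this
  · have hf := Nat.le_ceil (1/2 - u)
    have hf2 := Nat.ceil_lt_add_one (by linarith : 0 ≤ 1/2 - u)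
    have := down ⌈1/2 - u⌉₊ (u + ⌈1/2 - u⌉₊) (by linarith) (by linarith)
    rw [add_sub_cancel_right] at this
    refine this.trans ?_
    gcongr
    have : 0 ≤ max u 0 ^ 3 / (2 * t ^ 2) := by positivity
    linarith

end VIS

namespace VIS
open MeasureTheory Filter Topology Set

/-- The basic integrand. -/
noncomputable def H (l θ : ℝ) (s : ℂ) : ℂ := Complex.Gamma s * cexp (-(s * (l + θ * I)))

lemma norm_H (l θ u t : ℝ) :
    ‖H l θ (u + t * I)‖ = ‖Complex.Gamma (u + t * I)‖ * Real.exp (θ * t - l * u) := by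
  rw [H, norm_mul, Complex.norm_exp]; congr 2; simp; ring

lemma norm_Gamma_le (u t : ℝ) (hu : 0 < u) :
    ‖Complex.Gamma (u + t * I)‖ ≤ Real.Gamma u := by
  rw [Complex.Gamma_eq_integral (by simpa), Real.Gamma_eq_integral hu, Complex.GammaIntegral]
  refine (norm_integral_le_integral_norm _).trans_eq ?_
  refine setIntegral_congr_fun measurableSet_Ioi fun x hx => ?_
  have hx' : (0:ℝ) < x := hx
  simp only [norm_mul, Complex.norm_cpow_eq_rpow_re_of_pos hx']
  rw [Complex.norm_real, Real.norm_of_nonneg (Real.exp_pos _).le]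
  simp

lemma diffAt_Gamma {s : ℂ} (h : 0 < s.re ∨ s.im ≠ 0) : DifferentiableAt ℂ Complex.Gamma s := by
  apply Complex.differentiableAt_Gamma
  intro m hm
  rcases h with h | h
  · rw [hm] at h; simp at h; linarith [(Nat.cast_nonneg m : (0:ℝ) ≤ m)]
  · rw [hm] at h; simp at h

lemma diffAt_H (l θ : ℝ) {s : ℂ} (h : 0 < s.re ∨ s.im ≠ 0) : DifferentiableAt ℂ (H l θ) s := by
  unfold H
  exact (diffAt_Gamma h).mul (by fun_prop)

lemma continuous_Gamma_vert (σ : ℝ) (hσ : 0 < σ) :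
    Continuous fun t : ℝ => Complex.Gamma (σ + t * I) := by
  rw [continuous_iff_continuousAt]
  intro t
  have h : ContinuousAt Complex.Gamma ((σ : ℂ) + t * I) :=
    (diffAt_Gamma (Or.inl (by simpa))).continuousAt
  exact ContinuousAt.comp (f := fun t : ℝ => (σ : ℂ) + t * I) h (by fun_prop)

lemma continuous_H_vert (l θ σ : ℝ) (hσ : 0 < σ) :
    Continuous fun t : ℝ => H l θ (σ + t * I) := by
  unfold H
  exact (continuous_Gamma_vert σ hσ).mul (by fun_prop)

lemma Gamma_exp_bound (σ ε : ℝ) (hσ : 0 < σ) (hε : 0 < ε) : ∃ C : ℝ, 0 < C ∧ ∀ t : ℝ,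
    ‖Complex.Gamma (σ + t * I)‖ ≤ C * Real.exp (-((π / 2 - ε) * |t|)) := by
  obtain ⟨C, hC, h⟩ := Gamma_bound
  have hΓ := Real.Gamma_pos_of_pos hσ
  set η := ε / σ with hη
  have hη0 : 0 < η := by positivity
  refine ⟨C * Real.exp (σ * |Real.log η| + σ ^ 3 / 2) + Real.Gamma σ * Real.exp (π / 2), by positivity, ?_⟩
  have main : ∀ t : ℝ, 0 ≤ t → ‖Complex.Gamma (σ + t * I)‖ ≤
      (C * Real.exp (σ * |Real.log η| + σ ^ 3 / 2) + Real.Gamma σ * Real.exp (π / 2)) *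
        Real.exp (-((π / 2 - ε) * t)) := by
    intro t ht
    rcases le_total 1 t with h1 | h1
    · have ht0 : 0 < t := by linarith
      have hb := h t σ h1
      rw [max_eq_left hσ.le] at hb
      have hlog : Real.log t ≤ η * t + |Real.log η| := by
        have := Real.log_le_sub_one_of_pos (mul_pos hη0 ht0)
        rw [Real.log_mul hη0.ne' ht0.ne'] at this
        linarith [neg_abs_le (Real.log η)]
      have hlog0 : 0 ≤ Real.log t := Real.log_nonneg h1
      have e : σ * η = ε := by rw [hη]; field_simp
      calc _ ≤ _ := hb
        _ ≤ C * Real.exp ((σ * |Real.log η| + σ ^ 3 / 2) + -((π / 2 - ε) * t)) := by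
            refine mul_le_mul_of_nonneg_left (Real.exp_le_exp.2 ?_) hC.le
            have : σ ^ 3 / (2 * t ^ 2) ≤ σ ^ 3 / 2 := by
              gcongr; nlinarith
            have h4 : σ * Real.log t ≤ σ * (η * t + |Real.log η|) := by gcongr
            have h5 : σ * (η * t + |Real.log η|) = ε * t + σ * |Real.log η| := by rw [← e]; ring
            nlinarith
        _ = C * Real.exp (σ * |Real.log η| + σ ^ 3 / 2) * Real.exp (-((π / 2 - ε) * t)) := by
            rw [Real.exp_add]; ring
        _ ≤ _ := by gcongr; simp; positivity
    · calc _ ≤ Real.Gamma σ := norm_Gamma_le σ t hσ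
        _ ≤ Real.Gamma σ * Real.exp (π / 2 + -((π / 2 - ε) * t)) := by
            apply le_mul_of_one_le_right hΓ.le
            apply Real.one_le_exp
            nlinarith [pi_pos]
        _ = Real.Gamma σ * Real.exp (π / 2) * Real.exp (-((π / 2 - ε) * t)) := by
            rw [Real.exp_add]; ring
        _ ≤ _ := by gcongr; simp; positivity
  intro t
  rcases le_total 0 t with ht | ht
  · rw [abs_of_nonneg ht]; exact main t ht
  · rw [abs_of_nonpos ht]
    have := main (-t) (by linarith)
    have e : (σ : ℂ) + ((-t : ℝ) : ℂ) * I = (starRingEnd ℂ) (σ + t * I) := by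
      apply Complex.ext <;> simp
    rwa [e, Complex.Gamma_conj, RCLike.norm_conj] at this

lemma integrable_exp_abs (η : ℝ) (hη : 0 < η) : Integrable fun t : ℝ => Real.exp (-(η * |t|)) := by
  rw [← integrableOn_univ, ← Set.Iic_union_Ioi (a := (0:ℝ))]
  apply IntegrableOn.union
  · refine (integrableOn_exp_mul_Iic hη 0).congr_fun (fun t ht => ?_) measurableSet_Iic
    have : t ≤ 0 := ht
    simp only [abs_of_nonpos this]; congr 1; ring
  · refine (integrableOn_exp_mul_Ioi (neg_neg_of_pos hη) 0).congr_fun (fun t ht => ?_) measurableSet_Ioi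
    have : 0 < t := ht
    simp only [abs_of_pos this]; congr 1; ring

/-- integral over the vertical line as function of a complex parameter -/
noncomputable def F (σ : ℝ) (w : ℂ) : ℂ := ∫ t : ℝ, Complex.Gamma (σ + t * I) * cexp (-((σ + t * I) * w))

lemma norm_cexp_aux (σ t : ℝ) (w : ℂ) :
    ‖cexp (-((σ + t * I) * w))‖ = Real.exp (t * w.im - σ * w.re) := by
  rw [Complex.norm_exp]; congr 1; simp

lemma F_diff (σ : ℝ) (hσ : 0 < σ) (w : ℂ) (hw : |w.im| < π / 2) :
    Integrable (fun t : ℝ => Complex.Gamma (σ + t * I) * cexp (-((σ + t * I) * w))) ∧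
    DifferentiableAt ℂ (F σ) w := by
  set η := (π / 2 - |w.im|) / 4 with hη
  have hη0 : 0 < η := by rw [hη]; linarith
  obtain ⟨C, hC, hb⟩ := Gamma_exp_bound σ η hσ hη0
  have cont : ∀ z : ℂ, Continuous fun t : ℝ => Complex.Gamma (σ + t * I) * cexp (-((σ + t * I) * z)) :=
    fun z => (continuous_Gamma_vert σ hσ).mul (by fun_prop)
  have hball : ∀ z ∈ Metric.ball w η, ∀ t : ℝ,
      ‖Complex.Gamma (σ + t * I) * cexp (-((σ + t * I) * z))‖ ≤
        C * Real.exp (σ * (|w.re| + η)) * Real.exp (-((2 * η) * |t|)) := by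
    intro z hz t
    rw [norm_mul, norm_cexp_aux]
    have hz1 : ‖z - w‖ < η := by simpa [dist_eq_norm] using hz
    have h1 : |z.im| ≤ |w.im| + η := by
      have := Complex.abs_im_le_norm (z - w)
      have h2 : z.im = w.im + (z - w).im := by simp
      rw [h2]; linarith [abs_add_le w.im (z - w).im]
    have h1' : |z.re| ≤ |w.re| + η := by
      have := Complex.abs_re_le_norm (z - w)
      have h2 : z.re = w.re + (z - w).re := by simp
      rw [h2]; linarith [abs_add_le w.re (z - w).re]
    have h3 : t * z.im ≤ |t| * (|w.im| + η) := by
      calc _ ≤ |t * z.im| := le_abs_self _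
        _ = |t| * |z.im| := abs_mul _ _
        _ ≤ _ := by gcongr
    have h4 : -(σ * z.re) ≤ σ * (|w.re| + η) := by
      rw [← mul_neg]
      exact mul_le_mul_of_nonneg_left (by linarith [neg_abs_le z.re]) hσ.le
    calc _ ≤ C * Real.exp (-((π / 2 - η) * |t|)) *
          Real.exp (|t| * (|w.im| + η) + σ * (|w.re| + η)) := by
          gcongr
          · exact hb t
          · linarith
      _ = _ := by
          rw [mul_assoc, mul_assoc, ← Real.exp_add, ← Real.exp_add]; congr 2
          have : |w.im| = π / 2 - 4 * η := by rw [hη]; ring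
          rw [this]; ring
  have hint0 : Integrable (fun t : ℝ => C * Real.exp (σ * (|w.re| + η)) * Real.exp (-((2 * η) * |t|))) :=
    (integrable_exp_abs (2 * η) (by linarith)).const_mul _
  have hI : Integrable (fun t : ℝ => Complex.Gamma (σ + t * I) * cexp (-((σ + t * I) * w))) :=
    hint0.mono' (cont w).aestronglyMeasurable
      (Eventually.of_forall fun t => hball w (Metric.mem_ball_self hη0) t)
  refine ⟨hI, ?_⟩
  have key := hasDerivAt_integral_of_dominated_loc_of_deriv_le (μ := volume) (𝕜 := ℂ)
    (F := fun (z : ℂ) (t : ℝ) => Complex.Gamma (σ + t * I) * cexp (-((σ + t * I) * z)))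
    (F' := fun (z : ℂ) (t : ℝ) => Complex.Gamma (σ + t * I) * cexp (-((σ + t * I) * z)) * (-(σ + t * I)))
    (bound := fun t => C * Real.exp (σ * (|w.re| + η)) * (σ + 1 / η) * Real.exp (-(η * |t|)))
    (s := Metric.ball w η) (x₀ := w)
    (Metric.ball_mem_nhds w hη0)
    (Eventually.of_forall fun z => (cont z).aestronglyMeasurable) hI
    ((cont w).mul (by fun_prop)).aestronglyMeasurable
    (Eventually.of_forall fun t z hz => ?_)
    ((integrable_exp_abs η hη0).const_mul _)
    (Eventually.of_forall fun t z hz => ?_)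
  · exact key.2.differentiableAt
  · rw [norm_mul, norm_neg]
    have h1 : ‖(σ : ℂ) + t * I‖ ≤ (σ + 1 / η) * Real.exp (η * |t|) := by
      have a1 : ‖(σ : ℂ) + t * I‖ ≤ σ + |t| := by
        refine (norm_add_le _ _).trans ?_
        simp [abs_of_pos hσ]
      have a2 := Real.add_one_le_exp (η * |t|)
      have a3 : 0 ≤ η * |t| := by positivity
      have a4 : |t| ≤ 1 / η * Real.exp (η * |t|) := by
        rw [div_mul_eq_mul_div, le_div_iff₀ hη0]; linarith
      nlinarith [Real.one_le_exp a3]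
    calc _ ≤ _ := mul_le_mul (hball z hz t) h1 (norm_nonneg _) (by positivity)
      _ = C * Real.exp (σ * (|w.re| + η)) * (σ + 1 / η) *
          (Real.exp (-((2 * η) * |t|)) * Real.exp (η * |t|)) := by ring
      _ = _ := by rw [← Real.exp_add]; congr 2; ring
  · have h1 : HasDerivAt (fun z : ℂ => -((σ + t * I) * z)) (-(σ + t * I)) z := by
      simpa using! ((hasDerivAt_id z).const_mul ((σ : ℂ) + t * I)).neg
    have := (h1.cexp.const_mul (Complex.Gamma (σ + t * I)))
    simpa [mul_assoc] using this

lemma F_real (σ : ℝ) (hσ : 0 < σ) (l : ℝ) : F σ l = 2 * π * cexp (-cexp l) := by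
  have hx : 0 < Real.exp l := Real.exp_pos l
  have hmel : ∀ s : ℂ, 0 < s.re → mellin (fun x : ℝ => ((Real.exp (-x) : ℝ) : ℂ)) s = Complex.Gamma s := by
    intro s hs
    rw [Complex.Gamma_eq_integral hs, Complex.GammaIntegral_eq_mellin]
  have hI := (F_diff σ hσ 0 (by simp; positivity)).1
  have h := mellinInv_mellin_eq σ (fun x : ℝ => ((Real.exp (-x) : ℝ) : ℂ)) hx ?_ ?_ ?_
  · rw [mellinInv] at h
    have e : (∫ y : ℝ, ((Real.exp l : ℝ) : ℂ) ^ (-(σ + y * I) : ℂ) •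
        mellin (fun x : ℝ => ((Real.exp (-x) : ℝ) : ℂ)) (σ + y * I)) = F σ l := by
      rw [F]
      congr 1; ext t
      rw [hmel _ (by simpa), smul_eq_mul, mul_comm, Complex.cpow_def_of_ne_zero (by exact_mod_cast hx.ne'),
        ← Complex.ofReal_log hx.le, Real.log_exp]
      congr 2; ring
    rw [e] at h
    have hp : (π : ℂ) ≠ 0 := by exact_mod_cast pi_pos.ne'
    have : F σ l = 2 * π * ((1 / (2 * π) : ℝ) • F σ l) := by
      rw [Complex.real_smul]; push_cast; field_simp
    rw [this, h]; push_cast; rfl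
  · have := Complex.GammaIntegral_convergent (s := (σ : ℂ)) (by simpa)
    rw [MellinConvergent]
    refine this.congr_fun (fun x _ => ?_) measurableSet_Ioi
    simp [mul_comm]
  · rw [VerticalIntegrable]
    refine hI.congr (Eventually.of_forall fun t => ?_)
    simp only
    rw [hmel _ (by simpa)]; simp
  · fun_prop

lemma F_eq (σ : ℝ) (hσ : 0 < σ) (w : ℂ) (hw : |w.im| < π / 2) : F σ w = 2 * π * cexp (-cexp w) := by
  have hopen : IsOpen {w : ℂ | |w.im| < π / 2} :=
    isOpen_lt (by fun_prop) continuous_const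
  have hconv : Convex ℝ {w : ℂ | |w.im| < π / 2} := by
    have : {w : ℂ | |w.im| < π / 2} = Complex.imLm ⁻¹' (Metric.ball (0:ℝ) (π / 2)) := by
      ext z; simp [Complex.imLm]
    rw [this]
    exact (convex_ball _ _).linear_preimage _
  have d1 : DifferentiableOn ℂ (F σ) {w : ℂ | |w.im| < π / 2} :=
    fun z hz => (F_diff σ hσ z hz).2.differentiableWithinAt
  have d2 : DifferentiableOn ℂ (fun w : ℂ => 2 * π * cexp (-cexp w)) {w : ℂ | |w.im| < π / 2} :=
    Differentiable.differentiableOn (by fun_prop)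
  refine (d1.analyticOnNhd hopen).eqOn_of_preconnected_of_frequently_eq (d2.analyticOnNhd hopen)
    hconv.isPreconnected (z₀ := 0) (by simp; positivity) ?_ hw
  have ht : Tendsto (fun x : ℝ => (x : ℂ)) (𝓝[≠] 0) (𝓝[≠] 0) := by
    refine tendsto_nhdsWithin_of_tendsto_nhds_of_eventually_within _ ?_ ?_
    · have : Tendsto (fun x : ℝ => (x : ℂ)) (𝓝 0) (𝓝 ((0:ℝ) : ℂ)) := Complex.continuous_ofReal.tendsto 0
      simpa using this.mono_left nhdsWithin_le_nhds
    · filter_upwards [self_mem_nhdsWithin] with x hx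
      simpa using hx
  refine ht.frequently (Eventually.frequently (Eventually.of_forall fun x => ?_))
  exact F_real σ hσ x

lemma integral_H (l θ σ : ℝ) (hσ : 0 < σ) (hθ0 : 0 ≤ θ) (hθ : θ < π / 2) :
    Integrable (fun t : ℝ => H l θ (σ + t * I)) ∧
    ∫ t : ℝ, H l θ (σ + t * I) = 2 * π * cexp (-cexp (l + θ * I)) := by
  have hw : |((l : ℂ) + θ * I).im| < π / 2 := by simp [abs_of_nonneg hθ0, hθ]
  exact ⟨(F_diff σ hσ _ hw).1, F_eq σ hσ _ hw⟩

end VIS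

namespace VIS
open MeasureTheory Filter Topology Set

lemma expint_neg (d k a b : ℝ) (hk : 0 < k) :
    ∫ u in a..b, Real.exp (d - k * u) ≤ Real.exp (d - k * a) / k := by
  have h : ∀ u ∈ uIcc a b, HasDerivAt (fun u => -(Real.exp (d - k * u) / k)) (Real.exp (d - k * u)) u := by
    intro u _
    have h1 : HasDerivAt (fun u : ℝ => d - k * u) (-k) u := by
      simpa using! ((hasDerivAt_id u).const_mul k).const_sub d
    have h2 := (h1.exp.div_const k).neg
    convert! h2 using 1
    field_simp
  rw [intervalIntegral.integral_eq_sub_of_hasDerivAt h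
    (Continuous.intervalIntegrable (by fun_prop) _ _)]
  have : 0 < Real.exp (d - k * b) / k := by positivity
  linarith

lemma expint_pos (d k a b : ℝ) (hk : 0 < k) :
    ∫ u in a..b, Real.exp (d + k * u) ≤ Real.exp (d + k * b) / k := by
  have h : ∀ u ∈ uIcc a b, HasDerivAt (fun u => Real.exp (d + k * u) / k) (Real.exp (d + k * u)) u := by
    intro u _
    have h1 : HasDerivAt (fun u : ℝ => d + k * u) k u := by
      simpa using! ((hasDerivAt_id u).const_mul k).const_add d
    have h2 := (h1.exp.div_const k)
    convert! h2 using 1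
    field_simp
  rw [intervalIntegral.integral_eq_sub_of_hasDerivAt h
    (Continuous.intervalIntegrable (by fun_prop) _ _)]
  have : 0 < Real.exp (d + k * a) / k := by positivity
  linarith

lemma H_bound (S : ℝ) : ∃ C : ℝ, 0 < C ∧ ∀ l θ u t : ℝ, 1 ≤ t → u ≤ S →
    ‖H l θ (u + t * I)‖ ≤ C * Real.exp ((u - 1/2) * Real.log t - l * u - (π / 2 - θ) * t) := by
  obtain ⟨C, hC, h⟩ := Gamma_bound
  refine ⟨C * Real.exp (max S 0 ^ 3 / 2), by positivity, ?_⟩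
  intro l θ u t ht hu
  rw [norm_H]
  have h3 : max u 0 ^ 3 / (2 * t ^ 2) ≤ max S 0 ^ 3 / 2 := by
    have : max u 0 ≤ max S 0 := max_le_max_right 0 hu
    have : max u 0 ^ 3 ≤ max S 0 ^ 3 := by gcongr
    calc _ ≤ max S 0 ^ 3 / (2 * t ^ 2) := by gcongr
      _ ≤ _ := by gcongr; nlinarith
  calc _ ≤ C * Real.exp ((u - 1/2) * Real.log t - π * t / 2 + max u 0 ^ 3 / (2 * t ^ 2)) *
        Real.exp (θ * t - l * u) := by gcongr; exact h t u ht
    _ = C * Real.exp ((u - 1/2) * Real.log t - π * t / 2 + max u 0 ^ 3 / (2 * t ^ 2) +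
        (θ * t - l * u)) := by rw [mul_assoc, ← Real.exp_add]
    _ ≤ C * Real.exp (max S 0 ^ 3 / 2 + ((u - 1/2) * Real.log t - l * u - (π / 2 - θ) * t)) := by
        refine mul_le_mul_of_nonneg_left (Real.exp_le_exp.2 ?_) hC.le
        linarith
    _ = _ := by rw [Real.exp_add]; ring

/-- tail bound by shifting to the left -/
lemma tail_bound (S : ℝ) : ∃ C : ℝ, 0 < C ∧ ∀ l θ σ Z : ℝ, 0 < σ → σ ≤ S → 0 ≤ θ → θ < π / 2 → 1 ≤ Z →
    l < Real.log Z →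
    ‖∫ t in Ioi Z, H l θ (σ + t * I)‖ ≤
      C * (Real.exp ((σ - 1/2) * Real.log Z - l * σ) / (Real.log Z - l)) := by
  obtain ⟨C, hC, hH⟩ := H_bound S
  refine ⟨C, hC, ?_⟩
  intro l θ σ Z hσ hσS hθ0 hθ hZ hl
  have hZ0 : 0 < Z := by linarith
  set z := Real.log Z with hz
  have hz0 : 0 ≤ z := Real.log_nonneg hZ
  have hlam : 0 < z - l := by linarith
  set A := C * (Real.exp ((σ - 1/2) * z - l * σ) / (z - l)) with hA
  have hInt := (integral_H l θ σ hσ hθ0 hθ).1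
  -- the finite rectangle
  have rect : ∀ K : ℕ, 2 ≤ K → ∀ W : ℝ, Z ≤ W → ‖∫ t in Z..W, H l θ (σ + t * I)‖ ≤
      A + C * Real.exp (3 * z / 2 - (z - l) * K) +
        C * Real.exp (|l| * (|S| + K)) * (σ + K) * (W ^ |S| * Real.exp (-(π / 2 - θ) * W)) := by
    intro K hK W hW
    have hK0 : (2:ℝ) ≤ K := by exact_mod_cast hK
    have hW1 : 1 ≤ W := by linarith
    have hrect := Complex.integral_boundary_rect_eq_zero_of_differentiableOn (H l θ)
      (((-K : ℝ) : ℂ) + (Z : ℂ) * I) ((σ : ℂ) + (W : ℂ) * I) ?_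
    · have e1 : (((-K : ℝ) : ℂ) + (Z : ℂ) * I).re = -K := by simp
      have e2 : (((-K : ℝ) : ℂ) + (Z : ℂ) * I).im = Z := by simp
      have e3 : ((σ : ℂ) + (W : ℂ) * I).re = σ := by simp
      have e4 : ((σ : ℂ) + (W : ℂ) * I).im = W := by simp
      rw [e1, e2, e3, e4] at hrect
      simp only [smul_eq_mul] at hrect
      have hn : ‖∫ t in Z..W, H l θ (σ + t * I)‖ ≤
          ‖∫ x in (-K : ℝ)..σ, H l θ (x + Z * I)‖ + ‖∫ x in (-K : ℝ)..σ, H l θ (x + W * I)‖ +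
            ‖∫ t in Z..W, H l θ ((-K : ℝ) + t * I)‖ := by
        have : I * (∫ t in Z..W, H l θ (σ + t * I)) =
            -(∫ x in (-K : ℝ)..σ, H l θ (x + Z * I)) + (∫ x in (-K : ℝ)..σ, H l θ (x + W * I)) +
            I * ∫ t in Z..W, H l θ ((-K : ℝ) + t * I) := by linear_combination hrect
        have h2 := congrArg norm this
        rw [norm_mul, Complex.norm_I, one_mul] at h2
        rw [h2]
        refine (norm_add_le _ _).trans ?_
        refine add_le_add ((norm_add_le _ _).trans ?_) ?_
        · rw [norm_neg]
        · rw [norm_mul, Complex.norm_I, one_mul]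
      -- horizontal at Z
      have hA' : ‖∫ x in (-K : ℝ)..σ, H l θ (x + Z * I)‖ ≤ A := by
        have : ‖∫ x in (-K : ℝ)..σ, H l θ (x + Z * I)‖ ≤
            ∫ x in (-K : ℝ)..σ, C * Real.exp (-z / 2 + (z - l) * x) := by
          apply intervalIntegral.norm_integral_le_of_norm_le (by linarith)
          · refine Eventually.of_forall fun x hx => (hH l θ x Z hZ (hx.2.trans hσS)).trans ?_
            refine mul_le_mul_of_nonneg_left (Real.exp_le_exp.2 ?_) hC.le
            have : 0 ≤ (π / 2 - θ) * Z := mul_nonneg (by linarith) hZ0.le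
            nlinarith
          · exact Continuous.intervalIntegrable (by fun_prop) _ _
        refine this.trans ?_
        rw [intervalIntegral.integral_const_mul]
        refine mul_le_mul_of_nonneg_left ((expint_pos _ _ _ _ hlam).trans_eq ?_) hC.le
        congr 2; ring
      have hB' : ‖∫ x in (-K : ℝ)..σ, H l θ (x + W * I)‖ ≤
          C * Real.exp (|l| * (|S| + K)) * (σ + K) * (W ^ |S| * Real.exp (-(π / 2 - θ) * W)) := by
        have hlogW : 0 ≤ Real.log W := Real.log_nonneg hW1
        have : ‖∫ x in (-K : ℝ)..σ, H l θ (x + W * I)‖ ≤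
            C * Real.exp (|l| * (|S| + K)) * (W ^ |S| * Real.exp (-(π / 2 - θ) * W)) * |σ - (-K : ℝ)| := by
          apply intervalIntegral.norm_integral_le_of_norm_le_const
          intro x hx
          rw [uIoc_of_le (by linarith)] at hx
          refine (hH l θ x W hW1 (hx.2.trans hσS)).trans ?_
          rw [Real.rpow_def_of_pos (by linarith), mul_assoc, ← Real.exp_add, ← Real.exp_add]
          refine mul_le_mul_of_nonneg_left (Real.exp_le_exp.2 ?_) hC.le
          have h1 : (x - 1/2) * Real.log W ≤ Real.log W * |S| := by
            rw [mul_comm]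
            exact mul_le_mul_of_nonneg_left (by linarith [le_abs_self S, hx.2]) hlogW
          have h2 : -(l * x) ≤ |l| * (|S| + K) := by
            calc -(l * x) ≤ |l * x| := neg_le_abs _
              _ = |l| * |x| := abs_mul _ _
              _ ≤ _ := by
                gcongr
                rw [abs_le]; constructor <;> linarith [le_abs_self S, abs_nonneg S, hx.1, hx.2]
          linarith
        refine this.trans_eq ?_
        rw [abs_of_nonneg (by linarith : (0:ℝ) ≤ σ - (-K : ℝ))]; ring
      have hD' : ‖∫ t in Z..W, H l θ ((-K : ℝ) + t * I)‖ ≤ C * Real.exp (3 * z / 2 - (z - l) * K) := by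
        have hcont : ContinuousOn (fun t : ℝ => (t ^ 2)⁻¹) (uIcc Z W) := by
          apply ContinuousOn.inv₀ (by fun_prop)
          intro t ht
          rw [uIcc_of_le hW] at ht
          have : 0 < t := lt_of_lt_of_le hZ0 ht.1
          positivity
        have : ‖∫ t in Z..W, H l θ ((-K : ℝ) + t * I)‖ ≤
            ∫ t in Z..W, C * Real.exp (3 * z / 2 - (z - l) * K) * (t ^ 2)⁻¹ := by
          apply intervalIntegral.norm_integral_le_of_norm_le hW
          · refine Eventually.of_forall fun t ht => ?_
            have ht1 : Z < t := ht.1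
            have ht0 : 0 < t := by linarith
            refine (hH l θ (-K) t (by linarith) (by linarith)).trans ?_
            have : (t ^ 2)⁻¹ = Real.exp (-(2 * Real.log t)) := by
              rw [Real.exp_neg, mul_comm, Real.exp_mul, Real.exp_log ht0]; norm_cast
            rw [this, mul_assoc, ← Real.exp_add]
            refine mul_le_mul_of_nonneg_left (Real.exp_le_exp.2 ?_) hC.le
            have h1 : 0 ≤ (π / 2 - θ) * t := mul_nonneg (by linarith) ht0.le
            have h2 : z ≤ Real.log t := Real.log_le_log hZ0 ht1.le
            nlinarith
          · exact (hcont.const_smul (C * Real.exp (3 * z / 2 - (z - l) * K))).intervalIntegrable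
        refine this.trans ?_
        rw [intervalIntegral.integral_const_mul]
        apply mul_le_of_le_one_right (by positivity)
        have hd : ∀ t ∈ uIcc Z W, HasDerivAt (fun t : ℝ => -t⁻¹) ((t ^ 2)⁻¹) t := by
          intro t ht
          rw [uIcc_of_le hW] at ht
          have : 0 < t := lt_of_lt_of_le hZ0 ht.1
          simpa using! (hasDerivAt_inv this.ne').neg
        rw [intervalIntegral.integral_eq_sub_of_hasDerivAt hd hcont.intervalIntegrable]
        have : 0 < W⁻¹ := by positivity
        have : Z⁻¹ ≤ 1 := inv_le_one_of_one_le₀ hZ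
        linarith
      linarith
    · intro s hs
      rw [Complex.mem_reProdIm] at hs
      have := hs.2
      simp only [Complex.add_im, Complex.ofReal_im, Complex.mul_im, Complex.ofReal_re, Complex.I_im,
        Complex.I_re, mul_one, mul_zero, add_zero, zero_add] at this
      rw [uIcc_of_le hW] at this
      exact (diffAt_H l θ (Or.inr (by linarith [this.1]))).differentiableWithinAt
  -- let W go to infinity
  have lim1 : ∀ K : ℕ, 2 ≤ K → ‖∫ t in Ioi Z, H l θ (σ + t * I)‖ ≤
      A + C * Real.exp (3 * z / 2 - (z - l) * K) := by
    intro K hK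
    have t1 := (intervalIntegral_tendsto_integral_Ioi Z hInt.integrableOn tendsto_id).norm
    have t2 := (tendsto_rpow_mul_exp_neg_mul_atTop_nhds_zero |S| (π / 2 - θ) (by linarith)).const_mul
      (C * Real.exp (|l| * (|S| + K)) * (σ + K))
    have t3 := t2.const_add (A + C * Real.exp (3 * z / 2 - (z - l) * K))
    rw [mul_zero, add_zero] at t3
    refine le_of_tendsto_of_tendsto t1 t3 ?_
    filter_upwards [eventually_ge_atTop Z] with W hW
    exact rect K hK W hW
  have t4 : Tendsto (fun K : ℕ => A + C * Real.exp (3 * z / 2 - (z - l) * K)) atTop (𝓝 (A + C * 0)) := by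
    refine (Tendsto.const_mul C ?_).const_add A
    refine Real.tendsto_exp_atBot.comp ?_
    refine tendsto_atBot_add_const_left atTop _ ?_
    exact tendsto_neg_atTop_atBot.comp (tendsto_natCast_atTop_atTop.const_mul_atTop hlam)
  rw [mul_zero, add_zero] at t4
  exact ge_of_tendsto t4 (by filter_upwards [eventually_ge_atTop 2] with K hK using lim1 K hK)

lemma Gamma_sup (S : ℝ) : ∃ C : ℝ, 0 < C ∧ ∀ σ : ℝ, 1 ≤ σ → σ ≤ S → Real.Gamma σ ≤ C := by
  have hc : ContinuousOn Real.Gamma (Icc 1 S) := by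
    intro x hx
    apply ContinuousAt.continuousWithinAt
    apply (Real.differentiableAt_Gamma _).continuousAt
    intro m
    have : (0:ℝ) ≤ m := Nat.cast_nonneg m
    have := hx.1
    intro h; linarith
  obtain ⟨C, hC⟩ := isCompact_Icc.exists_bound_of_continuousOn hc
  refine ⟨max C 1, by positivity, fun σ h1 h2 => ?_⟩
  exact ((le_abs_self _).trans (hC σ ⟨h1, h2⟩)).trans (le_max_left _ _)

/-- left shift estimate -/
lemma left_bound (S : ℝ) : ∃ C : ℝ, 0 < C ∧ ∀ (σ Z : ℝ) (x : ℕ), 1 ≤ σ → σ ≤ S → 1 ≤ Z → 1 ≤ x →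
    Real.log (2 * π * x) < Real.log Z →
    ‖(∫ t in (0:ℝ)..Z, H (Real.log (2 * π * x)) (π / 2) (σ + t * I)) - 2 * π‖ ≤
      C * (Real.exp (-(Real.log (2 * π * x) * σ)) +
       Real.exp ((σ - 1/2) * Real.log Z - Real.log (2 * π * x) * σ) / (Real.log Z - Real.log (2 * π * x))) := by
  obtain ⟨C1, hC1, h1⟩ := tail_bound S
  obtain ⟨C2, hC2, h2⟩ := Gamma_sup S
  refine ⟨C1 + C2, by positivity, ?_⟩
  intro σ Z x hσ hσS hZ hx hl
  have hX : 0 < 2 * π * (x : ℝ) := by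
    have : (0:ℝ) < x := by exact_mod_cast hx
    positivity
  set l := Real.log (2 * π * x) with hldef
  have hσ0 : 0 < σ := by linarith
  set E := Real.exp ((σ - 1/2) * Real.log Z - l * σ) / (Real.log Z - l) with hE
  have hE0 : 0 < E := by
    rw [hE]; exact div_pos (Real.exp_pos _) (by linarith)
  have step : ∀ θ : ℝ, 1 ≤ θ → θ < π / 2 →
      ‖(∫ t in (0:ℝ)..Z, H l θ (σ + t * I)) - 2 * π * cexp (-cexp (l + θ * I))‖ ≤
        (C1 + C2) * (Real.exp (-(l * σ)) + E) := by
    intro θ hθ1 hθ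
    obtain ⟨hI, hval⟩ := integral_H l θ σ hσ0 (by linarith) hθ
    have hsplit : ∫ t : ℝ, H l θ (σ + t * I) = (∫ t in Iic (0:ℝ), H l θ (σ + t * I)) +
        ((∫ t in (0:ℝ)..Z, H l θ (σ + t * I)) + ∫ t in Ioi Z, H l θ (σ + t * I)) := by
      rw [intervalIntegral.integral_interval_add_Ioi hI.integrableOn hI.integrableOn,
        intervalIntegral.integral_Iic_add_Ioi hI.integrableOn hI.integrableOn]
    rw [← hval, hsplit]
    have hlow : ‖∫ t in Iic (0:ℝ), H l θ (σ + t * I)‖ ≤ C2 * Real.exp (-(l * σ)) := by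
      have hb : ‖∫ t in Iic (0:ℝ), H l θ (σ + t * I)‖ ≤
          ∫ t in Iic (0:ℝ), C2 * Real.exp (-(l * σ)) * Real.exp (θ * t) := by
        apply norm_integral_le_of_norm_le
        · exact (integrableOn_exp_mul_Iic (by linarith : 0 < θ) 0).const_mul _
        · refine Eventually.of_forall fun t => ?_
          rw [norm_H, sub_eq_add_neg, Real.exp_add, mul_comm (Real.exp (θ * t)), ← mul_assoc]
          gcongr
          exact (norm_Gamma_le σ t hσ0).trans (h2 σ hσ hσS)
      refine hb.trans ?_
      rw [integral_const_mul, integral_exp_mul_Iic (by linarith : 0 < θ)]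
      apply mul_le_of_le_one_right (by positivity)
      simp only [mul_zero, Real.exp_zero]
      rw [div_le_one (by linarith)]; exact hθ1
    have htail := h1 l θ σ Z hσ0 hσS (by linarith) hθ hZ hl
    have e : (∫ t in (0:ℝ)..Z, H l θ (σ + t * I)) - ((∫ t in Iic (0:ℝ), H l θ (σ + t * I)) +
        ((∫ t in (0:ℝ)..Z, H l θ (σ + t * I)) + ∫ t in Ioi Z, H l θ (σ + t * I))) =
        -((∫ t in Iic (0:ℝ), H l θ (σ + t * I)) + ∫ t in Ioi Z, H l θ (σ + t * I)) := by ring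
    rw [e, norm_neg]
    refine (norm_add_le _ _).trans ?_
    have : 0 < Real.exp (-(l * σ)) := Real.exp_pos _
    nlinarith
  have hcont : Continuous fun θ : ℝ =>
      ‖(∫ t in (0:ℝ)..Z, H l θ (σ + t * I)) - 2 * π * cexp (-cexp (l + θ * I))‖ := by
    apply Continuous.norm
    apply Continuous.sub
    · apply intervalIntegral.continuous_parametric_intervalIntegral_of_continuous'
      unfold H Function.uncurry
      apply Continuous.mul
      · exact (continuous_Gamma_vert σ hσ0).comp continuous_snd
      · fun_prop
    · fun_prop
  have hlim := (hcont.tendsto (π / 2)).mono_left (nhdsWithin_le_nhds (s := Iio (π / 2)))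
  have hfin := le_of_tendsto hlim (b := (C1 + C2) * (Real.exp (-(l * σ)) + E)) (by
    have : Ioo 1 (π / 2) ∈ 𝓝[<] (π / 2) := Ioo_mem_nhdsLT (by linarith [Real.pi_gt_three])
    filter_upwards [this] with θ hθ using step θ hθ.1.le hθ.2)
  have e : cexp (-cexp (l + ((π / 2 : ℝ) : ℂ) * I)) = 1 := by
    rw [Complex.exp_add, ← Complex.ofReal_exp, hldef, Real.exp_log hX]
    push_cast
    rw [Complex.exp_pi_div_two_mul_I, Complex.exp_eq_one_iff]
    exact ⟨-(x : ℤ), by push_cast; ring⟩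
  rw [e, mul_one] at hfin
  exact hfin

end VIS

namespace VIS
open MeasureTheory Filter Topology Set

lemma Gamma_right (S : ℝ) : ∃ C : ℝ, 0 < C ∧ ∀ σ V u : ℝ, 1 ≤ σ → σ ≤ S → 1 ≤ V → σ ≤ u → u ≤ V →
    Real.Gamma u ≤ C * Real.exp (Real.log V * (u - σ)) := by
  obtain ⟨C, hC, h⟩ := Gamma_sup (S + 1)
  refine ⟨C, hC, ?_⟩
  intro σ V u hσ hσS hV
  have hlV : 0 ≤ Real.log V := Real.log_nonneg hV
  have key : ∀ n : ℕ, ∀ u : ℝ, σ ≤ u → u ≤ σ + n + 1 → u ≤ V →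
      Real.Gamma u ≤ C * Real.exp (Real.log V * (u - σ)) := by
    intro n
    induction n with
    | zero =>
      intro u h1 h2 h3
      simp only [Nat.cast_zero, add_zero] at h2
      have := h u (by linarith) (by linarith)
      have h4 : 1 ≤ Real.exp (Real.log V * (u - σ)) :=
        Real.one_le_exp (mul_nonneg hlV (by linarith))
      nlinarith
    | succ n ih =>
      intro u h1 h2 h3
      push_cast at h2
      by_cases hu : u ≤ σ + n + 1
      · exact ih u h1 hu h3
      · push Not at hu
        have hn : (0:ℝ) ≤ n := Nat.cast_nonneg n
        have := ih (u - 1) (by linarith) (by linarith) (by linarith)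
        have e : Real.Gamma u = (u - 1) * Real.Gamma (u - 1) := by
          rw [← Real.Gamma_add_one (by linarith)]; congr 1; ring
        rw [e]
        have e2 : C * Real.exp (Real.log V * (u - σ)) =
            V * (C * Real.exp (Real.log V * (u - 1 - σ))) := by
          have : Real.log V * (u - σ) = Real.log V + Real.log V * (u - 1 - σ) := by ring
          rw [this, Real.exp_add, Real.exp_log (by linarith)]; ring
        rw [e2]
        exact mul_le_mul (by linarith) this (Real.Gamma_pos_of_pos (by linarith)).le (by linarith)
  intro h1 h2
  exact key ⌈u - σ⌉₊ u h1 (by linarith [Nat.le_ceil (u - σ)]) h2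

lemma Gamma_nat_half (k : ℕ) (t R : ℝ) (hR : 0 ≤ R) (hkR : (k:ℝ) ^ 2 + t ^ 2 ≤ R ^ 2) :
    ∀ j : ℕ, j ≤ k → ‖Complex.Gamma (((j + 1/2 : ℝ) : ℂ) + t * I)‖ ≤
      √(2 * π) * Real.exp (-(π * t / 2)) * R ^ j := by
  intro j
  induction j with
  | zero =>
    intro _
    simpa using norm_Gamma_half t
  | succ j ih =>
    intro hj
    have h1 := ih (by omega)
    have hj0 : (0:ℝ) ≤ j := Nat.cast_nonneg j
    have hjk : (j:ℝ) + 1 ≤ k := by exact_mod_cast hj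
    have e : (((((j+1 : ℕ):ℝ) + 1/2 : ℝ) : ℂ) + t * I) = (((j + 1/2 : ℝ) : ℂ) + t * I) + 1 := by
      push_cast; ring
    have hne : (((j + 1/2 : ℝ) : ℂ) + t * I) ≠ 0 := by
      intro h0
      have := congrArg Complex.re h0
      simp at this
      linarith
    rw [e, Complex.Gamma_add_one _ hne, norm_mul, pow_succ, ← mul_assoc, mul_comm]
    refine mul_le_mul h1 ?_ (norm_nonneg _) (by positivity)
    rw [Complex.norm_add_mul_I]
    apply Real.sqrt_le_iff.2 ⟨hR, ?_⟩
    nlinarith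

lemma comb3 {a b c x y w : ℝ} (ha : 0 ≤ a) (hb : 0 ≤ b) (hc : 0 ≤ c) (hx : 0 ≤ x) (hy : 0 ≤ y)
    (hw : 0 ≤ w) : a * x + b * y + c * w ≤ (a + b + c) * (x + y + w) := by
  have : 0 ≤ a * y + a * w + b * x + b * w + c * x + c * y := by positivity
  linarith

set_option maxHeartbeats 2000000 in
lemma right_main (S : ℝ) (hS : 1 ≤ S) : ∃ C : ℝ, 0 < C ∧ ∀ σ l r : ℝ, 1 ≤ σ → σ ≤ S → S + 11 ≤ r →
    r ^ 2 / 2 ≤ Real.exp l → ∃ U : ℝ, σ + r ≤ U ∧ U ≤ 2 * r ∧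
    ‖∫ t in (0:ℝ)..r ^ 2, H l (π / 2) (σ + t * I)‖ ≤
      C * (Real.exp (-(l * σ)) + (∫ u in σ..U, Real.exp (-Real.log r - (l - 2 * Real.log r) * u))
        + Real.exp (- ((l - 2 * Real.log r) * U))) := by
  obtain ⟨C1, hC1, h1⟩ := Gamma_right S
  obtain ⟨C2, hC2, h2⟩ := Gamma_bound
  set C3 := √(2 * π) * (2 * Real.exp 4) with hC3
  have hC30 : 0 < C3 := by positivity
  refine ⟨C1 / Real.log 2 + C2 * Real.exp 4 + C3, by positivity, ?_⟩
  intro σ l r hσ hσS hr hX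
  have hr0 : 0 < r := by linarith
  set k := ⌈r + S⌉₊ with hk
  have hk1 : r + S ≤ k := Nat.le_ceil _
  have hk2 : (k:ℝ) < r + S + 1 := Nat.ceil_lt_add_one (by linarith)
  set U : ℝ := k + 1/2 with hU
  have hU1 : σ + r ≤ U := by linarith
  have hU2 : U ≤ 2 * r := by linarith
  have hσU : σ ≤ U := by linarith
  refine ⟨U, hU1, hU2, ?_⟩
  set z := 2 * Real.log r with hz
  have hlr0 : 0 ≤ Real.log r := Real.log_nonneg (by linarith)
  have hrz : r ^ 2 = Real.exp z := by
    rw [hz, mul_comm, Real.exp_mul, Real.exp_log hr0]; norm_cast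
  have hlogZ : Real.log (r ^ 2) = z := by rw [hrz, Real.log_exp]
  have hZ1 : 1 ≤ r ^ 2 := by nlinarith
  have hV : U ≤ Real.exp l / 2 := by nlinarith
  have hV1 : 1 ≤ Real.exp l / 2 := by nlinarith
  have hlogV : Real.log (Real.exp l / 2) = l - Real.log 2 := by
    rw [Real.log_div (Real.exp_pos l).ne' (by norm_num), Real.log_exp]
  have hl2 : 0 < Real.log 2 := Real.log_pos (by norm_num)
  have hrect := Complex.integral_boundary_rect_eq_zero_of_differentiableOn (H l (π / 2))
      ((σ : ℂ) + ((0:ℝ) : ℂ) * I) ((U : ℂ) + ((r ^ 2 : ℝ) : ℂ) * I) ?_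
  swap
  · intro s hs
    rw [Complex.mem_reProdIm] at hs
    have := hs.1
    simp only [Complex.add_re, Complex.ofReal_im, Complex.mul_re, Complex.ofReal_re, Complex.I_im,
      Complex.I_re, mul_one, mul_zero, add_zero, sub_zero] at this
    rw [uIcc_of_le hσU] at this
    exact (diffAt_H l _ (Or.inl (by linarith [this.1]))).differentiableWithinAt
  have e1 : ((σ : ℂ) + ((0:ℝ) : ℂ) * I).re = σ := by simp
  have e2 : ((σ : ℂ) + ((0:ℝ) : ℂ) * I).im = 0 := by simp
  have e3 : ((U : ℂ) + ((r ^ 2 : ℝ) : ℂ) * I).re = U := by simp [-Complex.ofReal_pow]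
  have e4 : ((U : ℂ) + ((r ^ 2 : ℝ) : ℂ) * I).im = r ^ 2 := by simp [-Complex.ofReal_pow]
  rw [e1, e2, e3, e4] at hrect
  simp only [smul_eq_mul] at hrect
  have hn : ‖∫ t in (0:ℝ)..r ^ 2, H l (π / 2) (σ + t * I)‖ ≤
      ‖∫ x in σ..U, H l (π / 2) (x + (0:ℝ) * I)‖ + ‖∫ x in σ..U, H l (π / 2) (x + (r ^ 2 : ℝ) * I)‖ +
        ‖∫ t in (0:ℝ)..r ^ 2, H l (π / 2) (U + t * I)‖ := by
    have : I * (∫ t in (0:ℝ)..r ^ 2, H l (π / 2) (σ + t * I)) =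
        (∫ x in σ..U, H l (π / 2) (x + (0:ℝ) * I)) - (∫ x in σ..U, H l (π / 2) (x + (r ^ 2 : ℝ) * I)) +
        I * ∫ t in (0:ℝ)..r ^ 2, H l (π / 2) (U + t * I) := by linear_combination -hrect
    have h2 := congrArg norm this
    rw [norm_mul, Complex.norm_I, one_mul] at h2
    rw [h2]
    refine (norm_add_le _ _).trans ?_
    refine add_le_add (norm_sub_le _ _) ?_
    rw [norm_mul, Complex.norm_I, one_mul]
  have hbot : ‖∫ x in σ..U, H l (π / 2) (x + (0:ℝ) * I)‖ ≤ C1 / Real.log 2 * Real.exp (-(l * σ)) := by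
    have : ‖∫ x in σ..U, H l (π / 2) (x + (0:ℝ) * I)‖ ≤
        ∫ x in σ..U, C1 * Real.exp ((Real.log 2 - l) * σ - Real.log 2 * x) := by
      apply intervalIntegral.norm_integral_le_of_norm_le hσU
      · refine Eventually.of_forall fun x hx => ?_
        rw [norm_H]
        have hx0 : 0 < x := by linarith [hx.1]
        have a1 := norm_Gamma_le x 0 hx0
        have a2 := h1 σ _ x hσ hσS hV1 hx.1.le (hx.2.trans hV)
        rw [hlogV] at a2
        refine (mul_le_mul_of_nonneg_right (a1.trans a2) (Real.exp_pos _).le).trans_eq ?_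
        rw [mul_assoc, ← Real.exp_add]
        congr 2; ring
      · exact Continuous.intervalIntegrable (by fun_prop) _ _
    refine this.trans ?_
    rw [intervalIntegral.integral_const_mul, div_mul_eq_mul_div, mul_div_assoc]
    refine mul_le_mul_of_nonneg_left ((expint_neg _ _ _ _ hl2).trans_eq ?_) hC1.le
    congr 2; ring
  have htop : ‖∫ x in σ..U, H l (π / 2) (x + (r ^ 2 : ℝ) * I)‖ ≤
      C2 * Real.exp 4 * ∫ u in σ..U, Real.exp (-Real.log r - (l - z) * u) := by
    rw [← intervalIntegral.integral_const_mul]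
    apply intervalIntegral.norm_integral_le_of_norm_le hσU
    · refine Eventually.of_forall fun x hx => ?_
      rw [norm_H]
      have hx0 : 0 < x := by linarith [hx.1]
      have hx2 : x ≤ 2 * r := hx.2.trans hU2
      refine (mul_le_mul_of_nonneg_right (h2 (r ^ 2) x hZ1) (Real.exp_pos _).le).trans ?_
      rw [mul_assoc, mul_assoc, ← Real.exp_add, ← Real.exp_add, hlogZ]
      refine mul_le_mul_of_nonneg_left (Real.exp_le_exp.2 ?_) hC2.le
      have b1 : (max x 0) ^ 3 / (2 * (r ^ 2) ^ 2) ≤ 4 := by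
        rw [max_eq_left hx0.le, div_le_iff₀ (by positivity)]
        calc x ^ 3 ≤ (2 * r) ^ 3 := pow_le_pow_left₀ hx0.le hx2 3
          _ ≤ 4 * (2 * (r ^ 2) ^ 2) := by nlinarith [pow_pos hr0 3]
      nlinarith
    · exact Continuous.intervalIntegrable (by fun_prop) _ _
  have hver : ‖∫ t in (0:ℝ)..r ^ 2, H l (π / 2) (U + t * I)‖ ≤ C3 * Real.exp (- ((l - z) * U)) := by
    have : ‖∫ t in (0:ℝ)..r ^ 2, H l (π / 2) (U + t * I)‖ ≤
        ∫ t in (0:ℝ)..r ^ 2, √(2 * π) * Real.exp ((k * z - l * U + 4 - r / 2) + (1 / (2 * r)) * t) := by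
      apply intervalIntegral.norm_integral_le_of_norm_le (by positivity)
      · refine Eventually.of_forall fun t ht => ?_
        have ht0 : 0 < t := ht.1
        have ht2 : t ≤ r ^ 2 := ht.2
        set w := (4 - (r ^ 2 - t)) / r ^ 2 with hw
        have hkR : (k:ℝ) ^ 2 + t ^ 2 ≤ (Real.exp (z + w / 2)) ^ 2 := by
          have : (Real.exp (z + w / 2)) ^ 2 = (r ^ 2) ^ 2 * Real.exp w := by
            rw [hrz, ← Real.exp_nat_mul, ← Real.exp_nat_mul, ← Real.exp_add]
            congr 1; push_cast; ring
          rw [this]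
          calc (k:ℝ) ^ 2 + t ^ 2 ≤ 4 * r ^ 2 + t * r ^ 2 := by
                have : (k:ℝ) ≤ 2 * r := by linarith
                have : (k:ℝ) ^ 2 ≤ (2 * r) ^ 2 := pow_le_pow_left₀ (Nat.cast_nonneg k) this 2
                nlinarith
            _ = (r ^ 2) ^ 2 * (w + 1) := by rw [hw]; field_simp; ring
            _ ≤ _ := by
              gcongr
              exact Real.add_one_le_exp w
        have g := Gamma_nat_half k t (Real.exp (z + w / 2)) (Real.exp_pos _).le hkR k le_rfl
        rw [norm_H]
        refine (mul_le_mul_of_nonneg_right g (Real.exp_pos _).le).trans ?_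
        rw [mul_assoc, mul_assoc, ← Real.exp_nat_mul, ← Real.exp_add, ← Real.exp_add]
        refine mul_le_mul_of_nonneg_left (Real.exp_le_exp.2 ?_) (by positivity)
        have hkw : k * (w / 2) ≤ 4 - r / 2 + (1 / (2 * r)) * t := by
          have e : k * (w / 2) = k * 2 / r ^ 2 - k * ((r ^ 2 - t) / (2 * r ^ 2)) := by
            rw [hw]; field_simp; ring
          rw [e]
          have q1 : k * 2 / r ^ 2 ≤ 4 := by
            rw [div_le_iff₀ (by positivity)]; nlinarith
          have q2 : r * ((r ^ 2 - t) / (2 * r ^ 2)) ≤ k * ((r ^ 2 - t) / (2 * r ^ 2)) := by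
            apply mul_le_mul_of_nonneg_right (by linarith)
            apply div_nonneg (by linarith) (by positivity)
          have q3 : r * ((r ^ 2 - t) / (2 * r ^ 2)) = r / 2 - (1 / (2 * r)) * t := by
            field_simp
          linarith
        nlinarith
      · exact Continuous.intervalIntegrable (by fun_prop) _ _
    refine this.trans ?_
    rw [intervalIntegral.integral_const_mul, hC3, mul_assoc]
    refine mul_le_mul_of_nonneg_left ((expint_pos _ _ _ _ (by positivity)).trans_eq ?_) (by positivity)
    have : k * z - l * U + 4 - r / 2 + 1 / (2 * r) * r ^ 2 = 4 + (-((l - z) * U)) - Real.log r := by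
      have : 1 / (2 * r) * r ^ 2 = r / 2 := by field_simp
      rw [this, hU, hz]; ring
    rw [this, Real.exp_sub, Real.exp_add, Real.exp_log hr0]
    field_simp
  have p1 : 0 ≤ ∫ u in σ..U, Real.exp (-Real.log r - (l - z) * u) :=
    intervalIntegral.integral_nonneg hσU fun u _ => (Real.exp_pos _).le
  have p2 : 0 < Real.exp (-(l * σ)) := Real.exp_pos _
  have p3 : 0 < Real.exp (- ((l - z) * U)) := Real.exp_pos _
  have p4 : 0 < C1 / Real.log 2 := by positivity
  have p5 : 0 < C2 * Real.exp 4 := by positivity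
  refine (hn.trans (add_le_add (add_le_add hbot htop) hver)).trans ?_
  exact comb3 p4.le p5.le hC30.le p2.le p1 p3.le

lemma right_far (S : ℝ) (hS : 1 ≤ S) : ∃ C : ℝ, 0 < C ∧ ∀ σ l r : ℝ, 1 ≤ σ → σ ≤ S → S + 11 ≤ r →
    2 * Real.log r < l →
    ‖∫ t in (0:ℝ)..r ^ 2, H l (π / 2) (σ + t * I)‖ ≤
      C * (Real.exp (-(l * σ)) + Real.exp ((σ - 1/2) * (2 * Real.log r) - l * σ) / (l - 2 * Real.log r)) := by
  obtain ⟨C, hC, h⟩ := right_main S hS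
  refine ⟨2 * C, by positivity, ?_⟩
  intro σ l r hσ hσS hr hl
  have hr0 : 0 < r := by linarith
  have hrz : r ^ 2 = Real.exp (2 * Real.log r) := by
    rw [mul_comm, Real.exp_mul, Real.exp_log hr0]; norm_cast
  obtain ⟨U, hU1, hU2, hb⟩ := h σ l r hσ hσS hr (by
    have := Real.exp_lt_exp.2 hl
    rw [← hrz] at this
    nlinarith)
  set μ := l - 2 * Real.log r with hμ
  have hμ0 : 0 < μ := by linarith
  have a1 := expint_neg (-Real.log r) μ σ U hμ0
  have e1 : -Real.log r - μ * σ = (σ - 1/2) * (2 * Real.log r) - l * σ := by rw [hμ]; ring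
  rw [e1] at a1
  have a2 : Real.exp (-(μ * U)) ≤ Real.exp ((σ - 1/2) * (2 * Real.log r) - l * σ) / μ := by
    rw [← e1, le_div_iff₀ hμ0]
    have b1 : Real.exp (-(μ * U)) ≤ Real.exp (-(μ * σ)) * Real.exp (-(μ * r)) := by
      rw [← Real.exp_add]; apply Real.exp_le_exp.2; nlinarith
    have b2 : Real.exp (-(μ * r)) * (μ * r) ≤ 1 := by
      rw [Real.exp_neg, inv_mul_le_iff₀ (Real.exp_pos _), mul_one]
      linarith [Real.add_one_le_exp (μ * r)]
    have b3 : Real.exp (-Real.log r - μ * σ) = Real.exp (-(μ * σ)) / r := by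
      rw [← Real.exp_log hr0, ← Real.exp_sub, Real.exp_log hr0]; congr 1; ring
    rw [b3, le_div_iff₀ hr0]
    calc Real.exp (-(μ * U)) * μ * r ≤ Real.exp (-(μ * σ)) * Real.exp (-(μ * r)) * μ * r := by gcongr
      _ = Real.exp (-(μ * σ)) * (Real.exp (-(μ * r)) * (μ * r)) := by ring
      _ ≤ _ := mul_le_of_le_one_right (Real.exp_pos _).le b2
  refine hb.trans ?_
  have := Real.exp_pos (-(l * σ))
  nlinarith

lemma right_near (S : ℝ) (hS : 1 ≤ S) : ∃ C : ℝ, 0 < C ∧ ∀ σ l r : ℝ, 1 ≤ σ → σ ≤ S → S + 11 ≤ r →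
    0 ≤ l → r ^ 2 / 2 ≤ Real.exp l → 2 * Real.log r - l ≤ 2 / r →
    ‖∫ t in (0:ℝ)..r ^ 2, H l (π / 2) (σ + t * I)‖ ≤ C := by
  obtain ⟨C, hC, h⟩ := right_main S hS
  refine ⟨C * (1 + 2 * Real.exp 4 + Real.exp 4), by positivity, ?_⟩
  intro σ l r hσ hσS hr hl0 hX hl
  have hr0 : 0 < r := by linarith
  obtain ⟨U, hU1, hU2, hb⟩ := h σ l r hσ hσS hr hX
  refine hb.trans ?_
  set μ := l - 2 * Real.log r with hμ
  have hb0 : ∀ u, 0 ≤ u → u ≤ U → -(μ * u) ≤ 4 := by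
    intro u hu hu2
    have : 2 / r * u ≤ 4 := by
      rw [div_mul_eq_mul_div, div_le_iff₀ hr0]; linarith
    nlinarith
  have a1 : Real.exp (-(l * σ)) ≤ 1 := by
    apply Real.exp_le_one_iff.2; nlinarith
  have a3 : Real.exp (-(μ * U)) ≤ Real.exp 4 := Real.exp_le_exp.2 (hb0 U (by linarith) le_rfl)
  have a2 : (∫ u in σ..U, Real.exp (-Real.log r - μ * u)) ≤ 2 * Real.exp 4 := by
    have : ‖∫ u in σ..U, Real.exp (-Real.log r - μ * u)‖ ≤ (Real.exp 4 / r) * |U - σ| := by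
      apply intervalIntegral.norm_integral_le_of_norm_le_const
      intro u hu
      rw [uIoc_of_le (by linarith)] at hu
      rw [Real.norm_of_nonneg (Real.exp_pos _).le, ← Real.exp_log hr0, ← Real.exp_sub, Real.exp_log hr0]
      apply Real.exp_le_exp.2
      linarith [hb0 u (by linarith [hu.1]) hu.2]
    refine (le_abs_self _).trans (this.trans ?_)
    rw [abs_of_nonneg (by linarith), div_mul_eq_mul_div, div_le_iff₀ hr0]
    have := Real.exp_pos 4
    nlinarith
  gcongr

lemma triv_bound (S Z0 : ℝ) : ∃ C : ℝ, 0 < C ∧ ∀ σ l Z : ℝ, 1 ≤ σ → σ ≤ S → 0 ≤ Z → Z ≤ Z0 →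
    ‖∫ t in (0:ℝ)..Z, H l (π / 2) (σ + t * I)‖ ≤ C * Real.exp (-(l * σ)) := by
  obtain ⟨C, hC, h⟩ := Gamma_sup S
  refine ⟨C * Real.exp (π / 2 * Z0) * (|Z0| + 1), by positivity, ?_⟩
  intro σ l Z hσ hσS hZ hZ0
  have : ‖∫ t in (0:ℝ)..Z, H l (π / 2) (σ + t * I)‖ ≤
      (C * Real.exp (π / 2 * Z0) * Real.exp (-(l * σ))) * |Z - 0| := by
    apply intervalIntegral.norm_integral_le_of_norm_le_const
    intro t ht
    rw [uIoc_of_le hZ] at ht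
    rw [norm_H, mul_assoc, ← Real.exp_add]
    refine mul_le_mul ((norm_Gamma_le σ t (by linarith)).trans (h σ hσ hσS)) ?_ (Real.exp_pos _).le hC.le
    apply Real.exp_le_exp.2
    have := Real.pi_pos
    nlinarith [ht.2]
  refine this.trans ?_
  rw [sub_zero, abs_of_nonneg hZ, mul_right_comm]
  gcongr
  linarith [le_abs_self Z0]

lemma small_bound (S : ℝ) : ∃ C : ℝ, 0 < C ∧ ∀ σ l a b : ℝ, 1 ≤ σ → σ ≤ S → 0 ≤ a → a ≤ b →
    ‖∫ t in a..b, H l (-(π / 2)) (σ + t * I)‖ ≤ C * Real.exp (-(l * σ)) := by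
  obtain ⟨C, hC, h⟩ := Gamma_sup S
  refine ⟨C, hC, ?_⟩
  intro σ l a b hσ hσS ha hab
  have : ‖∫ t in a..b, H l (-(π / 2)) (σ + t * I)‖ ≤
      ∫ t in a..b, C * Real.exp (-(l * σ) - (π / 2) * t) := by
    apply intervalIntegral.norm_integral_le_of_norm_le hab
    · refine Eventually.of_forall fun t ht => ?_
      rw [norm_H]
      refine mul_le_mul ((norm_Gamma_le σ t (by linarith)).trans (h σ hσ hσS)) ?_ (Real.exp_pos _).le hC.le
      apply Real.exp_le_exp.2
      linarith
    · exact Continuous.intervalIntegrable (by fun_prop) _ _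
  refine this.trans ?_
  rw [intervalIntegral.integral_const_mul]
  refine mul_le_mul_of_nonneg_left ((expint_neg _ _ _ _ (by positivity)).trans ?_) hC.le
  rw [div_le_iff₀ (by positivity)]
  have h1 : Real.exp (-(l * σ) - π / 2 * a) ≤ Real.exp (-(l * σ)) := by
    apply Real.exp_le_exp.2
    have := Real.pi_pos
    nlinarith
  have := Real.exp_pos (-(l * σ))
  have := Real.pi_gt_three
  nlinarith

end VIS

namespace VIS
open MeasureTheory Filter Topology Set

/-- the local kernel -/
noncomputable def K (Z X : ℝ) : ℝ := if Z / 2 ≤ X ∧ X ≤ 2 * Z then √Z / (|Z - X| + √Z) else 0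

lemma K_nonneg (Z X : ℝ) : 0 ≤ K Z X := by
  unfold K; split_ifs <;> positivity

lemma mid_aux {P d D M r : ℝ} (hr : 0 < r) (hM : 0 ≤ M) (hP : P ≤ M / r) (hD : r ≤ D)
    (hd : D / (2 * r ^ 2) ≤ d) : P / d ≤ 4 * M * (r / (D + r)) := by
  have hD0 : 0 < D := by linarith
  have hd0 : 0 < d := lt_of_lt_of_le (by positivity) hd
  calc P / d ≤ (M / r) / d := by gcongr
    _ ≤ (M / r) / (D / (2 * r ^ 2)) := by gcongr
    _ = 2 * M * (r / D) := by field_simp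
    _ ≤ 2 * M * (2 * (r / (D + r))) := by
      gcongr
      rw [mul_div_assoc', div_le_div_iff₀ hD0 (by linarith)]
      nlinarith
    _ = _ := by ring

set_option maxHeartbeats 1000000 in
lemma propE (S : ℝ) (hS : 1 ≤ S) : ∃ C : ℝ, 0 < C ∧ ∀ (σ Z : ℝ) (x : ℕ), 1 ≤ σ → σ ≤ S → 0 < Z →
    1 ≤ x →
    ‖(∫ t in (0:ℝ)..Z, H (Real.log (2 * π * x)) (π / 2) (σ + t * I)) -
        (if 2 * π * (x:ℝ) ≤ Z then 2 * π else 0)‖ ≤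
      C * (Real.exp (-(Real.log (2 * π * x) * σ)) * (1 + Real.exp ((σ - 1/2) * Real.log Z)) +
        K Z (2 * π * x)) := by
  obtain ⟨C1, hC1, h1⟩ := left_bound S
  obtain ⟨C2, hC2, h2⟩ := right_far S hS
  obtain ⟨C3, hC3, h3⟩ := right_near S hS
  obtain ⟨C4, hC4, h4⟩ := triv_bound S ((S + 11) ^ 2)
  set M := Real.exp (S * Real.log 2) with hM
  have hM0 : 0 < M := Real.exp_pos _
  set D4 := 2 * π * Real.exp (Real.log ((S + 11) ^ 2) * S) with hD4
  have hD40 : 0 < D4 := by positivity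
  have hl2 : 0 < Real.log 2 := Real.log_pos (by norm_num)
  set Q := (C1 + C2) * (1 + 1 / Real.log 2) with hQ
  have hQ0 : 0 < Q := by positivity
  refine ⟨C4 + D4 + Q + 2 * (C3 + 2 * π) + (C1 + C2) * (1 + 4 * M), by positivity, ?_⟩
  intro σ Z x hσ hσS hZ hx
  have hx1 : (1:ℝ) ≤ x := by exact_mod_cast hx
  have hX6 : 6 ≤ 2 * π * (x:ℝ) := by nlinarith [Real.pi_gt_three]
  have hE1 := h1 σ Z x hσ hσS
  set X := 2 * π * (x : ℝ) with hX
  have hX0 : 0 < X := by linarith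
  set l := Real.log X with hl
  have hl0 : 0 ≤ l := Real.log_nonneg (by linarith)
  have hexpl : Real.exp l = X := Real.exp_log hX0
  set E0 := Real.exp (-(l * σ)) with hE0
  have hE00 : 0 < E0 := Real.exp_pos _
  set z := Real.log Z with hz
  set E1 := Real.exp ((σ - 1/2) * z) with hE1'
  have hE10 : 0 < E1 := Real.exp_pos _
  have hEE : Real.exp ((σ - 1/2) * z - l * σ) = E0 * E1 := by
    rw [hE0, hE1', ← Real.exp_add]; congr 1; ring
  have hKn := K_nonneg Z X
  set J := ∫ t in (0:ℝ)..Z, H l (π / 2) (σ + t * I) with hJ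
  -- combining
  have hfin : ∀ G : ℝ, 0 ≤ G → G ≤ C4 + D4 + Q + 2 * (C3 + 2 * π) + (C1 + C2) * (1 + 4 * M) →
      ‖J - (if X ≤ Z then 2 * π else 0)‖ ≤ G * (E0 * (1 + E1) + K Z X) →
      ‖J - (if X ≤ Z then 2 * π else 0)‖ ≤
        (C4 + D4 + Q + 2 * (C3 + 2 * π) + (C1 + C2) * (1 + 4 * M)) * (E0 * (1 + E1) + K Z X) := by
    intro G hG hG2 hb
    exact hb.trans (mul_le_mul_of_nonneg_right hG2 (by positivity))
  have hq1 : 0 ≤ (C1 + C2) * (1 + 4 * M) := by positivity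
  have hq2 : 0 ≤ 2 * (C3 + 2 * π) := by positivity
  have hEpos : 0 ≤ E0 * E1 := by positivity
  have hpi := Real.pi_pos
  by_cases hZ0 : Z ≤ (S + 11) ^ 2
  · apply hfin (C4 + D4) (by positivity) (by linarith)
    have a := h4 σ l Z hσ hσS hZ.le hZ0
    have b : ‖((if X ≤ Z then 2 * π else 0 : ℝ) : ℂ)‖ ≤ D4 * E0 := by
      split_ifs with hXZ
      · have : ‖((2 * π : ℝ) : ℂ)‖ = 2 * π := by simp [abs_of_pos hpi]
        rw [this, hD4, hE0, mul_assoc (2 * π), ← Real.exp_add]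
        apply le_mul_of_one_le_right (by positivity)
        apply Real.one_le_exp
        have : l ≤ Real.log ((S + 11) ^ 2) := Real.log_le_log hX0 (hXZ.trans hZ0)
        nlinarith
      · simp; positivity
    refine (norm_sub_le _ _).trans ((add_le_add a b).trans ?_)
    have : 0 ≤ (C4 + D4) * (E0 * E1 + K Z X) := by positivity
    nlinarith
  push Not at hZ0
  set r := √Z with hr
  have hr2 : r ^ 2 = Z := Real.sq_sqrt hZ.le
  have hr0 : 0 < r := Real.sqrt_pos.2 hZ
  have hrS : S + 11 ≤ r := Real.le_sqrt_of_sq_le hZ0.le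
  have hlr : 2 * Real.log r = z := by
    rw [hz, ← hr2, Real.log_pow]; norm_num
  have hZ1 : 1 ≤ Z := by nlinarith
  -- generic off-diagonal treatments
  have hfar : z < l → ‖J - (if X ≤ Z then 2 * π else 0)‖ ≤ C2 * (E0 + (E0 * E1) / (l - z)) := by
    intro hzl
    have hXZ : ¬ X ≤ Z := by
      intro h
      exact absurd (Real.log_le_log hX0 h) (not_le.2 hzl)
    have := h2 σ l r hσ hσS hrS (by rw [hlr]; exact hzl)
    rw [hlr, hr2, hEE] at this
    simpa [hXZ] using this
  have hnear : l < z → ‖J - (if X ≤ Z then 2 * π else 0)‖ ≤ C1 * (E0 + (E0 * E1) / (z - l)) := by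
    intro hzl
    have hXZ : X ≤ Z := by
      by_contra h
      push Not at h
      exact absurd (Real.log_le_log hZ h.le) (not_le.2 hzl)
    have := hE1 hZ1 hx hzl
    rw [hEE] at this
    simpa [hXZ] using this
  by_cases hc1 : 2 * Z < X
  · have hd : Real.log 2 ≤ l - z := by
      rw [hl, hz, ← Real.log_div hX0.ne' hZ.ne']
      apply Real.log_le_log (by norm_num)
      rw [le_div_iff₀ hZ]; linarith
    apply hfin Q hQ0.le (by linarith)
    refine (hfar (by linarith)).trans ?_
    have : (E0 * E1) / (l - z) ≤ (E0 * E1) * (1 / Real.log 2) := by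
      rw [mul_one_div]; gcongr
    have p : 0 ≤ 1 / Real.log 2 := by positivity
    have q : 0 ≤ E0 + (E0 * E1) / (l - z) := by
      have : 0 < l - z := by linarith
      positivity
    calc C2 * (E0 + (E0 * E1) / (l - z)) ≤ (C1 + C2) * (E0 + (E0 * E1) * (1 / Real.log 2)) :=
          mul_le_mul (by linarith) (by linarith) q (by linarith)
      _ ≤ (C1 + C2) * ((1 + 1 / Real.log 2) * (E0 * (1 + E1) + K Z X)) := by
          gcongr
          have : 0 ≤ 1 / Real.log 2 * E0 + 1 / Real.log 2 * K Z X := by positivity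
          nlinarith
      _ = _ := by rw [hQ]; ring
  push Not at hc1
  by_cases hc2 : X < Z / 2
  · have hd : Real.log 2 ≤ z - l := by
      rw [hl, hz, ← Real.log_div hZ.ne' hX0.ne']
      apply Real.log_le_log (by norm_num)
      rw [le_div_iff₀ hX0]; linarith
    apply hfin Q hQ0.le (by linarith)
    refine (hnear (by linarith)).trans ?_
    have : (E0 * E1) / (z - l) ≤ (E0 * E1) * (1 / Real.log 2) := by
      rw [mul_one_div]; gcongr
    have p : 0 ≤ 1 / Real.log 2 := by positivity
    have q : 0 ≤ E0 + (E0 * E1) / (z - l) := by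
      have : 0 < z - l := by linarith
      positivity
    calc C1 * (E0 + (E0 * E1) / (z - l)) ≤ (C1 + C2) * (E0 + (E0 * E1) * (1 / Real.log 2)) :=
          mul_le_mul (by linarith) (by linarith) q (by linarith)
      _ ≤ (C1 + C2) * ((1 + 1 / Real.log 2) * (E0 * (1 + E1) + K Z X)) := by
          gcongr
          have : 0 ≤ 1 / Real.log 2 * E0 + 1 / Real.log 2 * K Z X := by positivity
          nlinarith
      _ = _ := by rw [hQ]; ring
  push Not at hc2
  have hK : K Z X = r / (|Z - X| + r) := by
    unfold K; rw [if_pos ⟨hc2, hc1⟩]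
  have hPb : E0 * E1 ≤ M / r := by
    rw [← hEE, hM, ← Real.exp_log hr0, ← Real.exp_sub]
    apply Real.exp_le_exp.2
    have : z - l ≤ Real.log 2 := by
      rw [hl, hz, ← Real.log_div hZ.ne' hX0.ne']
      apply Real.log_le_log (by positivity)
      rw [div_le_iff₀ hX0]; linarith
    nlinarith
  have hmid : ∀ d, |Z - X| / (2 * r ^ 2) ≤ d → r ≤ |Z - X| →
      (C1 + C2) * (E0 + (E0 * E1) / d) ≤ ((C1 + C2) * (1 + 4 * M)) * (E0 * (1 + E1) + K Z X) := by
    intro d hd hD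
    have := mid_aux hr0 hM0.le hPb hD hd
    rw [← hK] at this
    rw [mul_assoc]
    gcongr
    have : 0 ≤ E0 * E1 + K Z X + 4 * M * (E0 * (1 + E1)) := by positivity
    nlinarith
  have hC4' : (C1 + C2) * (1 + 4 * M) ≤ C4 + D4 + Q + 2 * (C3 + 2 * π) + (C1 + C2) * (1 + 4 * M) := by
    linarith
  by_cases hc3 : |Z - X| ≤ r
  · apply hfin (2 * (C3 + 2 * π)) (by positivity) (by linarith)
    have hKh : 1 / 2 ≤ K Z X := by
      rw [hK, div_le_div_iff₀ (by norm_num) (by positivity)]; linarith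
    have a := h3 σ l r hσ hσS hrS hl0 (by rw [hr2, hexpl]; exact hc2) (by
      rw [hlr, hl, hz, ← Real.log_div hZ.ne' hX0.ne']
      refine (Real.log_le_sub_one_of_pos (by positivity)).trans ?_
      rw [div_sub_one hX0.ne', div_le_div_iff₀ hX0 hr0]
      have := (le_abs_self _).trans hc3
      nlinarith)
    rw [hr2] at a
    have b : ‖((if X ≤ Z then 2 * π else 0 : ℝ) : ℂ)‖ ≤ 2 * π := by
      split_ifs
      · simp [abs_of_pos hpi]
      · simp; positivity
    refine (norm_sub_le _ _).trans ((add_le_add a b).trans ?_)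
    have : 0 ≤ E0 * (1 + E1) := by positivity
    nlinarith
  push Not at hc3
  apply hfin _ hq1 hC4'
  rcases lt_or_ge Z X with hZX | hXZ
  · have hd : |Z - X| / (2 * r ^ 2) ≤ l - z := by
      rw [abs_of_nonpos (by linarith), hl, hz, ← Real.log_div hX0.ne' hZ.ne']
      refine le_trans ?_ (Real.one_sub_inv_le_log_of_pos (by positivity))
      rw [hr2, inv_div, one_sub_div hX0.ne', div_le_div_iff₀ (by positivity) hX0]
      nlinarith
    have hd0 : 0 < l - z := lt_of_lt_of_le (div_pos (hr0.trans hc3) (by positivity)) hd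
    have q : 0 ≤ E0 + (E0 * E1) / (l - z) := by positivity
    refine (hfar (by linarith)).trans (le_trans ?_ (hmid _ hd hc3.le))
    exact mul_le_mul_of_nonneg_right (by linarith) q
  · have hd : |Z - X| / (2 * r ^ 2) ≤ z - l := by
      rw [abs_of_nonneg (by linarith), hl, hz, ← Real.log_div hZ.ne' hX0.ne']
      refine le_trans ?_ (Real.one_sub_inv_le_log_of_pos (by positivity))
      rw [hr2, inv_div, one_sub_div hZ.ne', div_le_div_iff₀ (by positivity) hZ]
      nlinarith
    have hd0 : 0 < z - l := lt_of_lt_of_le (div_pos (hr0.trans hc3) (by positivity)) hd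
    have q : 0 ≤ E0 + (E0 * E1) / (z - l) := by positivity
    refine (hnear (by linarith)).trans (le_trans ?_ (hmid _ hd hc3.le))
    exact mul_le_mul_of_nonneg_right (by linarith) q

end VIS

namespace VIS
open MeasureTheory Filter Topology Set

lemma chi_identity (s : ℂ) (n m : ℕ) (hn : 1 ≤ n) (hm : 1 ≤ m) :
    fnEqChi (1 - s) * ((n : ℂ) * (m : ℂ)) ^ (-s) =
      H (Real.log (2 * π * ((n * m : ℕ) : ℝ))) (π / 2) s +
        H (Real.log (2 * π * ((n * m : ℕ) : ℝ))) (-(π / 2)) s := by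
  have hx : (0:ℝ) < ((n * m : ℕ) : ℝ) := by exact_mod_cast Nat.mul_pos hn hm
  have h2 : (2:ℂ) ≠ 0 := two_ne_zero
  have hpi : (π:ℂ) ≠ 0 := by exact_mod_cast Real.pi_pos.ne'
  have e2 : (2:ℂ) ^ (1 - s) = 2 * cexp (-(s * ((Real.log 2 : ℝ) : ℂ))) := by
    rw [sub_eq_add_neg, Complex.cpow_add _ _ h2, Complex.cpow_one, Complex.cpow_def_of_ne_zero h2]
    rw [Complex.ofReal_log (by norm_num)]
    congr 2; push_cast; ring
  have epi : (π:ℂ) ^ (1 - s - 1) = cexp (-(s * ((Real.log π : ℝ) : ℂ))) := by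
    rw [Complex.cpow_def_of_ne_zero hpi, Complex.ofReal_log Real.pi_pos.le]
    congr 1; ring
  have enm : ((n : ℂ) * (m : ℂ)) ^ (-s) = cexp (-(s * ((Real.log ((n * m : ℕ) : ℝ) : ℝ) : ℂ))) := by
    have : ((n : ℂ) * (m : ℂ)) = ((((n * m : ℕ) : ℝ)) : ℂ) := by push_cast; ring
    rw [this, Complex.cpow_def_of_ne_zero (by exact_mod_cast hx.ne'), Complex.ofReal_log hx.le]
    congr 1; ring
  have esin : Complex.sin (π * (1 - s) / 2) =
      (cexp (-(s * ((π / 2 : ℝ) * I))) + cexp (-(s * ((-(π / 2) : ℝ) * I)))) / 2 := by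
    have : (π * (1 - s) / 2 : ℂ) = π / 2 - π * s / 2 := by ring
    rw [this, Complex.sin_pi_div_two_sub, Complex.cos, add_comm]
    push_cast
    congr 3 <;> ring
  have elog : Real.log (2 * π * ((n * m : ℕ) : ℝ)) =
      Real.log 2 + Real.log π + Real.log ((n * m : ℕ) : ℝ) := by
    rw [Real.log_mul (by positivity) hx.ne', Real.log_mul (by norm_num) Real.pi_pos.ne']
  unfold fnEqChi H
  rw [e2, epi, enm, esin, elog]
  have g1 : (1 - (1 - s)) = s := by ring
  rw [g1]
  have key : ∀ w : ℂ, cexp (-(s * (((Real.log 2 + Real.log π + Real.log ((n * m : ℕ) : ℝ) : ℝ) : ℂ) + w))) =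
      cexp (-(s * ((Real.log 2 : ℝ) : ℂ))) * cexp (-(s * ((Real.log π : ℝ) : ℂ))) *
        cexp (-(s * ((Real.log ((n * m : ℕ) : ℝ) : ℝ) : ℂ))) * cexp (-(s * w)) := by
    intro w
    rw [← Complex.exp_add, ← Complex.exp_add, ← Complex.exp_add]
    congr 1; push_cast; ring
  rw [key, key]
  ring

/-- the power `Z^(σ-1/2)` -/
noncomputable def E1 (σ Z : ℝ) : ℝ := Real.exp ((σ - 1/2) * Real.log Z)

lemma termE (S : ℝ) (hS : 1 ≤ S) : ∃ C : ℝ, 0 < C ∧ ∀ (σ β T : ℝ) (n m : ℕ), 1 ≤ σ → σ ≤ S → 0 < β →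
    0 < T → 1 ≤ n → 1 ≤ m →
    ‖(∫ t in (0:ℝ)..T, fnEqChi (1 - ((σ : ℂ) + ((β + t : ℝ) : ℂ) * I)) *
        ((n : ℂ) * (m : ℂ)) ^ (-((σ : ℂ) + ((β + t : ℝ) : ℂ) * I))) -
        (if β < 2 * π * ((n * m : ℕ) : ℝ) ∧ 2 * π * ((n * m : ℕ) : ℝ) ≤ T + β then 2 * π else 0 : ℝ)‖ ≤
      C * (Real.exp (-(Real.log (2 * π * ((n * m : ℕ) : ℝ)) * σ)) * (1 + E1 σ β + E1 σ (T + β)) +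
        K β (2 * π * ((n * m : ℕ) : ℝ)) + K (T + β) (2 * π * ((n * m : ℕ) : ℝ))) := by
  obtain ⟨C1, hC1, h1⟩ := propE S hS
  obtain ⟨C2, hC2, h2⟩ := small_bound S
  refine ⟨2 * C1 + C2, by positivity, ?_⟩
  intro σ β T n m hσ hσS hβ hT hn hm
  have hx : 1 ≤ n * m := Nat.mul_pos hn hm
  have hE1β : 0 < E1 σ β := Real.exp_pos _
  have hE1T : 0 < E1 σ (T + β) := Real.exp_pos _
  have a1 := h1 σ β (n * m) hσ hσS hβ hx
  have a2 := h1 σ (T + β) (n * m) hσ hσS (by linarith) hx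
  have hc : ∀ θ, Continuous fun t : ℝ => H (Real.log (2 * π * ((n * m : ℕ) : ℝ))) θ (σ + t * I) :=
    fun θ => continuous_H_vert _ θ σ (by linarith)
  have hid : (∫ t in (0:ℝ)..T, fnEqChi (1 - ((σ : ℂ) + ((β + t : ℝ) : ℂ) * I)) *
        ((n : ℂ) * (m : ℂ)) ^ (-((σ : ℂ) + ((β + t : ℝ) : ℂ) * I))) =
      ((∫ t in (0:ℝ)..(T + β), H (Real.log (2 * π * ((n * m : ℕ) : ℝ))) (π / 2) (σ + t * I)) -
       ∫ t in (0:ℝ)..β, H (Real.log (2 * π * ((n * m : ℕ) : ℝ))) (π / 2) (σ + t * I)) +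
       ∫ t in β..(T + β), H (Real.log (2 * π * ((n * m : ℕ) : ℝ))) (-(π / 2)) (σ + t * I) := by
    rw [intervalIntegral.integral_interval_sub_left ((hc _).intervalIntegrable _ _)
      ((hc _).intervalIntegrable _ _), ← intervalIntegral.integral_add
      ((hc _).intervalIntegrable _ _) ((hc _).intervalIntegrable _ _)]
    have := intervalIntegral.integral_comp_add_left (a := 0) (b := T) (fun t : ℝ =>
      H (Real.log (2 * π * ((n * m : ℕ) : ℝ))) (π / 2) (σ + t * I) +
        H (Real.log (2 * π * ((n * m : ℕ) : ℝ))) (-(π / 2)) (σ + t * I)) β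
    rw [add_zero, add_comm β T] at this
    rw [← this]
    congr 1; ext t
    rw [chi_identity _ n m hn hm]
  have a3 := h2 σ (Real.log (2 * π * ((n * m : ℕ) : ℝ))) β (T + β) hσ hσS hβ.le (by linarith)
  rw [hid]
  set X := 2 * π * ((n * m : ℕ) : ℝ) with hX
  have hind : ((if β < X ∧ X ≤ T + β then 2 * π else 0 : ℝ) : ℂ) =
      ((if X ≤ T + β then 2 * π else 0 : ℝ) : ℂ) - ((if X ≤ β then 2 * π else 0 : ℝ) : ℂ) := by
    by_cases q1 : X ≤ β
    · have q2 : X ≤ T + β := by linarith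
      simp [q1, q2, not_lt.2 q1]
    · simp [q1, not_le.1 q1]
  rw [hind]
  set J1 := ∫ t in (0:ℝ)..(T + β), H (Real.log X) (π / 2) (σ + t * I)
  set J2 := ∫ t in (0:ℝ)..β, H (Real.log X) (π / 2) (σ + t * I)
  set J3 := ∫ t in β..(T + β), H (Real.log X) (-(π / 2)) (σ + t * I)
  set i1 := ((if X ≤ T + β then 2 * π else 0 : ℝ) : ℂ)
  set i2 := ((if X ≤ β then 2 * π else 0 : ℝ) : ℂ)
  have e : J1 - J2 + J3 - (i1 - i2) = (J1 - i1) - (J2 - i2) + J3 := by ring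
  rw [e]
  refine (norm_add_le _ _).trans ((add_le_add (norm_sub_le _ _) le_rfl).trans
    ((add_le_add (add_le_add a2 a1) a3).trans ?_))
  have k1 := K_nonneg β X
  have k2 := K_nonneg (T + β) X
  have k3 := Real.exp_pos (-(Real.log X * σ))
  change C1 * (Real.exp (-(Real.log X * σ)) * (1 + E1 σ (T + β)) + K (T + β) X) +
    C1 * (Real.exp (-(Real.log X * σ)) * (1 + E1 σ β) + K β X) + C2 * Real.exp (-(Real.log X * σ)) ≤ _
  set E0 := Real.exp (-(Real.log X * σ))
  have : 0 ≤ C1 * (E0 * E1 σ β + E0 * E1 σ (T + β) + K β X + K (T + β) X) +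
    C2 * (E0 * E1 σ β + E0 * E1 σ (T + β) + K β X + K (T + β) X) := by positivity
  nlinarith

end VIS

namespace VIS
open MeasureTheory Filter Topology Set

lemma zeta_step (η : ℝ) (hη : 0 < η) (n : ℕ) (hn : 1 ≤ n) :
    Real.exp (-((1 + η) * Real.log ((n:ℝ) + 1))) ≤
      (1 / η) * (Real.exp (-(η * Real.log n)) - Real.exp (-(η * Real.log ((n:ℝ) + 1)))) := by
  have hn0 : (0:ℝ) < n := by exact_mod_cast hn
  set y : ℝ := (n:ℝ) + 1 with hy
  have hy0 : 0 < y := by positivity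
  have e1 : Real.exp (-((1 + η) * Real.log y)) = Real.exp (-(η * Real.log y)) * (1 / y) := by
    have : -((1 + η) * Real.log y) = -(η * Real.log y) - Real.log y := by ring
    rw [this, Real.exp_sub, Real.exp_log hy0]; ring
  have hlog : Real.log n - Real.log y ≤ - (1 / y) := by
    rw [← Real.log_div hn0.ne' hy0.ne']
    refine (Real.log_le_sub_one_of_pos (by positivity)).trans_eq ?_
    field_simp; rw [hy]; ring
  have e2 : Real.exp (-(η * Real.log y)) * (1 + η * (1 / y)) ≤ Real.exp (-(η * Real.log n)) := by
    have : -(η * Real.log n) = -(η * Real.log y) + η * (Real.log y - Real.log n) := by ring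
    rw [this, Real.exp_add]
    gcongr
    have h3 := Real.add_one_le_exp (η * (Real.log y - Real.log n))
    have : η * (1 / y) ≤ η * (Real.log y - Real.log n) := by gcongr; linarith
    linarith
  rw [e1, div_mul_eq_mul_div, one_mul, le_div_iff₀ hη]
  nlinarith

lemma zeta_partial (η : ℝ) (hη : 0 < η) (N : ℕ) (hN : 1 ≤ N) :
    ∑ n ∈ Finset.Icc 1 N, Real.exp (-((1 + η) * Real.log (n:ℝ))) ≤
      1 + (1 / η) * (1 - Real.exp (-(η * Real.log N))) := by
  induction N, hN using Nat.le_induction with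
  | base => simp
  | succ N hN ih =>
    rw [Finset.sum_Icc_succ_top (by omega)]
    have := zeta_step η hη N hN
    push_cast
    linarith

lemma sum_pnat_le (f : ℕ → ℝ) (hf : ∀ n, 0 ≤ f n) (u : Finset ℕ+) :
    ∃ N : ℕ, 1 ≤ N ∧ ∑ n ∈ u, f n ≤ ∑ n ∈ Finset.Icc 1 N, f n := by
  refine ⟨1 + ∑ n ∈ u, (n : ℕ), by omega, ?_⟩
  have hinj : Function.Injective (fun n : ℕ+ => (n : ℕ)) := PNat.coe_injective
  rw [← Finset.sum_image (f := f) (g := fun n : ℕ+ => (n : ℕ)) (fun a _ b _ h => hinj h)]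
  apply Finset.sum_le_sum_of_subset_of_nonneg
  · intro k hk
    rw [Finset.mem_image] at hk
    obtain ⟨a, ha, rfl⟩ := hk
    rw [Finset.mem_Icc]
    refine ⟨a.pos, ?_⟩
    have := Finset.single_le_sum (f := fun n : ℕ+ => (n : ℕ)) (fun i _ => Nat.zero_le _) ha
    omega
  · intros; exact hf _

lemma zeta_pnat (η : ℝ) (hη : 0 < η) (u : Finset ℕ+) :
    ∑ n ∈ u, Real.exp (-((1 + η) * Real.log ((n:ℕ):ℝ))) ≤ 1 + 1 / η := by
  obtain ⟨N, hN, h⟩ := sum_pnat_le (fun n => Real.exp (-((1 + η) * Real.log (n:ℝ))))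
    (fun n => (Real.exp_pos _).le) u
  refine h.trans ((zeta_partial η hη N hN).trans ?_)
  have : 0 < (1 / η) * Real.exp (-(η * Real.log N)) := by positivity
  linarith

lemma zeta_sq (η : ℝ) (hη : 0 < η) (u : Finset (ℕ+ × ℕ+)) :
    ∑ p ∈ u, Real.exp (-((1 + η) * Real.log ((p.1:ℕ):ℝ))) * Real.exp (-((1 + η) * Real.log ((p.2:ℕ):ℝ)))
      ≤ (1 + 1 / η) ^ 2 := by
  have hsub : u ⊆ u.image Prod.fst ×ˢ u.image Prod.snd := by
    intro p hp
    rw [Finset.mem_product]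
    exact ⟨Finset.mem_image_of_mem _ hp, Finset.mem_image_of_mem _ hp⟩
  refine (Finset.sum_le_sum_of_subset_of_nonneg hsub fun _ _ _ => by positivity).trans ?_
  rw [Finset.sum_product, ← Finset.sum_mul_sum (f := fun n : ℕ+ => Real.exp (-((1 + η) * Real.log ((n:ℕ):ℝ))))
    (g := fun n : ℕ+ => Real.exp (-((1 + η) * Real.log ((n:ℕ):ℝ)))), sq]
  exact mul_le_mul (zeta_pnat η hη _) (zeta_pnat η hη _)
    (Finset.sum_nonneg fun _ _ => (Real.exp_pos _).le) (by positivity)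

lemma harm (N : ℕ) : ∑ j ∈ Finset.Icc 1 N, 1 / (j:ℝ) ≤ 1 + Real.log N := by
  have := harmonic_le_one_add_log N
  rw [harmonic_eq_sum_Icc] at this
  push_cast at this
  simpa using this

lemma lin_sum (α r : ℝ) (hα : 0 < α) (hr : 0 < r) (N : ℕ) :
    ∑ j ∈ Finset.range (N + 1), r / (α * (j:ℝ) + r) ≤ 1 + (r / α) * (1 + Real.log N) := by
  have hh := harm N
  rw [Finset.sum_range_succ', add_comm]
  apply add_le_add
  · simp [hr.ne']
  · refine le_trans ?_ (mul_le_mul_of_nonneg_left hh (by positivity))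
    rw [Finset.mul_sum, Finset.range_eq_Ico, Finset.sum_Ico_add' (fun j : ℕ => r / (α * (j:ℝ) + r)) 0 N 1]
    have : Finset.Ico (0 + 1) (N + 1) = Finset.Icc 1 N := by ext; simp
    rw [this]
    apply Finset.sum_le_sum
    intro j hj
    have hj0 : (0:ℝ) < j := by exact_mod_cast (Finset.mem_Icc.1 hj).1
    rw [div_mul_div_comm, mul_one]
    gcongr; linarith

lemma K_row (Z : ℝ) (d : ℕ) (hd : 1 ≤ d) (hZ : 1 ≤ Z) :
    ∑ e ∈ Finset.Icc 1 ⌊Z⌋₊, K Z (2 * π * ((d * e : ℕ) : ℝ)) ≤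
      2 * (1 + (√Z / d) * (1 + Real.log Z)) := by
  have hd0 : (1:ℝ) ≤ d := by exact_mod_cast hd
  set r := √Z with hr
  have hr0 : 0 < r := Real.sqrt_pos.2 (by linarith)
  set α : ℝ := 2 * π * d with hα
  have hαd : (d:ℝ) ≤ α := by rw [hα]; nlinarith [Real.pi_gt_three]
  have hα0 : 0 < α := by linarith
  have hα1 : 1 ≤ α := by linarith
  set N := ⌊Z⌋₊ with hN
  have hN1 : 1 ≤ N := Nat.le_floor (by simpa using hZ)
  set q := ⌊Z / α⌋₊ with hq
  have hqN : q ≤ N := Nat.floor_le_floor (div_le_self (by linarith) hα1)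
  have hq1 : (q:ℝ) ≤ Z / α := Nat.floor_le (by positivity)
  have hq2 : Z / α < q + 1 := Nat.lt_floor_add_one _
  rw [le_div_iff₀ hα0] at hq1
  rw [div_lt_iff₀ hα0] at hq2
  set f : ℕ → ℝ := fun j => r / (α * (j:ℝ) + r) with hf
  have hf0 : ∀ j, 0 ≤ f j := fun j => by rw [hf]; positivity
  have hpt : ∀ e, K Z (2 * π * ((d * e : ℕ) : ℝ)) ≤ if e ≤ q then f (q - e) else f (e - (q + 1)) := by
    intro e
    have hX : 2 * π * ((d * e : ℕ) : ℝ) = α * e := by rw [hα]; push_cast; ring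
    rw [hX]
    have hK : K Z (α * e) ≤ r / (|Z - α * e| + r) := by
      unfold K; split_ifs
      · exact le_rfl
      · positivity
    refine hK.trans ?_
    split_ifs with h
    · have : (e:ℝ) ≤ q := by exact_mod_cast h
      rw [hf]; simp only
      rw [Nat.cast_sub h]
      gcongr
      refine le_trans ?_ (le_abs_self _)
      nlinarith
    · push Not at h
      have : (q:ℝ) + 1 ≤ e := by exact_mod_cast h
      rw [hf]; simp only
      rw [Nat.cast_sub (by omega)]
      have hpos : 0 ≤ α * ((e:ℝ) - ((q + 1 : ℕ) : ℝ)) :=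
        mul_nonneg hα0.le (by push_cast; linarith)
      apply div_le_div_of_nonneg_left hr0.le (by linarith)
      have := neg_le_abs (Z - α * e)
      push_cast
      nlinarith
  refine (Finset.sum_le_sum fun e _ => hpt e).trans ?_
  rw [Finset.sum_ite]
  have s1 : ∑ e ∈ Finset.Icc 1 N with e ≤ q, f (q - e) ≤ ∑ j ∈ Finset.range (N + 1), f j := by
    rw [← Finset.sum_image (f := f) (g := fun e => q - e)]
    · apply Finset.sum_le_sum_of_subset_of_nonneg
      · intro k hk
        simp only [Finset.mem_image, Finset.mem_filter, Finset.mem_Icc, Finset.mem_range] at hk ⊢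
        omega
      · intros; exact hf0 _
    · intro a ha b hb hab
      simp only [Finset.coe_filter, Finset.mem_Icc, Set.mem_ofPred_eq] at ha hb hab
      omega
  have s2 : ∑ e ∈ Finset.Icc 1 N with ¬ e ≤ q, f (e - (q + 1)) ≤ ∑ j ∈ Finset.range (N + 1), f j := by
    rw [← Finset.sum_image (f := f) (g := fun e => e - (q + 1))]
    · apply Finset.sum_le_sum_of_subset_of_nonneg
      · intro k hk
        simp only [Finset.mem_image, Finset.mem_filter, Finset.mem_Icc, Finset.mem_range] at hk ⊢
        omega
      · intros; exact hf0 _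
    · intro a ha b hb hab
      simp only [Finset.coe_filter, Finset.mem_Icc, Set.mem_ofPred_eq] at ha hb hab
      omega
  have s3 := lin_sum α r hα0 hr0 N
  have hlogN : Real.log N ≤ Real.log Z :=
    Real.log_le_log (by exact_mod_cast hN1) (Nat.floor_le (by linarith))
  have hlogN0 : 0 ≤ Real.log N := Real.log_nonneg (by exact_mod_cast hN1)
  have s4 : 1 + (r / α) * (1 + Real.log N) ≤ 1 + (r / d) * (1 + Real.log Z) := by
    gcongr
  linarith

lemma K_tri (Z : ℝ) (hZ : 1 ≤ Z) :
    ∑ d ∈ Finset.Icc 1 ⌊√Z⌋₊, ∑ e ∈ Finset.Icc 1 ⌊Z⌋₊, K Z (2 * π * ((d * e : ℕ) : ℝ)) ≤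
      4 * √Z * (1 + Real.log Z) ^ 2 := by
  have hr1 : 1 ≤ √Z := Real.one_le_sqrt.2 hZ
  set r := √Z with hr
  have hL : 0 ≤ Real.log Z := Real.log_nonneg hZ
  set R := ⌊r⌋₊ with hR
  have hR1 : 1 ≤ R := Nat.le_floor (by simpa using hr1)
  have hRr : (R:ℝ) ≤ r := Nat.floor_le (by linarith)
  have hrZ : r ≤ Z := by
    have : r ^ 2 = Z := Real.sq_sqrt (by linarith)
    nlinarith
  have hlogR : Real.log R ≤ Real.log Z := Real.log_le_log (by exact_mod_cast hR1) (hRr.trans hrZ)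
  have h1 : ∑ d ∈ Finset.Icc 1 R, ∑ e ∈ Finset.Icc 1 ⌊Z⌋₊, K Z (2 * π * ((d * e : ℕ) : ℝ)) ≤
      ∑ d ∈ Finset.Icc 1 R, (2 + 2 * r * (1 + Real.log Z) * (1 / (d:ℝ))) := by
    apply Finset.sum_le_sum
    intro d hd
    refine (K_row Z d (Finset.mem_Icc.1 hd).1 hZ).trans_eq ?_
    rw [← hr]; ring
  refine h1.trans ?_
  rw [Finset.sum_add_distrib, ← Finset.mul_sum]
  simp only [Finset.sum_const, Nat.card_Icc, nsmul_eq_mul, Nat.add_sub_cancel]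
  have h2 := harm R
  have h3 : 2 * r * (1 + Real.log Z) * ∑ i ∈ Finset.Icc 1 R, 1 / (i:ℝ) ≤
      2 * r * (1 + Real.log Z) * (1 + Real.log Z) := by
    gcongr; linarith
  have h4 : 1 ≤ (1 + Real.log Z) ^ 2 := by nlinarith
  nlinarith

lemma K_zero {Z X : ℝ} (h : K Z X ≠ 0) : X ≤ 2 * Z := by
  unfold K at h
  by_contra hc
  apply h
  rw [if_neg]
  tauto

lemma K_sum (Z : ℝ) (u : Finset (ℕ+ × ℕ+)) (hZ : 1 ≤ Z) :
    ∑ p ∈ u, K Z (2 * π * (((p.2:ℕ) * (p.1:ℕ) : ℕ) : ℝ)) ≤ 8 * √Z * (1 + Real.log Z) ^ 2 := by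
  classical
  set g : ℕ × ℕ → ℝ := fun p => K Z (2 * π * ((p.1 * p.2 : ℕ) : ℝ)) with hg
  have hg0 : ∀ p, 0 ≤ g p := fun p => K_nonneg _ _
  set B := Finset.Icc 1 ⌊√Z⌋₊ ×ˢ Finset.Icc 1 ⌊Z⌋₊ with hB
  have htri : ∑ p ∈ B, g p ≤ 4 * √Z * (1 + Real.log Z) ^ 2 := by
    rw [hB, Finset.sum_product]; exact K_tri Z hZ
  have hkey : ∀ p : ℕ+ × ℕ+, K Z (2 * π * (((p.2:ℕ) * (p.1:ℕ) : ℕ) : ℝ)) ≠ 0 →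
      ((p.1:ℕ) * (p.2:ℕ) ≤ ⌊Z⌋₊) := by
    intro p hp
    apply Nat.le_floor
    have := K_zero hp
    have h1 : (0:ℝ) < (((p.2:ℕ) * (p.1:ℕ) : ℕ) : ℝ) := by
      exact_mod_cast Nat.mul_pos p.2.pos p.1.pos
    rw [mul_comm (p.1:ℕ)]
    nlinarith [Real.pi_gt_three]
  have hsq : ∀ a b : ℕ, a ≤ b → a * b ≤ ⌊Z⌋₊ → a ≤ ⌊√Z⌋₊ := by
    intro a b hab h
    apply Nat.le_floor
    apply Real.le_sqrt_of_sq_le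
    have h1 : ((a * b : ℕ) : ℝ) ≤ Z := (Nat.le_floor_iff (by linarith)).1 h
    have h2 : (a:ℝ) ≤ b := by exact_mod_cast hab
    push_cast at h1
    nlinarith [(Nat.cast_nonneg a : (0:ℝ) ≤ a)]
  set u1 := u.filter fun p => K Z (2 * π * (((p.2:ℕ) * (p.1:ℕ) : ℕ) : ℝ)) ≠ 0 with hu1
  have e1 : ∑ p ∈ u, K Z (2 * π * (((p.2:ℕ) * (p.1:ℕ) : ℕ) : ℝ)) =
      ∑ p ∈ u1, K Z (2 * π * (((p.2:ℕ) * (p.1:ℕ) : ℕ) : ℝ)) := by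
    rw [hu1, Finset.sum_filter_ne_zero]
  rw [e1, ← Finset.sum_filter_add_sum_filter_not u1 (fun p => (p.1:ℕ) ≤ (p.2:ℕ))]
  have s1 : ∑ p ∈ u1 with (p.1:ℕ) ≤ (p.2:ℕ), K Z (2 * π * (((p.2:ℕ) * (p.1:ℕ) : ℕ) : ℝ)) ≤ ∑ p ∈ B, g p := by
    have : ∀ p ∈ u1.filter (fun p => (p.1:ℕ) ≤ (p.2:ℕ)), K Z (2 * π * (((p.2:ℕ) * (p.1:ℕ) : ℕ) : ℝ)) =
        g ((p.1:ℕ), (p.2:ℕ)) := by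
      intro p _; rw [hg]; simp only; rw [mul_comm (p.2:ℕ)]
    rw [Finset.sum_congr rfl this, ← Finset.sum_image (f := g) (g := fun p : ℕ+ × ℕ+ => ((p.1:ℕ), (p.2:ℕ)))]
    · apply Finset.sum_le_sum_of_subset_of_nonneg
      · intro k hk
        rw [Finset.mem_image] at hk
        obtain ⟨p, hp, rfl⟩ := hk
        rw [Finset.mem_filter, hu1, Finset.mem_filter] at hp
        have h1 := hkey p hp.1.2
        rw [hB, Finset.mem_product, Finset.mem_Icc, Finset.mem_Icc]
        exact ⟨⟨p.1.pos, hsq _ _ hp.2 h1⟩, p.2.pos, (Nat.le_mul_of_pos_left _ p.1.pos).trans h1⟩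
      · intros; exact hg0 _
    · intro a _ b _ hab
      simp only [Prod.mk.injEq, PNat.coe_inj] at hab
      exact Prod.ext hab.1 hab.2
  have s2 : ∑ p ∈ u1 with ¬ (p.1:ℕ) ≤ (p.2:ℕ), K Z (2 * π * (((p.2:ℕ) * (p.1:ℕ) : ℕ) : ℝ)) ≤ ∑ p ∈ B, g p := by
    have : ∀ p ∈ u1.filter (fun p => ¬ (p.1:ℕ) ≤ (p.2:ℕ)), K Z (2 * π * (((p.2:ℕ) * (p.1:ℕ) : ℕ) : ℝ)) =
        g ((p.2:ℕ), (p.1:ℕ)) := by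
      intro p _; rfl
    rw [Finset.sum_congr rfl this, ← Finset.sum_image (f := g) (g := fun p : ℕ+ × ℕ+ => ((p.2:ℕ), (p.1:ℕ)))]
    · apply Finset.sum_le_sum_of_subset_of_nonneg
      · intro k hk
        rw [Finset.mem_image] at hk
        obtain ⟨p, hp, rfl⟩ := hk
        rw [Finset.mem_filter, hu1, Finset.mem_filter] at hp
        have h1 := hkey p hp.1.2
        rw [hB, Finset.mem_product, Finset.mem_Icc, Finset.mem_Icc]
        exact ⟨⟨p.2.pos, hsq _ _ (not_le.1 hp.2).le (by rw [mul_comm]; exact h1)⟩, p.1.pos,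
          (Nat.le_mul_of_pos_right _ p.2.pos).trans h1⟩
      · intros; exact hg0 _
    · intro a _ b _ hab
      simp only [Prod.mk.injEq, PNat.coe_inj] at hab
      exact Prod.ext hab.2 hab.1
  linarith

end VIS

namespace VIS
open MeasureTheory Filter Topology Set

lemma E1_bound (A T M Z σ : ℝ) (hA : 0 < A) (hT : 2 ≤ T) (hM : 2 ≤ M) (hZ : 0 < Z) (hZM : Z ≤ 2 * M)
    (hZT : Z ≤ T ^ 3) (hσ1 : 1 ≤ σ) (hσ : σ ≤ 1 + (1 + A) / Real.log T) :
    E1 σ Z ≤ 2 * Real.exp (3 * (1 + A)) * √M := by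
  have hL : 0 < Real.log T := Real.log_pos (by linarith)
  have hsM : 1 ≤ √M := Real.one_le_sqrt.2 (by linarith)
  have he : 1 ≤ Real.exp (3 * (1 + A)) := Real.one_le_exp (by linarith)
  unfold E1
  rcases le_or_gt Z 1 with h | h
  · have : Real.exp ((σ - 1/2) * Real.log Z) ≤ 1 := by
      apply Real.exp_le_one_iff.2
      exact mul_nonpos_of_nonneg_of_nonpos (by linarith) (Real.log_nonpos hZ.le h)
    nlinarith
  · have hlz : 0 ≤ Real.log Z := Real.log_nonneg h.le
    have hlz3 : Real.log Z ≤ 3 * Real.log T := by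
      have := Real.log_le_log hZ hZT
      rwa [Real.log_pow] at this
    have h1 : (σ - 1/2) * Real.log Z ≤ 3 * (1 + A) + 1 / 2 * Real.log Z := by
      have : (σ - 1) * Real.log Z ≤ ((1 + A) / Real.log T) * (3 * Real.log T) :=
        mul_le_mul (by linarith) hlz3 hlz (by positivity)
      have e : ((1 + A) / Real.log T) * (3 * Real.log T) = 3 * (1 + A) := by field_simp
      rw [e] at this
      linarith
    refine (Real.exp_le_exp.2 h1).trans ?_
    rw [Real.exp_add]
    have h2 : Real.exp (1 / 2 * Real.log Z) = √Z := by
      rw [Real.sqrt_eq_rpow, Real.rpow_def_of_pos hZ]; congr 1; ring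
    rw [h2]
    have h3 : √Z ≤ 2 * √M := by
      apply Real.sqrt_le_iff.2 ⟨by positivity, ?_⟩
      rw [mul_pow, Real.sq_sqrt (by linarith)]; linarith
    nlinarith

lemma K_weighted (A T M Z cr : ℝ) (hA : 0 < A) (hT : 2 ≤ T) (hM : 2 ≤ M) (hZ : 0 < Z) (hZM : Z ≤ 2 * M)
    (hZT : Z ≤ T ^ 3) (hcr : |cr| ≤ A / Real.log T) (u : Finset (ℕ+ × ℕ+)) :
    ∑ p ∈ u, Real.exp (-(cr * Real.log ((p.2:ℕ):ℝ))) * K Z (2 * π * (((p.2:ℕ) * (p.1:ℕ) : ℕ) : ℝ)) ≤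
      400 * Real.exp (3 * A) * √M * Real.log T ^ 2 := by
  have hL : 0 < Real.log T := Real.log_pos (by linarith)
  have hL2 : 1 ≤ 2 * Real.log T := by
    have := Real.log_le_log (by norm_num) hT
    have := Real.log_two_gt_d9
    linarith
  have hone : ∀ p : ℕ+ × ℕ+, (1:ℝ) ≤ (((p.2:ℕ) * (p.1:ℕ) : ℕ) : ℝ) := by
    intro p
    exact_mod_cast Nat.mul_pos p.2.pos p.1.pos
  rcases lt_or_ge Z 1 with h | h
  · have : ∀ p ∈ u, Real.exp (-(cr * Real.log ((p.2:ℕ):ℝ))) * K Z (2 * π * (((p.2:ℕ) * (p.1:ℕ) : ℕ) : ℝ)) = 0 := by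
      intro p _
      by_contra hc
      have h1 := K_zero (right_ne_zero_of_mul hc)
      have := hone p
      nlinarith [Real.pi_gt_three]
    rw [Finset.sum_eq_zero this]
    positivity
  · have hpt : ∀ p ∈ u, Real.exp (-(cr * Real.log ((p.2:ℕ):ℝ))) * K Z (2 * π * (((p.2:ℕ) * (p.1:ℕ) : ℕ) : ℝ)) ≤
        Real.exp (3 * A) * K Z (2 * π * (((p.2:ℕ) * (p.1:ℕ) : ℕ) : ℝ)) := by
      intro p _
      by_cases hk : K Z (2 * π * (((p.2:ℕ) * (p.1:ℕ) : ℕ) : ℝ)) = 0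
      · rw [hk]; simp
      · apply mul_le_mul_of_nonneg_right _ (K_nonneg _ _)
        apply Real.exp_le_exp.2
        have h1 := K_zero hk
        have h2 := hone p
        have hn1 : (1:ℝ) ≤ ((p.2:ℕ):ℝ) := by exact_mod_cast p.2.pos
        have hm1 : (1:ℝ) ≤ ((p.1:ℕ):ℝ) := by exact_mod_cast p.1.pos
        have h3 : ((p.2:ℕ):ℝ) ≤ T ^ 3 := by
          push_cast at h1 h2
          nlinarith [Real.pi_gt_three]
        have h4 : Real.log ((p.2:ℕ):ℝ) ≤ 3 * Real.log T := by
          have := Real.log_le_log (by linarith) h3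
          rwa [Real.log_pow] at this
        have h5 : 0 ≤ Real.log ((p.2:ℕ):ℝ) := Real.log_nonneg hn1
        calc -(cr * Real.log ((p.2:ℕ):ℝ)) = (-cr) * Real.log ((p.2:ℕ):ℝ) := by ring
          _ ≤ (A / Real.log T) * (3 * Real.log T) :=
            mul_le_mul ((neg_le_abs cr).trans hcr) h4 h5 (by positivity)
          _ = 3 * A := by field_simp
    refine (Finset.sum_le_sum hpt).trans ?_
    rw [← Finset.mul_sum]
    have hK := K_sum Z u h
    have hlz3 : Real.log Z ≤ 3 * Real.log T := by
      have := Real.log_le_log hZ hZT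
      rwa [Real.log_pow] at this
    have hlz : 0 ≤ Real.log Z := Real.log_nonneg h
    have h3 : √Z ≤ 2 * √M := by
      apply Real.sqrt_le_iff.2 ⟨by positivity, ?_⟩
      rw [mul_pow, Real.sq_sqrt (by linarith)]; linarith
    have h4 : 1 + Real.log Z ≤ 5 * Real.log T := by linarith
    calc Real.exp (3 * A) * ∑ p ∈ u, K Z (2 * π * (((p.2:ℕ) * (p.1:ℕ) : ℕ) : ℝ))
        ≤ Real.exp (3 * A) * (8 * √Z * (1 + Real.log Z) ^ 2) := by gcongr
      _ ≤ Real.exp (3 * A) * (8 * (2 * √M) * (5 * Real.log T) ^ 2) := by gcongr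
      _ = _ := by ring

lemma err_sum (A : ℝ) (hA : 0 < A) : ∃ C : ℝ, 0 < C ∧ ∀ T β cr σ : ℝ, 2 ≤ T → 0 < β → β ≤ T ^ 2 →
    |cr| ≤ A / Real.log T → 1 + 1 / Real.log T ≤ σ → 1 + 1 / Real.log T ≤ σ + cr →
    σ ≤ 1 + (1 + A) / Real.log T → ∀ u : Finset (ℕ+ × ℕ+),
    ∑ p ∈ u, Real.exp (-(cr * Real.log ((p.2:ℕ):ℝ))) *
      (Real.exp (-(Real.log (2 * π * (((p.2:ℕ) * (p.1:ℕ) : ℕ) : ℝ)) * σ)) * (1 + E1 σ β + E1 σ (T + β)) +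
        K β (2 * π * (((p.2:ℕ) * (p.1:ℕ) : ℕ) : ℝ)) + K (T + β) (2 * π * (((p.2:ℕ) * (p.1:ℕ) : ℕ) : ℝ))) ≤
      C * √(max β T) * Real.log T ^ 2 := by
  refine ⟨9 * (1 + 4 * Real.exp (3 * (1 + A))) + 800 * Real.exp (3 * A), by positivity, ?_⟩
  intro T β cr σ hT hβ hβT hcr hσ1 hσ2 hσ3 u
  set L := Real.log T with hLdef
  have hL : 0 < L := Real.log_pos (by linarith)
  have hL2 : 1 ≤ 2 * L := by
    have := Real.log_le_log (by norm_num) hT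
    have := Real.log_two_gt_d9
    linarith
  set M := max β T with hM
  have hMT : T ≤ M := le_max_right _ _
  have hMβ : β ≤ M := le_max_left _ _
  have hM2 : 2 ≤ M := by linarith
  have hsM : 1 ≤ √M := Real.one_le_sqrt.2 (by linarith)
  have hβ3 : β ≤ T ^ 3 := by nlinarith
  have hTβ3 : T + β ≤ T ^ 3 := by nlinarith
  have hinv : 0 < 1 / L := by positivity
  have b1 := E1_bound A T M β σ hA hT hM2 hβ (by linarith) hβ3 (by linarith) hσ3
  have b2 := E1_bound A T M (T + β) σ hA hT hM2 (by linarith) (by linarith) hTβ3 (by linarith) hσ3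
  have k1 := K_weighted A T M β cr hA hT hM2 hβ (by linarith) hβ3 hcr u
  have k2 := K_weighted A T M (T + β) cr hA hT hM2 (by linarith) (by linarith) hTβ3 hcr u
  have z1 := zeta_sq (1 / L) hinv u
  set G := 1 + E1 σ β + E1 σ (T + β) with hG
  have hG0 : 0 < G := by
    have : 0 < E1 σ β := Real.exp_pos _
    have : 0 < E1 σ (T + β) := Real.exp_pos _
    positivity
  have hGb : G ≤ (1 + 4 * Real.exp (3 * (1 + A))) * √M := by rw [hG]; linarith
  have hpt : ∀ p ∈ u, Real.exp (-(cr * Real.log ((p.2:ℕ):ℝ))) *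
      (Real.exp (-(Real.log (2 * π * (((p.2:ℕ) * (p.1:ℕ) : ℕ) : ℝ)) * σ)) * G +
        K β (2 * π * (((p.2:ℕ) * (p.1:ℕ) : ℕ) : ℝ)) + K (T + β) (2 * π * (((p.2:ℕ) * (p.1:ℕ) : ℕ) : ℝ))) ≤
      G * (Real.exp (-((1 + 1 / L) * Real.log ((p.1:ℕ):ℝ))) * Real.exp (-((1 + 1 / L) * Real.log ((p.2:ℕ):ℝ))))
      + Real.exp (-(cr * Real.log ((p.2:ℕ):ℝ))) * K β (2 * π * (((p.2:ℕ) * (p.1:ℕ) : ℕ) : ℝ))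
      + Real.exp (-(cr * Real.log ((p.2:ℕ):ℝ))) * K (T + β) (2 * π * (((p.2:ℕ) * (p.1:ℕ) : ℕ) : ℝ)) := by
    intro p _
    rw [mul_add, mul_add]
    refine add_le_add (add_le_add ?_ le_rfl) le_rfl
    rw [mul_comm G, ← mul_assoc]
    refine mul_le_mul_of_nonneg_right ?_ hG0.le
    rw [← Real.exp_add, ← Real.exp_add]
    apply Real.exp_le_exp.2
    have hn1 : (1:ℝ) ≤ ((p.2:ℕ):ℝ) := by exact_mod_cast p.2.pos
    have hm1 : (1:ℝ) ≤ ((p.1:ℕ):ℝ) := by exact_mod_cast p.1.pos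
    have hln := Real.log_nonneg hn1
    have hlm := Real.log_nonneg hm1
    have hl2 : 0 ≤ Real.log (2 * π) := Real.log_nonneg (by linarith [Real.pi_gt_three])
    have elog : Real.log (2 * π * (((p.2:ℕ) * (p.1:ℕ) : ℕ) : ℝ)) =
        Real.log (2 * π) + Real.log ((p.2:ℕ):ℝ) + Real.log ((p.1:ℕ):ℝ) := by
      push_cast
      rw [Real.log_mul (by positivity : (2 * π) ≠ 0) (by positivity),
        Real.log_mul (x := ((p.2:ℕ):ℝ)) (by positivity) (by positivity)]
      ring
    rw [elog]
    have q1 : (1 + 1 / L) * Real.log ((p.1:ℕ):ℝ) ≤ σ * Real.log ((p.1:ℕ):ℝ) := by gcongr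
    have q2 : (1 + 1 / L) * Real.log ((p.2:ℕ):ℝ) ≤ (σ + cr) * Real.log ((p.2:ℕ):ℝ) := by gcongr
    have q3 : 0 ≤ Real.log (2 * π) * σ := mul_nonneg hl2 (by linarith)
    nlinarith
  refine (Finset.sum_le_sum hpt).trans ?_
  rw [Finset.sum_add_distrib, Finset.sum_add_distrib, ← Finset.mul_sum]
  have hz : (1 + 1 / (1 / L)) ^ 2 ≤ 9 * L ^ 2 := by
    rw [one_div_one_div]; nlinarith
  have h1 : G * ∑ p ∈ u, (Real.exp (-((1 + 1 / L) * Real.log ((p.1:ℕ):ℝ))) *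
      Real.exp (-((1 + 1 / L) * Real.log ((p.2:ℕ):ℝ)))) ≤
      ((1 + 4 * Real.exp (3 * (1 + A))) * √M) * (9 * L ^ 2) :=
    mul_le_mul hGb (z1.trans hz) (Finset.sum_nonneg fun _ _ => by positivity) (by positivity)
  refine (add_le_add (add_le_add h1 k1) k2).trans_eq ?_
  ring

end VIS
theorem vertical_integral_sum_asymptotic :
    ∀ A : ℝ, 0 < A → ∃ C : ℝ, 0 < C ∧
      ∀ T : ℝ, 2 ≤ T → ∀ b c : ℂ,
        |b.re| ≤ A / Real.log T → 0 < b.im → b.im ≤ T ^ 2 →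
        |c.re| ≤ A / Real.log T → |(b + c).re| ≤ A / Real.log T →
        ‖(∑' m : ℕ+, ∑' n : ℕ+,
              (n : ℂ) ^ (-c) *
                (I * ∫ t in (0:ℝ)..T,
                  fnEqChi (1 - (((1 / Real.log T + max (1 - (b + c).re) (1 - b.re) : ℝ) : ℂ)
                      + b + t * I)) *
                    ((n : ℂ) * (m : ℂ)) ^
                      (-(((1 / Real.log T + max (1 - (b + c).re) (1 - b.re) : ℝ) : ℂ)
                        + b + t * I)))) -
            2 * Real.pi * I *
              ∑ p ∈ Finset.Icc 1 ⌊(T + b.im) / (2 * Real.pi)⌋₊ ×ˢ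
                  Finset.Icc 1 ⌊(T + b.im) / (2 * Real.pi)⌋₊,
                (if (b.im / (2 * Real.pi) < (p.1 * p.2 : ℝ) ∧
                    (p.1 * p.2 : ℝ) ≤ (T + b.im) / (2 * Real.pi)) then
                  (p.2 : ℂ) ^ (-c)
                else 0)‖ ≤
          C * (max b.im T) ^ ((1:ℝ) / 2) * Real.log T ^ 2 := by
  intro A hA
  have hl2 : 0 < Real.log 2 := Real.log_pos (by norm_num)
  obtain ⟨C1, hC1, h1⟩ := VIS.termE (1 + (1 + A) / Real.log 2) (by
    have : 0 < (1 + A) / Real.log 2 := by positivity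
    linarith)
  obtain ⟨C2, hC2, h2⟩ := VIS.err_sum A hA
  refine ⟨C1 * C2, by positivity, ?_⟩
  intro T hT b c hb hβ hβT hc _
  have hL : 0 < Real.log T := Real.log_pos (by linarith)
  have hLL : Real.log 2 ≤ Real.log T := Real.log_le_log (by norm_num) hT
  set δ : ℝ := 1 / Real.log T + max (1 - (b + c).re) (1 - b.re) with hδ
  set σ : ℝ := δ + b.re with hσ
  set β := b.im with hβdef
  have hσe : σ = 1 / Real.log T + max (1 - c.re) 1 := by
    rw [hσ, hδ, add_assoc, max_add]
    congr 2
    · rw [Complex.add_re]; ring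
    · ring
  have hσ1 : 1 + 1 / Real.log T ≤ σ := by
    rw [hσe]; linarith [le_max_right (1 - c.re) 1]
  have hσ2 : 1 + 1 / Real.log T ≤ σ + c.re := by
    rw [hσe]; linarith [le_max_left (1 - c.re) 1]
  have hσ3 : σ ≤ 1 + (1 + A) / Real.log T := by
    rw [hσe, add_div]
    have : max (1 - c.re) 1 ≤ 1 + A / Real.log T := by
      apply max_le
      · linarith [neg_le_abs c.re]
      · have : 0 < A / Real.log T := by positivity
        linarith
    linarith
  have hinv : 0 < 1 / Real.log T := by positivity
  have hσS : σ ≤ 1 + (1 + A) / Real.log 2 := by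
    refine hσ3.trans ?_
    gcongr
  -- the summand
  set f : ℕ+ × ℕ+ → ℂ := fun p => ((p.2 : ℕ) : ℂ) ^ (-c) *
      (I * ∫ t in (0:ℝ)..T, fnEqChi (1 - ((δ : ℂ) + b + t * I)) *
        (((p.2 : ℕ) : ℂ) * ((p.1 : ℕ) : ℂ)) ^ (-((δ : ℂ) + b + t * I))) with hf
  set N := ⌊(T + β) / (2 * Real.pi)⌋₊ with hN
  set F : ℕ × ℕ → ℂ := fun p => if p ∈ Finset.Icc 1 N ×ˢ Finset.Icc 1 N then
      2 * Real.pi * I * (if (β / (2 * Real.pi) < (p.1 * p.2 : ℝ) ∧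
        (p.1 * p.2 : ℝ) ≤ (T + β) / (2 * Real.pi)) then (p.2 : ℂ) ^ (-c) else 0) else 0 with hF
  set φ : ℕ+ × ℕ+ → ℕ × ℕ := fun p => ((p.1 : ℕ), (p.2 : ℕ)) with hφ
  have hφinj : Function.Injective φ := by
    intro a b hab
    simp only [hφ, Prod.mk.injEq, PNat.coe_inj] at hab
    exact Prod.ext hab.1 hab.2
  have hsupp : Function.support F ⊆ Set.range φ := by
    intro p hp
    have hmem : p ∈ Finset.Icc 1 N ×ˢ Finset.Icc 1 N := by
      by_contra hcon
      apply hp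
      simp only [hF, if_neg hcon]
    rw [Finset.mem_product, Finset.mem_Icc, Finset.mem_Icc] at hmem
    exact ⟨(⟨p.1, hmem.1.1⟩, ⟨p.2, hmem.2.1⟩), rfl⟩
  have hFs : HasSum F (∑ p ∈ Finset.Icc 1 N ×ˢ Finset.Icc 1 N, F p) := by
    apply hasSum_sum_of_ne_finset_zero
    intro p hp
    simp only [hF, if_neg hp]
  have hmain : HasSum (F ∘ φ) (∑ p ∈ Finset.Icc 1 N ×ˢ Finset.Icc 1 N, F p) :=
    (hφinj.hasSum_iff (fun x hx => by
      by_contra hcon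
      exact hx (hsupp hcon))).2 hFs
  have hFsum : ∑ p ∈ Finset.Icc 1 N ×ˢ Finset.Icc 1 N, F p = 2 * Real.pi * I *
      ∑ p ∈ Finset.Icc 1 N ×ˢ Finset.Icc 1 N, (if (β / (2 * Real.pi) < (p.1 * p.2 : ℝ) ∧
        (p.1 * p.2 : ℝ) ≤ (T + β) / (2 * Real.pi)) then (p.2 : ℂ) ^ (-c) else 0) := by
    rw [Finset.mul_sum]
    apply Finset.sum_congr rfl
    intro p hp
    simp only [hF, if_pos hp]
  have hFval : ∀ p : ℕ+ × ℕ+, (F ∘ φ) p = ((p.2 : ℕ) : ℂ) ^ (-c) * (I *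
      ((if β < 2 * π * (((p.2:ℕ) * (p.1:ℕ) : ℕ) : ℝ) ∧ 2 * π * (((p.2:ℕ) * (p.1:ℕ) : ℕ) : ℝ) ≤ T + β
        then 2 * π else 0 : ℝ) : ℂ)) := by
    intro p
    have hpi : 0 < 2 * π := by positivity
    have e1 : (β / (2 * π) < (((p.1:ℕ):ℝ) * ((p.2:ℕ):ℝ))) ↔ β < 2 * π * (((p.2:ℕ) * (p.1:ℕ) : ℕ) : ℝ) := by
      rw [div_lt_iff₀ hpi]; push_cast
      constructor <;> intro h <;> linarith
    have e2 : ((((p.1:ℕ):ℝ) * ((p.2:ℕ):ℝ)) ≤ (T + β) / (2 * π)) ↔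
        2 * π * (((p.2:ℕ) * (p.1:ℕ) : ℕ) : ℝ) ≤ T + β := by
      rw [le_div_iff₀ hpi]; push_cast
      constructor <;> intro h <;> linarith
    by_cases hcond : β < 2 * π * (((p.2:ℕ) * (p.1:ℕ) : ℕ) : ℝ) ∧
        2 * π * (((p.2:ℕ) * (p.1:ℕ) : ℕ) : ℝ) ≤ T + β
    · have hcond' : β / (2 * π) < (((p.1:ℕ):ℝ) * ((p.2:ℕ):ℝ)) ∧
          (((p.1:ℕ):ℝ) * ((p.2:ℕ):ℝ)) ≤ (T + β) / (2 * π) := ⟨e1.2 hcond.1, e2.2 hcond.2⟩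
      have hfl : (p.1:ℕ) * (p.2:ℕ) ≤ N := Nat.le_floor (by push_cast; exact hcond'.2)
      have hmem : φ p ∈ Finset.Icc 1 N ×ˢ Finset.Icc 1 N := by
        rw [Finset.mem_product, Finset.mem_Icc, Finset.mem_Icc]
        exact ⟨⟨p.1.pos, (Nat.le_mul_of_pos_right _ p.2.pos).trans hfl⟩, p.2.pos,
          (Nat.le_mul_of_pos_left _ p.1.pos).trans hfl⟩
      rw [if_pos hcond, Function.comp_apply]
      simp only [hF, if_pos hmem]
      rw [if_pos hcond']
      push_cast; ring
    · have hcond' : ¬ (β / (2 * π) < (((p.1:ℕ):ℝ) * ((p.2:ℕ):ℝ)) ∧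
          (((p.1:ℕ):ℝ) * ((p.2:ℕ):ℝ)) ≤ (T + β) / (2 * π)) := by
        rw [e1, e2]; exact hcond
      rw [if_neg hcond, Function.comp_apply]
      simp only [hF, hφ]
      rw [if_neg hcond']
      simp
  set g : ℕ+ × ℕ+ → ℂ := fun p => f p - (F ∘ φ) p with hg
  have hs : ∀ t : ℝ, (δ : ℂ) + b + t * I = (σ : ℂ) + ((β + t : ℝ) : ℂ) * I := by
    intro t
    apply Complex.ext <;> simp [hσ, hβdef]
  have hgn : ∀ p, ‖g p‖ ≤ C1 * (Real.exp (-(c.re * Real.log ((p.2:ℕ):ℝ))) *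
      (Real.exp (-(Real.log (2 * π * (((p.2:ℕ) * (p.1:ℕ) : ℕ) : ℝ)) * σ)) *
        (1 + VIS.E1 σ β + VIS.E1 σ (T + β)) +
        VIS.K β (2 * π * (((p.2:ℕ) * (p.1:ℕ) : ℕ) : ℝ)) +
        VIS.K (T + β) (2 * π * (((p.2:ℕ) * (p.1:ℕ) : ℕ) : ℝ)))) := by
    intro p
    have hn1 : (0:ℝ) < ((p.2:ℕ):ℝ) := by exact_mod_cast p.2.pos
    have hb := h1 σ β T (p.2:ℕ) (p.1:ℕ) (by linarith) hσS hβ (by linarith) p.2.pos p.1.pos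
    simp only [hg, hFval, hf]
    rw [← mul_sub, ← mul_sub, norm_mul, norm_mul, Complex.norm_I, one_mul,
      Complex.norm_natCast_cpow_of_pos p.2.pos, Real.rpow_def_of_pos hn1]
    have e : Real.log ((p.2:ℕ):ℝ) * (-c).re = -(c.re * Real.log ((p.2:ℕ):ℝ)) := by
      rw [Complex.neg_re]; ring
    rw [e, mul_left_comm C1]
    apply mul_le_mul_of_nonneg_left _ (Real.exp_pos _).le
    simp only [hs]
    exact hb
  have hfin : ∀ u : Finset (ℕ+ × ℕ+), ∑ p ∈ u, ‖g p‖ ≤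
      C1 * (C2 * √(max β T) * Real.log T ^ 2) := by
    intro u
    refine (Finset.sum_le_sum fun p _ => hgn p).trans ?_
    rw [← Finset.mul_sum]
    exact mul_le_mul_of_nonneg_left (h2 T β c.re σ hT hβ hβT hc hσ1 hσ2 hσ3 u) hC1.le
  have hgsum : Summable fun p => ‖g p‖ := summable_of_sum_le (fun p => norm_nonneg _) hfin
  have hgs : Summable g := hgsum.of_norm
  have hfg : f = fun p => g p + (F ∘ φ) p := by
    ext p; simp only [hg]; ring
  have hfs : Summable f := by rw [hfg]; exact hgs.add hmain.summable
  have htsum : ∑' m : ℕ+, ∑' n : ℕ+, f (m, n) = ∑' p, g p + ∑ p ∈ Finset.Icc 1 N ×ˢ Finset.Icc 1 N, F p := by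
    rw [← hfs.tsum_prod, hfg, hgs.tsum_add hmain.summable, hmain.tsum_eq]
  rw [← hFsum]
  change ‖(∑' m : ℕ+, ∑' n : ℕ+, f (m, n)) - _‖ ≤ _
  rw [htsum, add_sub_cancel_right, ← Real.sqrt_eq_rpow]
  calc ‖∑' p, g p‖ ≤ ∑' p, ‖g p‖ := norm_tsum_le_tsum_norm hgsum
    _ ≤ C1 * (C2 * √(max β T) * Real.log T ^ 2) :=
      Real.tsum_le_of_sum_le (fun p => norm_nonneg _) hfin
    _ = _ := by ring
end
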